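/- There exists an absolute constant c > 0 with the following property: for every prime p and every set A ⊆ F_p² with |A| ≥ p^{5/4}, the pinned distance count satisfies Δ_pin(A) > c·p. -/

import Mathlib

namespace Stmt0

/-- The (algebraic) squared distance in the plane `F²`. -/
def dist2 {F : Type*} [CommRing F] (x y : F × F) : F :=
  (x.1 - y.1) ^ 2 + (x.2 - y.2) ^ 2

/-- `Δ(A;x)`, the number of distances from the pin `x` to points of `A`. -/
noncomputable def pinnedCount {F : Type*} [CommRing F] (A : Finset (F × F)) (x : F × F) : ℕ :=
  Set.ncard ((fun a => dist2 a x) '' (A : Set (F × F)))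

/-- `Δ_pin(A) = max_{x ∈ A} Δ(A;x)`. -/
noncomputable def pinnedMax {F : Type*} [CommRing F] (A : Finset (F × F)) : ℕ :=
  A.sup (fun x => pinnedCount A x)

section NullLines

open Polynomial

variable {K : Type*} [Field K]

theorem pderiv_pderiv_comm {σ : Type*} (i j : σ) (f : MvPolynomial σ K) :
    MvPolynomial.pderiv i (MvPolynomial.pderiv j f)
      = MvPolynomial.pderiv j (MvPolynomial.pderiv i f) := by
  classical
  have h : ⁅MvPolynomial.pderiv (R := K) i, MvPolynomial.pderiv (R := K) j⁆ = 0 := by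
    apply MvPolynomial.derivation_ext
    intro k
    simp only [Derivation.commutator_apply, MvPolynomial.pderiv_X, Derivation.zero_apply,
      Pi.single_apply]
    split_ifs <;> simp
  have := congrArg (fun D => D f) h
  simpa [Derivation.commutator_apply, sub_eq_zero] using this

/-- The restriction of a polynomial in three variables to the line
`t ↦ (t, b + a t, c + a² t)` with parameters `(a, b, c)`. -/
noncomputable def restrictLine (l : K × K × K) : MvPolynomial (Fin 3) K →ₐ[K] K[X] :=
  MvPolynomial.aeval ![X, C l.2.1 + C l.1 * X, C l.2.2 + C (l.1 ^ 2) * X]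

theorem derivative_restrictLine (l : K × K × K) (f : MvPolynomial (Fin 3) K) :
    derivative (restrictLine l f) =
      restrictLine l (MvPolynomial.pderiv 0 f) + C l.1 * restrictLine l (MvPolynomial.pderiv 1 f)
        + C (l.1 ^ 2) * restrictLine l (MvPolynomial.pderiv 2 f) := by
  induction f using MvPolynomial.induction_on with
  | C r => simp [restrictLine, Polynomial.algebraMap_eq]
  | add p q hp hq => simp only [map_add, hp, hq]; ring
  | mul_X p i hp =>
    simp only [map_mul, derivative_mul, hp, Derivation.leibniz, smul_eq_mul, map_add]
    have h2 : derivative (C l.1 ^ 2) = 0 := by rw [← C_pow, derivative_C]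
    fin_cases i <;> simp [restrictLine, MvPolynomial.pderiv_X, h2] <;> ring

theorem natDegree_restrictLine_le (l : K × K × K) {f : MvPolynomial (Fin 3) K} {d : ℕ}
    (hf : f.totalDegree ≤ d) : (restrictLine l f).natDegree ≤ d := by
  have := MvPolynomial.aeval_natDegree_le (m := d) (n := 1) f hf
    ![X, C l.2.1 + C l.1 * X, C l.2.2 + C (l.1 ^ 2) * X] (by
      intro i
      fin_cases i
      · simp
      · simp only [Fin.mk_one, Matrix.cons_val_one, Matrix.cons_val_zero]; compute_degree
      · simp only [Fin.reduceFinMk, Matrix.cons_val]; compute_degree)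
  simpa [restrictLine] using this

theorem eval_restrictLine (l : K × K × K) (f : MvPolynomial (Fin 3) K) (t : K) :
    (restrictLine l f).eval t
      = MvPolynomial.eval ![t, l.2.1 + l.1 * t, l.2.2 + l.1 ^ 2 * t] f := by
  induction f using MvPolynomial.induction_on with
  | C r => simp [restrictLine, Polynomial.algebraMap_eq]
  | add p q hp hq => simp [hp, hq]
  | mul_X p i hp =>
    simp only [map_mul, eval_mul, hp]
    congr 1
    fin_cases i <;> simp [restrictLine]

theorem totalDegree_pderiv_le {σ : Type*} (i : σ) (f : MvPolynomial σ K) :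
    (MvPolynomial.pderiv i f).totalDegree ≤ f.totalDegree - 1 := by
  classical
  refine Finset.sup_le fun m hm => ?_
  rw [MvPolynomial.mem_support_iff, MvPolynomial.coeff_pderiv] at hm
  have h1 := MvPolynomial.le_totalDegree (MvPolynomial.mem_support_iff.2 (left_ne_zero_of_mul hm))
  rw [Finsupp.sum_add_index' (fun _ => rfl) (fun _ _ _ => rfl), Finsupp.sum_single_index rfl] at h1
  omega

theorem eq_C_of_pderiv_eq_zero {σ : Type*} {p : ℕ} [CharP K p] {f : MvPolynomial σ K}
    (hp : f.totalDegree < p) (h : ∀ i, MvPolynomial.pderiv i f = 0) :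
    f = MvPolynomial.C (f.coeff 0) := by
  classical
  ext m
  rw [MvPolynomial.coeff_C]
  split_ifs with hm
  · rw [hm]
  · obtain ⟨i, hi⟩ : ∃ i, m i ≠ 0 := by
      by_contra! hc
      exact hm (Finsupp.ext fun i => (hc i).symm)
    by_contra hne
    have hle : m i ≤ f.totalDegree := by
      refine le_trans ?_ (MvPolynomial.le_totalDegree (MvPolynomial.mem_support_iff.2 hne))
      rw [Finsupp.sum]
      exact Finset.single_le_sum (f := fun j => m j) (fun _ _ => Nat.zero_le _)
        (Finsupp.mem_support_iff.2 hi)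
    have h0 := congrArg (MvPolynomial.coeff (m - Finsupp.single i 1)) (h i)
    have hs : m - Finsupp.single i 1 + Finsupp.single i 1 = m :=
      tsub_add_cancel_of_le (by simpa [Finsupp.single_le_iff] using Nat.one_le_iff_ne_zero.2 hi)
    rw [MvPolynomial.coeff_pderiv, hs, MvPolynomial.coeff_zero] at h0
    have h1 : ((m - Finsupp.single i 1 : σ →₀ ℕ) i : K) + 1 = (m i : K) := by
      rw [Finsupp.tsub_apply, Finsupp.single_eq_same]
      exact_mod_cast congrArg (Nat.cast (R := K)) (Nat.sub_add_cancel (Nat.one_le_iff_ne_zero.2 hi))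
    rw [h1] at h0
    rcases mul_eq_zero.1 h0 with h2 | h2
    · exact hne h2
    · rw [CharP.cast_eq_zero_iff K p] at h2
      exact absurd (Nat.le_of_dvd (Nat.pos_of_ne_zero hi) h2) (by omega)

theorem eq_C_of_derivative_eq_zero {p : ℕ} [CharP K p] {f : K[X]}
    (hp : f.natDegree < p) (h : derivative f = 0) : f = C (f.coeff 0) := by
  ext n
  rw [coeff_C]
  split_ifs with hn
  · rw [hn]
  · obtain ⟨k, rfl⟩ := Nat.exists_eq_succ_of_ne_zero hn
    by_contra hne
    have h0 := congrArg (fun g => g.coeff k) h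
    simp only [coeff_derivative, coeff_zero] at h0
    rcases mul_eq_zero.1 h0 with h2 | h2
    · exact hne h2
    · have h3 : ((k + 1 : ℕ) : K) = 0 := by exact_mod_cast h2
      rw [CharP.cast_eq_zero_iff K p] at h3
      have := Nat.le_of_dvd (Nat.succ_pos k) h3
      have := le_natDegree_of_ne_zero hne
      omega

/-- If two polynomials of degree less than the characteristic have proportional logarithmic
derivatives, they are proportional. -/
theorem eq_C_mul_of_wronskian_eq_zero {p : ℕ} [CharP K p] {g h : K[X]} (hh : h ≠ 0)
    (hgp : g.natDegree < p) (hhp : h.natDegree < p)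
    (hW : derivative g * h = g * derivative h) : ∃ k : K, g = C k * h := by
  classical
  by_cases hg : g = 0
  · exact ⟨0, by simp [hg]⟩
  obtain ⟨g₀, h₀, hco, hg₀, hh₀⟩ : ∃ g₀ h₀ : K[X], IsCoprime g₀ h₀ ∧
      g = EuclideanDomain.gcd g h * g₀ ∧ h = EuclideanDomain.gcd g h * h₀ := by
    obtain ⟨g₀, e1⟩ := EuclideanDomain.gcd_dvd_left g h
    obtain ⟨h₀, e2⟩ := EuclideanDomain.gcd_dvd_right g h
    refine ⟨g₀, h₀, ?_, e1, e2⟩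
    have hd : EuclideanDomain.gcd g h ≠ 0 := fun h0 => hg (by rw [e1, h0, zero_mul])
    have hb := EuclideanDomain.gcd_eq_gcd_ab g h
    refine ⟨EuclideanDomain.gcdA g h, EuclideanDomain.gcdB g h, ?_⟩
    apply mul_left_cancel₀ hd
    linear_combination (EuclideanDomain.gcdA g h) * (-e1) + (EuclideanDomain.gcdB g h) * (-e2) - hb
  generalize EuclideanDomain.gcd g h = D at hg₀ hh₀
  have hD : D ≠ 0 := by rintro rfl; simp at hg₀; exact hg hg₀
  have hg0 : g₀ ≠ 0 := by rintro rfl; simp at hg₀; exact hg hg₀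
  have hh0 : h₀ ≠ 0 := by rintro rfl; simp at hh₀; exact hh hh₀
  subst hg₀ hh₀
  rw [natDegree_mul hD hg0] at hgp
  rw [natDegree_mul hD hh0] at hhp
  have hW' : derivative g₀ * h₀ = g₀ * derivative h₀ := by
    have hD2 : D * D ≠ 0 := mul_ne_zero hD hD
    apply mul_left_cancel₀ hD2
    simp only [derivative_mul] at hW
    linear_combination hW
  have key : ∀ u v : K[X], IsCoprime u v → u ≠ 0 → u.natDegree < p →
      derivative u * v = u * derivative v → u = C (u.coeff 0) := by
    intro u v huv hu hup he
    apply eq_C_of_derivative_eq_zero hup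
    by_contra hne
    have hdvd : u ∣ derivative u := huv.dvd_of_dvd_mul_right ⟨derivative v, he⟩
    have h1 := natDegree_le_of_dvd hdvd hne
    by_cases h2 : u.natDegree = 0
    · exact hne (by rw [eq_C_of_natDegree_eq_zero h2, derivative_C])
    · have := natDegree_derivative_lt h2
      omega
  have e1 := key g₀ h₀ hco hg0 (by omega) hW'
  have e2 := key h₀ g₀ hco.symm hh0 (by omega) (by linear_combination -hW')
  have e3 : h₀.coeff 0 ≠ 0 := by intro h0; rw [h0, C_0] at e2; exact hh0 e2
  refine ⟨g₀.coeff 0 / h₀.coeff 0, ?_⟩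
  rw [e1, e2]
  simp only [coeff_C_zero]
  rw [mul_left_comm, ← C_mul, div_mul_cancel₀ _ e3]

/-- A rational function `m / R` with vanishing second derivative is affine, if the degrees are
small compared with the characteristic. -/
theorem affine_of_second_derivative_eq_zero {p d : ℕ} [CharP K p] {m R : K[X]} (hR : R ≠ 0)
    (hm : m.natDegree ≤ d) (hRd : R.natDegree ≤ d) (hd : 2 * d + 1 < p)
    (h : derivative (derivative m * R - m * derivative R) * R
      = 2 * derivative R * (derivative m * R - m * derivative R)) :
    ∃ k u : K, m = (C k * X + C u) * R := by
  have hWd : (derivative m * R - m * derivative R).natDegree ≤ 2 * d := by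
    have h1 := natDegree_derivative_le m
    have h2 := natDegree_derivative_le R
    refine (natDegree_sub_le _ _).trans (max_le ?_ ?_) <;>
      refine natDegree_mul_le.trans ?_ <;> omega
  have hR2 : (R ^ 2).natDegree ≤ 2 * d := natDegree_pow_le.trans (by omega)
  obtain ⟨k, hk⟩ := eq_C_mul_of_wronskian_eq_zero (p := p) (pow_ne_zero 2 hR)
    (lt_of_le_of_lt hWd (by omega)) (lt_of_le_of_lt hR2 (by omega))
    (show derivative (derivative m * R - m * derivative R) * R ^ 2 = _ by
      rw [derivative_pow]
      simp only [Nat.cast_ofNat, Nat.add_one_sub_one, pow_one, C_ofNat]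
      linear_combination R * h)
  obtain ⟨u, hu⟩ := eq_C_mul_of_wronskian_eq_zero (p := p) (g := m - C k * X * R) hR
    (by
      have : (m - C k * X * R).natDegree ≤ d + 1 := by
        refine (natDegree_sub_le _ _).trans (max_le (by omega) ?_)
        refine natDegree_mul_le.trans ?_
        have : (C k * X).natDegree ≤ 1 := by compute_degree
        omega
      omega)
    (by omega)
    (by
      simp only [derivative_sub, derivative_mul, derivative_C, derivative_X]
      linear_combination hk)
  exact ⟨k, u, by linear_combination hu⟩

theorem exists_ne_zero_forall_restrictLine_eq_zero (L : Finset (K × K × K)) {e : ℕ}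
    (h : L.card * (3 * e + 1) < (e + 1) ^ 3) :
    ∃ f : MvPolynomial (Fin 3) K, f ≠ 0 ∧ f.totalDegree ≤ 3 * e ∧
      ∀ l ∈ L, restrictLine l f = 0 := by
  classical
  let I := Fin (e + 1) × Fin (e + 1) × Fin (e + 1)
  let m : I → (Fin 3 →₀ ℕ) := fun s => Finsupp.equivFunOnFinite.symm ![s.1, s.2.1, s.2.2]
  have hm : Function.Injective m := by
    intro s s' hs
    have hs' := Finsupp.equivFunOnFinite.symm.injective hs
    have h0 := congrFun hs' 0
    have h1 := congrFun hs' 1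
    have h2 := congrFun hs' 2
    simp only [Matrix.cons_val_zero, Matrix.cons_val_one, Matrix.cons_val] at h0 h1 h2
    exact Prod.ext (Fin.ext h0) (Prod.ext (Fin.ext h1) (Fin.ext h2))
  let P : (I → K) →ₗ[K] MvPolynomial (Fin 3) K :=
    ∑ s : I, (LinearMap.toSpanSingleton K _ (MvPolynomial.monomial (m s) (1 : K))).comp
      (LinearMap.proj s)
  have hP : ∀ c, P c = ∑ s, MvPolynomial.monomial (m s) (c s) := by
    intro c
    simp [P, LinearMap.sum_apply, MvPolynomial.smul_monomial]
  have hdeg : ∀ c, (P c).totalDegree ≤ 3 * e := by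
    intro c
    rw [hP]
    refine MvPolynomial.totalDegree_finsetSum_le fun s _ => ?_
    refine (MvPolynomial.totalDegree_monomial_le _ _).trans ?_
    rw [Finsupp.sum_fintype _ _ (fun _ => rfl)]
    simp only [m, Fin.sum_univ_three, Finsupp.equivFunOnFinite_symm_apply_apply,
      Matrix.cons_val_zero, Matrix.cons_val_one, Matrix.cons_val, id]
    have := s.1.2; have := s.2.1.2; have := s.2.2.2
    omega
  let Φ : (I → K) →ₗ[K] (L × Fin (3 * e + 1) → K) :=
    LinearMap.pi fun lj => (Polynomial.lcoeff K lj.2).comp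
      ((restrictLine (lj.1 : K × K × K)).toLinearMap.comp P)
  have hker : LinearMap.ker Φ ≠ ⊥ := by
    apply LinearMap.ker_ne_bot_of_finrank_lt
    simp only [Module.finrank_fintype_fun_eq_card, Fintype.card_prod, Fintype.card_coe,
      Fintype.card_fin, I]
    calc _ < _ := h
      _ = _ := by ring
  obtain ⟨c, hc, hc0⟩ := Submodule.exists_mem_ne_zero_of_ne_bot hker
  refine ⟨P c, ?_, hdeg c, ?_⟩
  · intro h0
    apply hc0
    ext s
    have := congrArg (MvPolynomial.coeff (m s)) h0
    rw [hP, MvPolynomial.coeff_sum] at this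
    simp only [MvPolynomial.coeff_monomial, hm.eq_iff, MvPolynomial.coeff_zero] at this
    rwa [Finset.sum_eq_single s (fun b _ hb => if_neg hb) (fun h => absurd (Finset.mem_univ s) h),
      if_pos rfl] at this
  · intro l hl
    ext j
    by_cases hj : j < 3 * e + 1
    · have := congrFun (LinearMap.mem_ker.1 hc) (⟨l, hl⟩, ⟨j, hj⟩)
      simpa [Φ] using this
    · rw [coeff_zero]
      apply coeff_eq_zero_of_natDegree_lt
      have := natDegree_restrictLine_le l (hdeg c)
      omega

theorem second_derivative_identity {a b fy m xx xy xz yy yz zz : K}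
    {xxx xxy xxz xyy xyz xzz yyy yyz yzz zzz : K} (hab : a ≠ b) (hm : m ≠ 0)
    (hfy : fy = -(a + b) * m)
    (haa : xx + 2 * a * xy + 2 * a ^ 2 * xz + a ^ 2 * yy + 2 * a ^ 3 * yz + a ^ 4 * zz = 0)
    (hbb : xx + 2 * b * xy + 2 * b ^ 2 * xz + b ^ 2 * yy + 2 * b ^ 3 * yz + b ^ 4 * zz = 0)
    (haaa : (xxx + a * xxy + a ^ 2 * xxz) + 2 * a * (xxy + a * xyy + a ^ 2 * xyz)
      + 2 * a ^ 2 * (xxz + a * xyz + a ^ 2 * xzz) + a ^ 2 * (xyy + a * yyy + a ^ 2 * yyz)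
      + 2 * a ^ 3 * (xyz + a * yyz + a ^ 2 * yzz) + a ^ 4 * (xzz + a * yzz + a ^ 2 * zzz) = 0)
    {n m₁ n₁ : K} (hn : n = -(fy + b * m)) (hm₁ : m₁ = xz + b * yz + b ^ 2 * zz)
    (hn₁ : n₁ = -((xy + b * yy + b ^ 2 * yz) + b * m₁))
    (hΦ : 4 * m ^ 3 * m₁ * xx + m ^ 4 * (xxx + b * xxy + b ^ 2 * xxz)
      + 2 * (3 * m ^ 2 * m₁ * n * xy + m ^ 3 * n₁ * xy
        + m ^ 3 * n * (xxy + b * xyy + b ^ 2 * xyz))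
      + 2 * (2 * m * m₁ * n ^ 2 * xz + 2 * m ^ 2 * n * n₁ * xz
        + m ^ 2 * n ^ 2 * (xxz + b * xyz + b ^ 2 * xzz))
      + (2 * m * m₁ * n ^ 2 * yy + 2 * m ^ 2 * n * n₁ * yy
        + m ^ 2 * n ^ 2 * (xyy + b * yyy + b ^ 2 * yyz))
      + 2 * (m₁ * n ^ 3 * yz + 3 * m * n ^ 2 * n₁ * yz
        + m * n ^ 3 * (xyz + b * yyz + b ^ 2 * yzz))
      + (4 * n ^ 3 * n₁ * zz + n ^ 4 * (xzz + b * yzz + b ^ 2 * zzz)) = 0)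
    {m' R R' m'' R'' : K} (hm' : m' = xz + a * yz + a ^ 2 * zz) (hR : R = fy + 2 * a * m)
    (hR' : R' = (xy + a * yy + a ^ 2 * yz) + 2 * a * m')
    (hm'' : m'' = (xxz + a * xyz + a ^ 2 * xzz) + a * (xyz + a * yyz + a ^ 2 * yzz)
      + a ^ 2 * (xzz + a * yzz + a ^ 2 * zzz))
    (hR'' : R'' = (xxy + a * xyy + a ^ 2 * xyz) + a * (xyy + a * yyy + a ^ 2 * yyz)
      + a ^ 2 * (xyz + a * yyz + a ^ 2 * yzz) + 2 * a * m'') :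
    (m'' * R - m * R'') * R - 2 * R' * (m' * R - m * R') = 0 := by
  have hab' : a - b ≠ 0 := sub_ne_zero.2 hab
  obtain ⟨fab, hfab⟩ : ∃ s, s = xx + (a + b) * xy + (a ^ 2 + b ^ 2) * xz + a * b * yy
    + (a * b ^ 2 + a ^ 2 * b) * yz + a ^ 2 * b ^ 2 * zz := ⟨_, rfl⟩
  obtain ⟨faab, hfaab⟩ : ∃ s, s = (xxx + b * xxy + b ^ 2 * xxz)
      + 2 * a * (xxy + b * xyy + b ^ 2 * xyz)
      + 2 * a ^ 2 * (xxz + b * xyz + b ^ 2 * xzz) + a ^ 2 * (xyy + b * yyy + b ^ 2 * yyz)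
      + 2 * a ^ 3 * (xyz + b * yyz + b ^ 2 * yzz) + a ^ 4 * (xzz + b * yzz + b ^ 2 * zzz) :=
    ⟨_, rfl⟩
  have hR0 : R = (a - b) * m := by rw [hR, hfy]; ring
  have hn0 : n = a * m := by rw [hn, hfy]; ring
  have e1 : (a - b) * R' = -fab + (a - b) ^ 2 * m' := by
    rw [hR', hm', hfab]; linear_combination haa
  have e2 : (a - b) * R'' = -faab + (a - b) ^ 2 * m'' := by
    rw [hR'', hm'', hfaab]; linear_combination haaa
  have e3 : (a - b) * (n₁ - a * m₁) = -fab := by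
    rw [hn₁, hm₁, hfab]; linear_combination hbb
  have e4 : m * faab + 2 * R' * (n₁ - a * m₁) = 0 := by
    have hm3 : m ^ 3 ≠ 0 := pow_ne_zero 3 hm
    apply mul_left_cancel₀ hm3
    subst hn0
    rw [hfaab, hR', hm']
    linear_combination hΦ - 4 * m ^ 3 * m₁ * haa
  have e5 : m * faab * (a - b) = 2 * R' * fab := by
    linear_combination (a - b) * e4 - 2 * R' * e3
  apply mul_left_cancel₀ hab'
  rw [hR0]
  linear_combination (-m * (a - b) * m) * e2 + m * e5 + 2 * R' * m * e1

def Meet (l l' : K × K × K) : Prop :=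
  l.1 ≠ l'.1 ∧ l.2.2 - l'.2.2 = (l.1 + l'.1) * (l.2.1 - l'.2.1)

def meetParam (l l' : K × K × K) : K := -(l.2.1 - l'.2.1) / (l.1 - l'.1)

theorem Meet.symm {l l' : K × K × K} (h : Meet l l') : Meet l' l :=
  ⟨h.1.symm, by linear_combination -h.2⟩

theorem Meet.mul_meetParam {l l' : K × K × K} (h : Meet l l') :
    (l.1 - l'.1) * meetParam l l' = -(l.2.1 - l'.2.1) :=
  mul_div_cancel₀ _ (sub_ne_zero.2 h.1)

theorem Meet.eval_eq {l l' : K × K × K} (h : Meet l l') (f : MvPolynomial (Fin 3) K) :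
    (restrictLine l f).eval (meetParam l l') = (restrictLine l' f).eval (meetParam l l') := by
  rw [eval_restrictLine, eval_restrictLine]
  have h1 := h.mul_meetParam
  have h2 := h.2
  congr 2
  ext i
  fin_cases i
  · simp
  · simp only [Fin.mk_one, Matrix.cons_val_one, Matrix.cons_val_zero]
    linear_combination h1
  · simp only [Fin.reduceFinMk, Matrix.cons_val]
    linear_combination (l.1 + l'.1) * h1 + h2

theorem card_filter_eval_meetParam_le {g : K[X]} {l : K × K × K} {T : Finset (K × K × K)}
    (hinj : Set.InjOn (meetParam l) T) {d : ℕ} (hd : g.natDegree ≤ d) (hg : g ≠ 0)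
    [DecidablePred fun l' => g.eval (meetParam l l') = 0] :
    (T.filter fun l' => g.eval (meetParam l l') = 0).card ≤ d := by
  classical
  by_contra! h
  apply hg
  apply eq_zero_of_natDegree_lt_card_of_eval_eq_zero' g
    ((T.filter fun l' => g.eval (meetParam l l') = 0).image (meetParam l))
  · intro t ht
    obtain ⟨l', hl', rfl⟩ := Finset.mem_image.1 ht
    exact (Finset.mem_filter.1 hl').2
  · rw [Finset.card_image_of_injOn (hinj.mono (Finset.coe_subset.2 (Finset.filter_subset _ _)))]
    omega

theorem eq_zero_of_forall_eval_meetParam_eq_zero {g : K[X]} {l : K × K × K}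
    {T : Finset (K × K × K)} (hinj : Set.InjOn (meetParam l) T) (hd : g.natDegree < T.card)
    (h : ∀ l' ∈ T, g.eval (meetParam l l') = 0) : g = 0 := by
  classical
  by_contra hg
  have := card_filter_eval_meetParam_le hinj le_rfl hg
  rw [Finset.filter_true_of_mem h] at this
  omega

section Vanishing

variable {f : MvPolynomial (Fin 3) K} {l l' : K × K × K}

local notation "∂" => MvPolynomial.pderiv (R := K) (σ := Fin 3)

theorem pderiv_one_zero (g : MvPolynomial (Fin 3) K) : ∂ 1 (∂ 0 g) = ∂ 0 (∂ 1 g) :=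
  pderiv_pderiv_comm 1 0 g

theorem pderiv_two_zero (g : MvPolynomial (Fin 3) K) : ∂ 2 (∂ 0 g) = ∂ 0 (∂ 2 g) :=
  pderiv_pderiv_comm 2 0 g

theorem pderiv_two_one (g : MvPolynomial (Fin 3) K) : ∂ 2 (∂ 1 g) = ∂ 1 (∂ 2 g) :=
  pderiv_pderiv_comm 2 1 g

theorem first_derivative_eq_zero (hf : restrictLine l f = 0) :
    restrictLine l (∂ 0 f) + C l.1 * restrictLine l (∂ 1 f)
      + C (l.1 ^ 2) * restrictLine l (∂ 2 f) = 0 := by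
  rw [← derivative_restrictLine, hf, derivative_zero]

theorem second_derivative_eq_zero (hf : restrictLine l f = 0) (t : K) :
    (restrictLine l (∂ 0 (∂ 0 f))).eval t + 2 * l.1 * (restrictLine l (∂ 0 (∂ 1 f))).eval t
      + 2 * l.1 ^ 2 * (restrictLine l (∂ 0 (∂ 2 f))).eval t
      + l.1 ^ 2 * (restrictLine l (∂ 1 (∂ 1 f))).eval t
      + 2 * l.1 ^ 3 * (restrictLine l (∂ 1 (∂ 2 f))).eval t
      + l.1 ^ 4 * (restrictLine l (∂ 2 (∂ 2 f))).eval t = 0 := by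
  have h := congrArg (fun g => (derivative g).eval t) (first_derivative_eq_zero hf)
  simp only [derivative_add, derivative_mul, derivative_C, zero_mul, zero_add,
    derivative_restrictLine, eval_add, eval_mul, eval_C, derivative_zero, eval_zero,
    pderiv_one_zero, pderiv_two_zero, pderiv_two_one] at h
  linear_combination h

theorem third_derivative_eq_zero (hf : restrictLine l f = 0) (t : K) :
    ((restrictLine l (∂ 0 (∂ 0 (∂ 0 f)))).eval t + l.1 * (restrictLine l (∂ 0 (∂ 0 (∂ 1 f)))).eval t
        + l.1 ^ 2 * (restrictLine l (∂ 0 (∂ 0 (∂ 2 f)))).eval t)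
      + 2 * l.1 * ((restrictLine l (∂ 0 (∂ 0 (∂ 1 f)))).eval t
        + l.1 * (restrictLine l (∂ 0 (∂ 1 (∂ 1 f)))).eval t
        + l.1 ^ 2 * (restrictLine l (∂ 0 (∂ 1 (∂ 2 f)))).eval t)
      + 2 * l.1 ^ 2 * ((restrictLine l (∂ 0 (∂ 0 (∂ 2 f)))).eval t
        + l.1 * (restrictLine l (∂ 0 (∂ 1 (∂ 2 f)))).eval t
        + l.1 ^ 2 * (restrictLine l (∂ 0 (∂ 2 (∂ 2 f)))).eval t)
      + l.1 ^ 2 * ((restrictLine l (∂ 0 (∂ 1 (∂ 1 f)))).eval t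
        + l.1 * (restrictLine l (∂ 1 (∂ 1 (∂ 1 f)))).eval t
        + l.1 ^ 2 * (restrictLine l (∂ 1 (∂ 1 (∂ 2 f)))).eval t)
      + 2 * l.1 ^ 3 * ((restrictLine l (∂ 0 (∂ 1 (∂ 2 f)))).eval t
        + l.1 * (restrictLine l (∂ 1 (∂ 1 (∂ 2 f)))).eval t
        + l.1 ^ 2 * (restrictLine l (∂ 1 (∂ 2 (∂ 2 f)))).eval t)
      + l.1 ^ 4 * ((restrictLine l (∂ 0 (∂ 2 (∂ 2 f)))).eval t
        + l.1 * (restrictLine l (∂ 1 (∂ 2 (∂ 2 f)))).eval t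
        + l.1 ^ 2 * (restrictLine l (∂ 2 (∂ 2 (∂ 2 f)))).eval t) = 0 := by
  have h := congrArg (fun g => (derivative (derivative g)).eval t) (first_derivative_eq_zero hf)
  simp only [derivative_add, derivative_mul, derivative_C, zero_mul, zero_add,
    derivative_restrictLine, eval_add, eval_mul, eval_C, derivative_zero, eval_zero,
    pderiv_one_zero, pderiv_two_zero, pderiv_two_one] at h
  linear_combination h

theorem Meet.eval_pderiv_one (h : Meet l l') (hf : restrictLine l f = 0)
    (hf' : restrictLine l' f = 0) :
    (restrictLine l (∂ 1 f)).eval (meetParam l l')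
      = -(l.1 + l'.1) * (restrictLine l (∂ 2 f)).eval (meetParam l l') := by
  have h1 := congrArg (fun g => g.eval (meetParam l l')) (first_derivative_eq_zero hf)
  have h2 := congrArg (fun g => g.eval (meetParam l l')) (first_derivative_eq_zero hf')
  simp only [eval_add, eval_mul, eval_C, eval_zero] at h1 h2
  rw [← h.eval_eq, ← h.eval_eq, ← h.eval_eq] at h2
  apply mul_left_cancel₀ (sub_ne_zero.2 h.1)
  linear_combination h1 - h2

/-- The second fundamental form in the other null direction, cleared of denominators. -/
noncomputable def flecnode (f : MvPolynomial (Fin 3) K) (l : K × K × K) : K[X] :=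
  let m := restrictLine l (∂ 2 f)
  let n := -(restrictLine l (∂ 1 f) + C l.1 * m)
  m ^ 4 * restrictLine l (∂ 0 (∂ 0 f)) + 2 * (m ^ 3 * n * restrictLine l (∂ 0 (∂ 1 f)))
    + 2 * (m ^ 2 * n ^ 2 * restrictLine l (∂ 0 (∂ 2 f)))
    + m ^ 2 * n ^ 2 * restrictLine l (∂ 1 (∂ 1 f))
    + 2 * (m * n ^ 3 * restrictLine l (∂ 1 (∂ 2 f))) + n ^ 4 * restrictLine l (∂ 2 (∂ 2 f))

theorem natDegree_flecnode_le {D : ℕ} (hD : f.totalDegree ≤ D) :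
    (flecnode f l).natDegree ≤ 5 * D := by
  have h1 : ∀ i, (restrictLine l (∂ i f)).natDegree ≤ D := fun i =>
    natDegree_restrictLine_le l ((totalDegree_pderiv_le i f).trans (by omega))
  have h2 : ∀ i j, (restrictLine l (∂ i (∂ j f))).natDegree ≤ D := fun i j =>
    natDegree_restrictLine_le l ((totalDegree_pderiv_le i _).trans
      (by have := totalDegree_pderiv_le j f; omega))
  have hn : (-(restrictLine l (∂ 1 f) + C l.1 * restrictLine l (∂ 2 f))).natDegree ≤ D := by
    rw [natDegree_neg]
    exact (natDegree_add_le _ _).trans (max_le (h1 1) ((natDegree_C_mul_le _ _).trans (h1 2)))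
  have key : ∀ {m n g : K[X]} (i j : ℕ), m.natDegree ≤ D → n.natDegree ≤ D → g.natDegree ≤ D →
      i + j = 4 → (m ^ i * n ^ j * g).natDegree ≤ 5 * D := by
    intro m n g i j hm hn hg hij
    refine natDegree_mul_le.trans ?_
    have e1 := natDegree_mul_le (p := m ^ i) (q := n ^ j)
    have e2 := (natDegree_pow_le (p := m) (n := i)).trans (Nat.mul_le_mul_left i hm)
    have e3 := (natDegree_pow_le (p := n) (n := j)).trans (Nat.mul_le_mul_left j hn)
    have e4 : i * D + j * D = 4 * D := by rw [← add_mul, hij]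
    omega
  have two : ∀ g : K[X], g.natDegree ≤ 5 * D → (2 * g).natDegree ≤ 5 * D := by
    intro g hg
    rw [← C_ofNat]
    exact (natDegree_C_mul_le _ _).trans hg
  have k0 := key 4 0 (h1 2) hn (h2 0 0) rfl
  have k1 := two _ (key 3 1 (h1 2) hn (h2 0 1) rfl)
  have k2 := two _ (key 2 2 (h1 2) hn (h2 0 2) rfl)
  have k3 := key 2 2 (h1 2) hn (h2 1 1) rfl
  have k4 := two _ (key 1 3 (h1 2) hn (h2 1 2) rfl)
  have k5 := key 0 4 (h1 2) hn (h2 2 2) rfl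
  simp only [pow_zero, pow_one, mul_one, one_mul] at k0 k1 k2 k3 k4 k5
  exact natDegree_add_le_of_degree_le (natDegree_add_le_of_degree_le (natDegree_add_le_of_degree_le
    (natDegree_add_le_of_degree_le (natDegree_add_le_of_degree_le k0 k1) k2) k3) k4) k5

theorem Meet.eval_flecnode (h : Meet l l') (hf : restrictLine l f = 0)
    (hf' : restrictLine l' f = 0) : (flecnode f l).eval (meetParam l l') = 0 := by
  have h1 := h.eval_pderiv_one hf hf'
  have h2 := second_derivative_eq_zero hf' (meetParam l l')
  simp only [← h.eval_eq] at h2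
  simp only [flecnode, eval_add, eval_mul, eval_pow, eval_neg, eval_C, eval_ofNat, h1]
  linear_combination (eval (meetParam l l') (restrictLine l (∂ 2 f))) ^ 4 * h2

theorem Meet.eval_second_derivative (h : Meet l l') (hf : restrictLine l f = 0)
    (hf' : restrictLine l' f = 0) (hΦ : flecnode f l' = 0)
    (hm : (restrictLine l (∂ 2 f)).eval (meetParam l l') ≠ 0) {m R : K[X]}
    (hm' : m = restrictLine l (∂ 2 f))
    (hR : R = restrictLine l (∂ 1 f) + 2 * (C l.1 * restrictLine l (∂ 2 f))) :
    ((derivative (derivative m * R - m * derivative R)) * R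
      - 2 * derivative R * (derivative m * R - m * derivative R)).eval (meetParam l l') = 0 := by
  have h1 := h.eval_pderiv_one hf hf'
  have haa := second_derivative_eq_zero hf (meetParam l l')
  have hbb := second_derivative_eq_zero hf' (meetParam l l')
  have haaa := third_derivative_eq_zero hf (meetParam l l')
  have hΦ' := congrArg (fun g => (derivative g).eval (meetParam l l')) hΦ
  have two : derivative (2 : K[X]) = 0 := by rw [← C_ofNat, derivative_C]
  simp only [flecnode, derivative_add, derivative_mul, derivative_pow, derivative_neg,
    derivative_restrictLine, derivative_C, two,
    eval_add, eval_mul, eval_pow, eval_neg, eval_C, eval_ofNat, derivative_zero, eval_zero,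
    pderiv_one_zero, pderiv_two_zero, pderiv_two_one] at hΦ'
  simp only [← h.eval_eq] at hbb hΦ'
  subst hm' hR
  simp only [derivative_add, derivative_mul, derivative_sub, derivative_restrictLine,
    derivative_C, derivative_zero, two, eval_add, eval_mul, eval_sub, eval_C, eval_ofNat,
    eval_zero, pderiv_one_zero, pderiv_two_zero, pderiv_two_one]
  have := second_derivative_identity h.1 hm h1 haa hbb haaa rfl rfl rfl
    (by push_cast at hΦ'; linear_combination hΦ') rfl rfl rfl rfl rfl
  linear_combination this

end Vanishing

theorem exists_smooth_line {p D : ℕ} [CharP K p] {L : Finset (K × K × K)}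
    {Nb : K × K × K → Finset (K × K × K)} (hL : L.Nonempty) (hp : D < p)
    (hex : ∃ f : MvPolynomial (Fin 3) K, f ≠ 0 ∧ f.totalDegree ≤ D ∧ ∀ l ∈ L, restrictLine l f = 0)
    (hNb : ∀ l ∈ L, Nb l ⊆ L) (hmeet : ∀ l ∈ L, ∀ l' ∈ Nb l, Meet l l')
    (hinj : ∀ l ∈ L, Set.InjOn (meetParam l) (Nb l)) (hdeg : ∀ l ∈ L, D < (Nb l).card) :
    ∃ f : MvPolynomial (Fin 3) K, f.totalDegree ≤ D ∧ (∀ l ∈ L, restrictLine l f = 0) ∧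
      ∃ l ∈ L, restrictLine l (MvPolynomial.pderiv 2 f) ≠ 0 := by
  classical
  have hex' : ∃ d, ∃ f : MvPolynomial (Fin 3) K, f ≠ 0 ∧ f.totalDegree = d ∧
      ∀ l ∈ L, restrictLine l f = 0 := by
    obtain ⟨f, h0, -, h1⟩ := hex
    exact ⟨_, f, h0, rfl, h1⟩
  obtain ⟨f, hf0, hfd, hf⟩ := Nat.find_spec hex'
  have hmin : ∀ g : MvPolynomial (Fin 3) K, g.totalDegree < f.totalDegree →
      (∀ l ∈ L, restrictLine l g = 0) → g = 0 := by
    intro g hg hgL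
    by_contra h0
    rw [hfd] at hg
    exact Nat.find_min hex' hg ⟨g, h0, rfl, hgL⟩
  have hfD : f.totalDegree ≤ D := by
    obtain ⟨g, h0, h1, h2⟩ := hex
    rw [hfd]
    exact (Nat.find_min' hex' ⟨g, h0, rfl, h2⟩).trans h1
  refine ⟨f, hfD, hf, ?_⟩
  by_contra! hsing
  obtain ⟨l₀, hl₀⟩ := hL
  have not_C : ∀ c, f ≠ MvPolynomial.C c := by
    rintro c rfl
    have := hf l₀ hl₀
    rw [← MvPolynomial.algebraMap_eq, AlgHom.commutes] at this
    have hc : c = 0 := by simpa [Polynomial.algebraMap_eq] using this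
    exact hf0 (by rw [hc, map_zero])
  have hpos : f.totalDegree ≠ 0 := fun h =>
    not_C _ (MvPolynomial.totalDegree_eq_zero_iff_eq_C.1 h)
  have hlt : ∀ i, (MvPolynomial.pderiv i f).totalDegree < f.totalDegree := fun i => by
    have := totalDegree_pderiv_le i f
    omega
  have hz : MvPolynomial.pderiv 2 f = 0 := hmin _ (hlt 2) hsing
  have hy : MvPolynomial.pderiv 1 f = 0 := by
    refine hmin _ (hlt 1) fun l hl => ?_
    refine eq_zero_of_forall_eval_meetParam_eq_zero (hinj l hl) ?_ fun l' hl' => ?_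
    · refine lt_of_le_of_lt (natDegree_restrictLine_le l ?_) (hdeg l hl)
      have := hlt 1
      omega
    · rw [(hmeet l hl l' hl').eval_pderiv_one (hf l hl) (hf l' (hNb l hl hl')), hz]
      simp
  have hx : MvPolynomial.pderiv 0 f = 0 := by
    refine hmin _ (hlt 0) fun l hl => ?_
    have := first_derivative_eq_zero (hf l hl)
    rwa [hy, hz, map_zero, mul_zero, mul_zero, add_zero, add_zero] at this
  exact not_C _ (eq_C_of_pderiv_eq_zero (p := p) (by omega)
    (fun i => by fin_cases i; exacts [hx, hy, hz]))

/-- A finite family of null lines in which every line meets many others contains a line most of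
whose neighbours satisfy an extra linear condition. -/
theorem exists_line_affine_neighbours {p e : ℕ} [CharP K p] {L : Finset (K × K × K)}
    {Nb : K × K × K → Finset (K × K × K)} (hL : L.Nonempty)
    (hcard : L.card * (3 * e + 1) < (e + 1) ^ 3) (hp : 6 * e + 1 < p)
    (hNb : ∀ l ∈ L, Nb l ⊆ L) (hmeet : ∀ l ∈ L, ∀ l' ∈ Nb l, Meet l l')
    (hinj : ∀ l ∈ L, Set.InjOn (meetParam l) (Nb l)) (hdeg : ∀ l ∈ L, 18 * e < (Nb l).card) :
    ∃ l ∈ L, ∃ k u : K, ∃ S ⊆ Nb l, (Nb l).card ≤ S.card + 3 * e ∧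
      ∀ l' ∈ S, k * (l'.2.1 - l.2.1) + u * (l.1 - l'.1) = 1 := by
  classical
  obtain ⟨f, hfD, hf, l, hl, hsm⟩ := exists_smooth_line (p := p) (D := 3 * e) hL (by omega)
    (exists_ne_zero_forall_restrictLine_eq_zero L hcard) hNb hmeet hinj
    (fun l hl => by have := hdeg l hl; omega)
  have hfi : ∀ (l : K × K × K) i, (restrictLine l (MvPolynomial.pderiv i f)).natDegree ≤ 3 * e :=
    fun l i => natDegree_restrictLine_le l ((totalDegree_pderiv_le i f).trans (by omega))
  let good : K × K × K → Finset (K × K × K) := fun l => (Nb l).filter fun l' =>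
    ¬ (restrictLine l (MvPolynomial.pderiv 2 f)).eval (meetParam l l') = 0
  have hgood : ∀ l ∈ L, restrictLine l (MvPolynomial.pderiv 2 f) ≠ 0 →
      (Nb l).card ≤ (good l).card + 3 * e := by
    intro l hl h0
    have h1 := card_filter_eval_meetParam_le (hinj l hl) (hfi l 2) h0
    have h2 := Finset.card_filter_add_card_filter_not (s := Nb l)
      (fun l' => (restrictLine l (MvPolynomial.pderiv 2 f)).eval (meetParam l l') = 0)
    simp only [good]
    omega
  have hgsub : ∀ l, good l ⊆ Nb l := fun l => Finset.filter_subset _ _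
  have hflec : ∀ l ∈ L, restrictLine l (MvPolynomial.pderiv 2 f) ≠ 0 → flecnode f l = 0 := by
    intro l hl h0
    refine eq_zero_of_forall_eval_meetParam_eq_zero
      ((hinj l hl).mono (Finset.coe_subset.2 (hgsub l))) ?_ fun l' hl' =>
        (hmeet l hl l' (hgsub l hl')).eval_flecnode (hf l hl) (hf l' (hNb l hl (hgsub l hl')))
    have h1 := natDegree_flecnode_le (l := l) hfD
    have h2 := hgood l hl h0
    have h3 := hdeg l hl
    omega
  obtain ⟨m, hm⟩ : ∃ m, m = restrictLine l (MvPolynomial.pderiv 2 f) := ⟨_, rfl⟩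
  obtain ⟨R, hR⟩ : ∃ R, R = restrictLine l (MvPolynomial.pderiv 1 f)
    + 2 * (C l.1 * restrictLine l (MvPolynomial.pderiv 2 f)) := ⟨_, rfl⟩
  have hRd : R.natDegree ≤ 3 * e := by
    rw [hR, ← C_ofNat]
    exact (natDegree_add_le _ _).trans (max_le (hfi l 1) ((natDegree_C_mul_le _ _).trans
      ((natDegree_C_mul_le _ _).trans (hfi l 2))))
  have hmd : m.natDegree ≤ 3 * e := hm ▸ hfi l 2
  have hRe : ∀ l' ∈ good l, R.eval (meetParam l l') = (l.1 - l'.1) * m.eval (meetParam l l') := by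
    intro l' hl'
    have h1 := (hmeet l hl l' (hgsub l hl')).eval_pderiv_one (hf l hl)
      (hf l' (hNb l hl (hgsub l hl')))
    rw [hR, hm]
    simp only [eval_add, eval_mul, eval_C, eval_ofNat]
    linear_combination h1
  have hme : ∀ l' ∈ good l, m.eval (meetParam l l') ≠ 0 := by
    intro l' hl'
    rw [hm]
    exact (Finset.mem_filter.1 hl').2
  have hcg := hgood l hl hsm
  have hdl := hdeg l hl
  have hR0 : R ≠ 0 := by
    obtain ⟨l', hl'⟩ : (good l).Nonempty := Finset.card_pos.1 (by omega)
    intro h0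
    have h1 := hRe l' hl'
    rw [h0, eval_zero] at h1
    exact mul_ne_zero (sub_ne_zero.2 (hmeet l hl l' (hgsub l hl')).1) (hme l' hl') h1.symm
  obtain ⟨k, u, hku⟩ := affine_of_second_derivative_eq_zero (p := p) hR0 hmd hRd (by omega) (by
    rw [← sub_eq_zero]
    refine eq_zero_of_forall_eval_meetParam_eq_zero
      ((hinj l hl).mono (Finset.coe_subset.2 (hgsub l))) ?_ fun l' hl' => ?_
    · have h1 := natDegree_derivative_le m
      have h2 := natDegree_derivative_le R
      have h3 : (derivative m * R - m * derivative R).natDegree ≤ 6 * e := by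
        refine (natDegree_sub_le _ _).trans (max_le ?_ ?_) <;>
          refine natDegree_mul_le.trans ?_ <;> omega
      have h4 := natDegree_derivative_le (derivative m * R - m * derivative R)
      have h5 : (2 * derivative R).natDegree ≤ 3 * e := by
        rw [← C_ofNat]
        exact (natDegree_C_mul_le _ _).trans (by omega)
      refine lt_of_le_of_lt (b := 9 * e) ?_ (by omega)
      refine (natDegree_sub_le _ _).trans (max_le ?_ ?_) <;>
          refine natDegree_mul_le.trans ?_ <;> omega
    · have hl'' := hgsub l hl'
      have hM := hmeet l hl l' hl''
      have hsm' : restrictLine l' (MvPolynomial.pderiv 2 f) ≠ 0 := by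
        intro h0
        apply (Finset.mem_filter.1 hl').2
        rw [hM.eval_eq, h0, eval_zero]
      exact hM.eval_second_derivative (hf l hl) (hf l' (hNb l hl hl''))
        (hflec l' (hNb l hl hl'') hsm') (Finset.mem_filter.1 hl').2 hm hR)
  refine ⟨l, hl, k, u, good l, hgsub l, hcg, fun l' hl' => ?_⟩
  have h1 := congrArg (fun g => g.eval (meetParam l l')) hku
  simp only [eval_add, eval_mul, eval_C, eval_X] at h1
  rw [hRe l' hl'] at h1
  have h2 := (hmeet l hl l' (hgsub l hl')).mul_meetParam
  apply mul_right_cancel₀ (hme l' hl')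
  linear_combination -h1 - k * m.eval (meetParam l l') * h2

end NullLines

section Twist

open Polynomial

variable {K : Type*} [Field K]

theorem meet_of_meetParam_eq {l l' l'' : K × K × K} (h' : Meet l l') (h'' : Meet l l'')
    (ht : meetParam l l' = meetParam l l'') :
    l'.2.2 - l''.2.2 = (l'.1 + l''.1) * (l'.2.1 - l''.2.1) := by
  have e1 := h'.mul_meetParam
  have e2 := h''.mul_meetParam
  rw [← ht] at e2
  have e3 := h'.2
  have e4 := h''.2
  linear_combination e4 - e3 - (l.1 + l'.1) * e1 + (l.1 + l''.1) * e2
    + (l'.1 + l''.1) * (e1 - e2)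

/-- The null line with homogeneous parameters `(u₀, u₁, u₂, u₃)`. -/
def nullLine (u₀ u₁ u₂ u₃ : K) : K × K × K := (u₁ / u₀, u₂ / u₀, u₃ / u₀ + u₁ / u₀ * (u₂ / u₀))

theorem nullLine_incident_iff {u₀ u₁ u₂ u₃ v₀ v₁ v₂ v₃ : K} (hu : u₀ ≠ 0) (hv : v₀ ≠ 0) :
    (nullLine u₀ u₁ u₂ u₃).2.2 - (nullLine v₀ v₁ v₂ v₃).2.2
      = ((nullLine u₀ u₁ u₂ u₃).1 + (nullLine v₀ v₁ v₂ v₃).1)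
        * ((nullLine u₀ u₁ u₂ u₃).2.1 - (nullLine v₀ v₁ v₂ v₃).2.1)
      ↔ u₃ * v₀ - u₀ * v₃ - u₂ * v₁ + u₁ * v₂ = 0 := by
  simp only [nullLine]
  field_simp
  constructor <;> intro h
  · apply mul_left_cancel₀ (mul_ne_zero hu hv)
    linear_combination h
  · linear_combination u₀ * v₀ * h

/-- The twisted form on triples `(x, z, y)`, encoding the relation of having a common bisector. -/
def pairForm (r : K) (G H : K × K × K) : K :=
  r * (G.2.1 - H.2.1) + G.2.2 * H.1 - G.1 * H.2.2

def twistDet (t : K) : K := t ^ 7 - t ^ 5 + t ^ 3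

def S₀ (t : K) (G : K × K × K) : K := 1 + t * G.1 + t ^ 2 * G.2.1 + t ^ 3 * G.2.2
def S₁ (t : K) (G : K × K × K) : K := t ^ 3 * G.1 + t ^ 4
def S₂ (t : K) (G : K × K × K) : K := G.2.1 + t * G.1
def T₂ (r t : K) (H : K × K × K) : K := -(H.2.2 + t * r + (t ^ 3 - t) * r * H.2.1)
def T₃ (r t : K) (H : K × K × K) : K := t ^ 4 * T₂ r t H + twistDet t * r * H.2.1
def T₀ (r t : K) (H : K × K × K) : K := twistDet t * H.1 + t ^ 3 * T₃ r t H
def T₁ (r t : K) (H : K × K × K) : K := -t ^ 2 * T₃ r t H - twistDet t * r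

/-- The null line attached to a point of the first vertex class. -/
def leftLine (t : K) (G : K × K × K) : K × K × K := nullLine (S₀ t G) (S₁ t G) (S₂ t G) G.2.2

/-- The null line attached to a point of the second vertex class. -/
def rightLine (r t : K) (H : K × K × K) : K × K × K :=
  nullLine (T₀ r t H) (T₁ r t H) (T₂ r t H) (T₃ r t H)

theorem left_right_form (r t : K) (G H : K × K × K) :
    G.2.2 * T₀ r t H - S₀ t G * T₃ r t H - S₂ t G * T₁ r t H + S₁ t G * T₂ r t H
      = twistDet t * pairForm r G H := by
  simp only [S₀, S₁, S₂, T₀, T₁, T₂, T₃, twistDet, pairForm]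
  ring

theorem eventually_eval_ne_zero {q : K[X]} (hq : q ≠ 0) :
    ∀ᶠ t in Filter.cofinite, q.eval t ≠ 0 := by
  rw [Filter.eventually_cofinite]
  simpa using q.finite_setOfPred_isRoot hq

theorem eventually_sum_ne_zero {n : ℕ} (a : ℕ → K) {i : ℕ} (hi : i < n) (ha : a i ≠ 0) :
    ∀ᶠ t in Filter.cofinite, ∑ j ∈ Finset.range n, a j * t ^ j ≠ 0 := by
  have hq : (∑ j ∈ Finset.range n, C (a j) * X ^ j : K[X]) ≠ 0 := by
    intro h
    apply ha
    have := congrArg (fun q => q.coeff i) h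
    simpa [finsetSum_coeff, coeff_C_mul, coeff_X_pow, hi] using this
  filter_upwards [eventually_eval_ne_zero hq] with t ht
  simpa [eval_finsetSum] using ht

/-- The non-degeneracy conditions on the twisting parameter. -/
structure Generic (r t : K) (P : Finset (K × K × K)) : Prop where
  det_ne_zero : twistDet t ≠ 0
  left_ne_zero : ∀ G ∈ P, S₀ t G ≠ 0
  right_ne_zero : ∀ H ∈ P, T₀ r t H ≠ 0
  left_skew : ∀ G ∈ P, ∀ H ∈ P, G ≠ H →
    G.2.2 * S₀ t H - S₀ t G * H.2.2 - S₂ t G * S₁ t H + S₁ t G * S₂ t H ≠ 0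
  right_skew : ∀ G ∈ P, ∀ H ∈ P, G ≠ H →
    T₃ r t G * T₀ r t H - T₀ r t G * T₃ r t H - T₂ r t G * T₁ r t H + T₁ r t G * T₂ r t H ≠ 0
  direction_ne : ∀ G ∈ P, ∀ H ∈ P, S₁ t G * T₀ r t H - T₁ r t H * S₀ t G ≠ 0

theorem triple_ne {G H : K × K × K} (h : G ≠ H) :
    H.1 - G.1 ≠ 0 ∨ H.2.1 - G.2.1 ≠ 0 ∨ H.2.2 - G.2.2 ≠ 0 := by
  by_contra! hc
  simp only [sub_eq_zero] at hc
  exact h (Prod.ext hc.1.symm (Prod.ext hc.2.1.symm hc.2.2.symm))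

theorem exists_generic [Infinite K] {r : K} (hr : r ≠ 0) {P : Finset (K × K × K)}
    (hP : ∀ G ∈ P, G.1 ≠ 0) : ∃ t, Generic r t P := by
  have h0 : ∀ᶠ t : K in Filter.cofinite, t ≠ 0 := by
    simp
  have h1 : ∀ᶠ t : K in Filter.cofinite, twistDet t ≠ 0 := by
    filter_upwards [h0, eventually_sum_ne_zero (n := 5)
      (fun j => ([1, 0, -1, 0, 1] : List K).getD j 0) (i := 0) (by norm_num) (by simp)]
      with t ht h
    have e : twistDet t = t ^ 3 *
        ∑ j ∈ Finset.range 5, ([1, 0, -1, 0, 1] : List K).getD j 0 * t ^ j := by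
      simp [Finset.sum_range_succ, twistDet]; ring
    rw [e]
    exact mul_ne_zero (pow_ne_zero 3 ht) h
  have h2 : ∀ᶠ t : K in Filter.cofinite, ∀ G ∈ P, S₀ t G ≠ 0 := by
    refine (Filter.eventually_all_finset P).2 fun G _ => ?_
    filter_upwards [eventually_sum_ne_zero (n := 4)
      (fun j => [1, G.1, G.2.1, G.2.2].getD j 0) (i := 0) (by norm_num) (by simp)] with t h
    convert h using 1
    simp [Finset.sum_range_succ, S₀]; ring
  have h3 : ∀ᶠ t : K in Filter.cofinite, ∀ H ∈ P, T₀ r t H ≠ 0 := by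
    refine (Filter.eventually_all_finset P).2 fun H hH => ?_
    filter_upwards [h0, eventually_sum_ne_zero (n := 6)
      (fun j => [H.1, 0, -H.1, r * H.2.1, H.1 - H.2.2, -r].getD j 0) (i := 0) (by norm_num)
      (by simpa using hP H hH)] with t ht h
    have e : T₀ r t H = t ^ 3 * ∑ j ∈ Finset.range 6,
        [H.1, 0, -H.1, r * H.2.1, H.1 - H.2.2, -r].getD j 0 * t ^ j := by
      simp [Finset.sum_range_succ, T₀, T₃, T₂, twistDet]; ring
    rw [e]
    exact mul_ne_zero (pow_ne_zero 3 ht) h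
  have h4 : ∀ᶠ t : K in Filter.cofinite, ∀ G ∈ P, ∀ H ∈ P, G ≠ H →
      G.2.2 * S₀ t H - S₀ t G * H.2.2 - S₂ t G * S₁ t H + S₁ t G * S₂ t H ≠ 0 := by
    refine (Filter.eventually_all_finset P).2 fun G _ =>
      (Filter.eventually_all_finset P).2 fun H _ => ?_
    rw [Filter.eventually_imp_distrib_left]
    intro hne
    let a : ℕ → K := fun j => [-(H.2.2 - G.2.2), -(G.1 * H.2.2 - G.2.2 * H.1),
      -(G.2.1 * H.2.2 - G.2.2 * H.2.1), G.1 * H.2.1 - G.2.1 * H.1,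
      H.2.1 - G.2.1, H.1 - G.1].getD j 0
    have key : ∀ᶠ t in Filter.cofinite, ∑ j ∈ Finset.range 6, a j * t ^ j ≠ 0 := by
      rcases triple_ne hne with h | h | h
      · exact eventually_sum_ne_zero a (i := 5) (by norm_num) (by simpa [a] using h)
      · exact eventually_sum_ne_zero a (i := 4) (by norm_num) (by simpa [a] using h)
      · exact eventually_sum_ne_zero a (i := 0) (by norm_num) (by simpa [a] using neg_ne_zero.2 h)
    filter_upwards [key] with t h
    convert h using 1
    simp [Finset.sum_range_succ, a, S₀, S₁, S₂]; ring
  have h5 : ∀ᶠ t : K in Filter.cofinite, ∀ G ∈ P, ∀ H ∈ P, G ≠ H →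
      T₃ r t G * T₀ r t H - T₀ r t G * T₃ r t H - T₂ r t G * T₁ r t H
        + T₁ r t G * T₂ r t H ≠ 0 := by
    refine (Filter.eventually_all_finset P).2 fun G _ =>
      (Filter.eventually_all_finset P).2 fun H _ => ?_
    rw [Filter.eventually_imp_distrib_left]
    intro hne
    let a : ℕ → K := fun j => [r * (H.2.2 - G.2.2), -(r ^ 2 * (H.2.1 - G.2.1)),
      r * (G.2.1 * H.2.2 - G.2.2 * H.2.1), r * (G.2.1 * H.1 - G.1 * H.2.1),
      -(G.2.2 * H.1 - G.1 * H.2.2), -(r * (H.1 - G.1))].getD j 0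
    have key : ∀ᶠ t in Filter.cofinite, ∑ j ∈ Finset.range 6, a j * t ^ j ≠ 0 := by
      rcases triple_ne hne with h | h | h
      · exact eventually_sum_ne_zero a (i := 5) (by norm_num)
          (neg_ne_zero.2 (mul_ne_zero hr h))
      · exact eventually_sum_ne_zero a (i := 1) (by norm_num)
          (neg_ne_zero.2 (mul_ne_zero (pow_ne_zero 2 hr) h))
      · exact eventually_sum_ne_zero a (i := 0) (by norm_num)
          (mul_ne_zero hr h)
    filter_upwards [h1, key] with t ht h
    have e : T₃ r t G * T₀ r t H - T₀ r t G * T₃ r t H - T₂ r t G * T₁ r t H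
        + T₁ r t G * T₂ r t H = twistDet t * ∑ j ∈ Finset.range 6, a j * t ^ j := by
      simp [Finset.sum_range_succ, a, T₀, T₁, T₂, T₃, twistDet]; ring
    rw [e]
    exact mul_ne_zero ht h
  have h6 : ∀ᶠ t : K in Filter.cofinite, ∀ G ∈ P, ∀ H ∈ P,
      S₁ t G * T₀ r t H - T₁ r t H * S₀ t G ≠ 0 := by
    refine (Filter.eventually_all_finset P).2 fun G _ =>
      (Filter.eventually_all_finset P).2 fun H _ => ?_
    let s₀ : K[X] := 1 + X * C G.1 + X ^ 2 * C G.2.1 + X ^ 3 * C G.2.2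
    let t₂ : K[X] := -(C H.2.2 + X * C r + (X ^ 3 - X) * C r * C H.2.1)
    let d : K[X] := X ^ 4 - X ^ 2 + 1
    let t₃ : K[X] := X * t₂ + d * C r * C H.2.1
    let t₀ : K[X] := d * C H.1 + X ^ 3 * t₃
    let t₁ : K[X] := -X ^ 2 * t₃ - d * C r
    let q : K[X] := (X ^ 3 * C G.1 + X ^ 4) * t₀ - t₁ * s₀
    have hq : q ≠ 0 := by
      intro h
      have := congrArg (fun q => q.eval 0) h
      simp [q, s₀, t₀, t₁, t₃, d] at this
      exact hr this
    filter_upwards [h0, eventually_eval_ne_zero hq] with t ht h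
    have e : S₁ t G * T₀ r t H - T₁ r t H * S₀ t G = t ^ 3 * q.eval t := by
      simp [q, s₀, t₀, t₁, t₂, t₃, d, S₀, S₁, T₀, T₁, T₂, T₃, twistDet]; ring
    rw [e]
    exact mul_ne_zero (pow_ne_zero 3 ht) h
  obtain ⟨t, ⟨⟨⟨⟨h1, h2⟩, h3⟩, h4⟩, h5⟩, h6⟩ :=
    (((((h1.and h2).and h3).and h4).and h5).and h6).exists
  exact ⟨t, h1, h2, h3, h4, h5, h6⟩

/-- Triples `(x, z, y)` whose first coordinate is constant, or determines the other two affinely. -/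
def Pencil (S : Finset (K × K × K)) : Prop :=
  (∃ x, ∀ H ∈ S, H.1 = x) ∨ ∃ a b c d : K, ∀ H ∈ S, H.2.1 = a + b * H.1 ∧ H.2.2 = c + d * H.1

theorem pencil_of_linear_forms {S : Finset (K × K × K)} (α β : Fin 4 → K) (hα : α 2 ≠ 0)
    (hind : ¬ ∀ i, α 2 * β i = β 2 * α i)
    (h₁ : ∀ H ∈ S, α 0 + α 1 * H.1 + α 2 * H.2.1 + α 3 * H.2.2 = 0)
    (h₂ : ∀ H ∈ S, β 0 + β 1 * H.1 + β 2 * H.2.1 + β 3 * H.2.2 = 0) : Pencil S := by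
  obtain ⟨δ, hδ⟩ : ∃ δ : Fin 4 → K, ∀ i, δ i = α 2 * β i - β 2 * α i := ⟨_, fun _ => rfl⟩
  have hδS : ∀ H ∈ S, δ 0 + δ 1 * H.1 + δ 3 * H.2.2 = 0 := by
    intro H hH
    rw [hδ, hδ, hδ]
    linear_combination α 2 * h₂ H hH - β 2 * h₁ H hH
  by_cases h3 : δ 3 = 0
  · left
    by_cases h1 : δ 1 = 0
    · refine ⟨0, fun H hH => (hind fun i => ?_).elim⟩
      have h0 := hδS H hH
      rw [h1, h3] at h0
      rw [← sub_eq_zero, ← hδ]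
      fin_cases i
      · simpa using h0
      · exact h1
      · change δ 2 = 0
        rw [hδ]; ring
      · exact h3
    · refine ⟨-δ 0 / δ 1, fun H hH => ?_⟩
      have h0 := hδS H hH
      rw [h3] at h0
      rw [eq_div_iff h1]
      linear_combination h0
  · right
    have hy : ∀ H ∈ S, H.2.2 = -δ 0 / δ 3 + -δ 1 / δ 3 * H.1 := by
      intro H hH
      have := hδS H hH
      field_simp
      linear_combination this
    refine ⟨-(α 0 + α 3 * (-δ 0 / δ 3)) / α 2, -(α 1 + α 3 * (-δ 1 / δ 3)) / α 2, _, _,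
      fun H hH => ⟨?_, hy H hH⟩⟩
    have h1 := h₁ H hH
    rw [hy H hH] at h1
    rw [div_mul_eq_mul_div, ← add_div, eq_div_iff hα]
    linear_combination h1

theorem pencil_of_left {r t : K} {G : K × K × K} (hr : r ≠ 0) (hd : twistDet t ≠ 0)
    (hG : S₀ t G ≠ 0) {S : Finset (K × K × K)} {k u : K}
    (hS : ∀ H ∈ S, pairForm r G H = 0 ∧ T₀ r t H ≠ 0 ∧
      k * ((rightLine r t H).2.1 - (leftLine t G).2.1)
        + u * ((leftLine t G).1 - (rightLine r t H).1) = 1) : Pencil S := by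
  obtain ⟨F, hF⟩ : ∃ F : K → K → K → K → K, ∀ h₀ h₁ h₂ h₃, F h₀ h₁ h₂ h₃ =
      (k * S₀ t G) * (-(h₃ + t * r * h₀ + (t ^ 3 - t) * r * h₂))
      - (u * S₀ t G) * (-t ^ 2 * (t ^ 4 * (-(h₃ + t * r * h₀ + (t ^ 3 - t) * r * h₂))
        + twistDet t * r * h₂) - twistDet t * r * h₀)
      + (u * S₁ t G - k * S₂ t G - S₀ t G) * (twistDet t * h₁ + t ^ 3 *
        (t ^ 4 * (-(h₃ + t * r * h₀ + (t ^ 3 - t) * r * h₂)) + twistDet t * r * h₂)) :=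
    ⟨_, fun _ _ _ _ => rfl⟩
  have hcr : twistDet t * r ≠ 0 := mul_ne_zero hd hr
  refine pencil_of_linear_forms ![r * G.2.1, G.2.2, -r, -G.1]
    ![F 1 0 0 0, F 0 1 0 0, F 0 0 1 0, F 0 0 0 1] (neg_ne_zero.2 hr) ?_ ?_ ?_
  · intro h
    have e0 := h 0
    have e1 := h 1
    have e3 := h 3
    simp only [Matrix.cons_val] at e0 e1 e3
    have key : ∀ h₀ h₁ h₂ h₃, -r * F h₀ h₁ h₂ h₃ =
        F 0 0 1 0 * (r * G.2.1 * h₀ + G.2.2 * h₁ - r * h₂ - G.1 * h₃) := by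
      intro h₀ h₁ h₂ h₃
      have hlin : F h₀ h₁ h₂ h₃ = h₀ * F 1 0 0 0 + h₁ * F 0 1 0 0 + h₂ * F 0 0 1 0
          + h₃ * F 0 0 0 1 := by
        simp only [hF]; ring
      rw [hlin]
      linear_combination h₀ * e0 + h₁ * e1 + h₃ * e3
    have hb : F 0 0 1 0 = 0 := by
      have h1 := key (-t ^ 2) (-t ^ 3 * r) 1 (t * r)
      have h2 : F (-t ^ 2) (-t ^ 3 * r) 1 (t * r) = 0 := by
        rw [hF]; simp only [S₀, S₁, S₂]; ring
      have h3 : r * G.2.1 * (-t ^ 2) + G.2.2 * (-t ^ 3 * r) - r * 1 - G.1 * (t * r)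
          = -(r * S₀ t G) := by simp only [S₀]; ring
      rw [h2, h3, mul_zero] at h1
      exact (mul_eq_zero.1 h1.symm).resolve_right (neg_ne_zero.2 (mul_ne_zero hr hG))
    have hF0 : ∀ h₀ h₁ h₂ h₃, F h₀ h₁ h₂ h₃ = 0 := by
      intro h₀ h₁ h₂ h₃
      have := key h₀ h₁ h₂ h₃
      rw [hb, zero_mul] at this
      exact (mul_eq_zero.1 this).resolve_left (neg_ne_zero.2 hr)
    have hk : k = 0 := by
      have h1 := hF0 0 0 (-t ^ 4) (-(twistDet t * r) + (t ^ 3 - t) * r * t ^ 4)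
      rw [hF] at h1
      have h2 : k * (S₀ t G * (twistDet t * r)) = 0 := by linear_combination h1
      exact (mul_eq_zero.1 h2).resolve_right (mul_ne_zero hG hcr)
    have hu : u = 0 := by
      have h1 := hF0 (-1) 0 0 (t * r)
      rw [hF] at h1
      have h2 : u * (S₀ t G * (twistDet t * r)) = 0 := by linear_combination -h1
      exact (mul_eq_zero.1 h2).resolve_right (mul_ne_zero hG hcr)
    have h1 := hF0 0 1 0 0
    rw [hF, hk, hu] at h1
    exact mul_ne_zero hG hd (by linear_combination -h1)
  · intro H hH
    have := (hS H hH).1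
    simp only [Matrix.cons_val, pairForm] at this ⊢
    linear_combination this
  · intro H hH
    obtain ⟨-, hT, h⟩ := hS H hH
    simp only [leftLine, rightLine, nullLine] at h
    field_simp at h
    have hlin : F 1 H.1 H.2.1 H.2.2 = F 1 0 0 0 + F 0 1 0 0 * H.1 + F 0 0 1 0 * H.2.1
        + F 0 0 0 1 * H.2.2 := by
      simp only [hF]; ring
    simp only [Matrix.cons_val]
    rw [← hlin, hF]
    simp only [T₀, T₁, T₂, T₃] at h
    linear_combination h

theorem pencil_of_right {r t : K} {H : K × K × K} (hr : r ≠ 0) (hd : twistDet t ≠ 0)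
    (hH : T₀ r t H ≠ 0) {S : Finset (K × K × K)} {k u : K}
    (hS : ∀ G ∈ S, pairForm r G H = 0 ∧ S₀ t G ≠ 0 ∧
      k * ((leftLine t G).2.1 - (rightLine r t H).2.1)
        + u * ((rightLine r t H).1 - (leftLine t G).1) = 1) : Pencil S := by
  obtain ⟨F, hF⟩ : ∃ F : K → K → K → K → K, ∀ g₀ g₁ g₂ g₃, F g₀ g₁ g₂ g₃ =
      (k * T₀ r t H) * (g₂ + t * g₁) - (u * T₀ r t H) * (t ^ 3 * g₁ + t ^ 4 * g₀)
      + (u * T₁ r t H - k * T₂ r t H - T₀ r t H) * (g₀ + t * g₁ + t ^ 2 * g₂ + t ^ 3 * g₃) :=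
    ⟨_, fun _ _ _ _ => rfl⟩
  have ht : 1 - t ^ 2 + t ^ 4 ≠ 0 := by
    intro h0
    apply hd
    rw [twistDet]
    linear_combination t ^ 3 * h0
  refine pencil_of_linear_forms ![-(r * H.2.1), -H.2.2, r, H.1]
    ![F 1 0 0 0, F 0 1 0 0, F 0 0 1 0, F 0 0 0 1] hr ?_ ?_ ?_
  · intro h
    have e0 := h 0
    have e1 := h 1
    have e3 := h 3
    simp only [Matrix.cons_val] at e0 e1 e3
    have key : ∀ h₀ h₁ h₂ h₃, r * F h₀ h₁ h₂ h₃ =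
        F 0 0 1 0 * (-(r * H.2.1) * h₀ - H.2.2 * h₁ + r * h₂ + H.1 * h₃) := by
      intro h₀ h₁ h₂ h₃
      have hlin : F h₀ h₁ h₂ h₃ = h₀ * F 1 0 0 0 + h₁ * F 0 1 0 0 + h₂ * F 0 0 1 0
          + h₃ * F 0 0 0 1 := by
        simp only [hF]; ring
      rw [hlin]
      linear_combination h₀ * e0 + h₁ * e1 + h₃ * e3
    have hb : F 0 0 1 0 = 0 := by
      have h1 := key (-t ^ 3) (t ^ 4) (-t ^ 5) (1 - t ^ 2 + t ^ 4)
      have h2 : F (-t ^ 3) (t ^ 4) (-t ^ 5) (1 - t ^ 2 + t ^ 4) = 0 := by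
        rw [hF]; ring
      rw [h2, mul_zero] at h1
      have h3 : F 0 0 1 0 * T₀ r t H = 0 := by
        simp only [T₀, T₂, T₃, twistDet]
        linear_combination -t ^ 3 * h1
      exact (mul_eq_zero.1 h3).resolve_right hH
    have hF0 : ∀ h₀ h₁ h₂ h₃, F h₀ h₁ h₂ h₃ = 0 := by
      intro h₀ h₁ h₂ h₃
      have := key h₀ h₁ h₂ h₃
      rw [hb, zero_mul] at this
      exact (mul_eq_zero.1 this).resolve_left hr
    have hk : k = 0 := by
      have h1 := hF0 (-t ^ 2) (t ^ 3) (1 - t ^ 2) 0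
      rw [hF] at h1
      have h2 : k * (T₀ r t H * (1 - t ^ 2 + t ^ 4)) = 0 := by linear_combination h1
      exact (mul_eq_zero.1 h2).resolve_right (mul_ne_zero hH ht)
    have hu : u = 0 := by
      have h1 := hF0 (t ^ 3 - t) 1 (-t) 0
      rw [hF] at h1
      have h2 : u * (T₀ r t H * twistDet t) = 0 := by
        simp only [twistDet]
        linear_combination -h1
      exact (mul_eq_zero.1 h2).resolve_right (mul_ne_zero hH hd)
    have h1 := hF0 (-1) t (-t ^ 2) 0
    rw [hF, hk, hu] at h1
    exact mul_ne_zero hH ht (by linear_combination h1)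
  · intro G hG
    have := (hS G hG).1
    simp only [Matrix.cons_val, pairForm] at this ⊢
    linear_combination this
  · intro G hG
    obtain ⟨-, hT, h⟩ := hS G hG
    simp only [leftLine, rightLine, nullLine] at h
    field_simp at h
    have hlin : F 1 G.1 G.2.1 G.2.2 = F 1 0 0 0 + F 0 1 0 0 * G.1 + F 0 0 1 0 * G.2.1
        + F 0 0 0 1 * G.2.2 := by
      simp only [hF]; ring
    simp only [Matrix.cons_val]
    rw [← hlin, hF]
    simp only [S₀, S₁, S₂] at h ⊢
    linear_combination h

theorem exists_vertex_pencil [Infinite K] {p e : ℕ} [CharP K p] {r : K} (hr : r ≠ 0)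
    {A B : Finset (K × K × K)} (hA : ∀ G ∈ A, G.1 ≠ 0) (hB : ∀ H ∈ B, H.1 ≠ 0)
    (hne : A.Nonempty ∨ B.Nonempty) (hcard : (A.card + B.card) * (3 * e + 1) < (e + 1) ^ 3)
    (hp : 6 * e + 1 < p) {E : K × K × K → K × K × K → Prop} [DecidableRel E]
    (hE : ∀ G H, E G H → pairForm r G H = 0)
    (hdA : ∀ G ∈ A, 18 * e < (B.filter fun H => E G H).card)
    (hdB : ∀ H ∈ B, 18 * e < (A.filter fun G => E G H).card) :
    (∃ G ∈ A, ∃ S ⊆ B.filter (fun H => E G H),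
        (B.filter fun H => E G H).card ≤ S.card + 3 * e ∧ Pencil S) ∨
      ∃ H ∈ B, ∃ S ⊆ A.filter (fun G => E G H),
        (A.filter fun G => E G H).card ≤ S.card + 3 * e ∧ Pencil S := by
  classical
  obtain ⟨t, ht⟩ := exists_generic hr (P := A ∪ B) (fun G hG =>
    (Finset.mem_union.1 hG).elim (hA G) (hB G))
  have iA : ∀ {G}, G ∈ A → G ∈ A ∪ B := fun h => Finset.mem_union_left _ h
  have iB : ∀ {G}, G ∈ B → G ∈ A ∪ B := fun h => Finset.mem_union_right _ h
  have injL : ∀ G ∈ A, ∀ G' ∈ A, (leftLine t G).2.2 - (leftLine t G').2.2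
      = ((leftLine t G).1 + (leftLine t G').1) * ((leftLine t G).2.1 - (leftLine t G').2.1) →
      G = G' := by
    intro G hG G' hG' h
    by_contra hne
    exact ht.left_skew G (iA hG) G' (iA hG') hne
      ((nullLine_incident_iff (ht.left_ne_zero G (iA hG)) (ht.left_ne_zero G' (iA hG'))).1 h)
  have injR : ∀ H ∈ B, ∀ H' ∈ B, (rightLine r t H).2.2 - (rightLine r t H').2.2
      = ((rightLine r t H).1 + (rightLine r t H').1)
        * ((rightLine r t H).2.1 - (rightLine r t H').2.1) → H = H' := by
    intro G hG G' hG' h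
    by_contra hne
    exact ht.right_skew G (iB hG) G' (iB hG') hne
      ((nullLine_incident_iff (ht.right_ne_zero G (iB hG)) (ht.right_ne_zero G' (iB hG'))).1 h)
  have injL' : Set.InjOn (leftLine t) A := fun G hG G' hG' h => injL G hG G' hG' (by rw [h]; ring)
  have injR' : Set.InjOn (rightLine r t) B :=
    fun G hG G' hG' h => injR G hG G' hG' (by rw [h]; ring)
  have hdir : ∀ G ∈ A, ∀ H ∈ B, (leftLine t G).1 ≠ (rightLine r t H).1 := by
    intro G hG H hH h
    apply ht.direction_ne G (iA hG) H (iB hH)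
    simp only [leftLine, rightLine, nullLine] at h
    rw [div_eq_div_iff (ht.left_ne_zero G (iA hG)) (ht.right_ne_zero H (iB hH))] at h
    exact sub_eq_zero.2 h
  have hmeetE : ∀ G ∈ A, ∀ H ∈ B, E G H → Meet (leftLine t G) (rightLine r t H) := by
    intro G hG H hH h
    refine ⟨hdir G hG H hH, (nullLine_incident_iff (ht.left_ne_zero G (iA hG))
      (ht.right_ne_zero H (iB hH))).2 ?_⟩
    rw [left_right_form, hE G H h, mul_zero]
  let Nb : K × K × K → Finset (K × K × K) := fun l =>
    ((A.filter fun G => leftLine t G = l).biUnion fun G =>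
      (B.filter fun H => E G H).image (rightLine r t)) ∪
    (B.filter fun H => rightLine r t H = l).biUnion fun H =>
      (A.filter fun G => E G H).image (leftLine t)
  have NbL : ∀ G ∈ A, Nb (leftLine t G) = (B.filter fun H => E G H).image (rightLine r t) := by
    intro G hG
    have h1 : (A.filter fun G' => leftLine t G' = leftLine t G) = {G} := by
      ext G'
      simp only [Finset.mem_filter, Finset.mem_singleton]
      exact ⟨fun h => injL' h.1 hG h.2, by rintro rfl; exact ⟨hG, rfl⟩⟩
    have h2 : (B.filter fun H => rightLine r t H = leftLine t G) = ∅ := by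
      refine Finset.filter_false_of_mem fun H hH h => hdir G hG H hH (by rw [h])
    simp only [Nb]
    rw [h1, h2, Finset.singleton_biUnion, Finset.biUnion_empty, Finset.union_empty]
  have NbR : ∀ H ∈ B, Nb (rightLine r t H) = (A.filter fun G => E G H).image (leftLine t) := by
    intro H hH
    have h1 : (B.filter fun H' => rightLine r t H' = rightLine r t H) = {H} := by
      ext G'
      simp only [Finset.mem_filter, Finset.mem_singleton]
      exact ⟨fun h => injR' h.1 hH h.2, by rintro rfl; exact ⟨hH, rfl⟩⟩
    have h2 : (A.filter fun G => leftLine t G = rightLine r t H) = ∅ := by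
      refine Finset.filter_false_of_mem fun G hG h => hdir G hG H hH (by rw [h])
    simp only [Nb]
    rw [h1, h2, Finset.singleton_biUnion, Finset.biUnion_empty, Finset.empty_union]
  have fB : ∀ G, ((B.filter fun H => E G H : Finset _) : Set (K × K × K)) ⊆ B :=
    fun G => Finset.coe_subset.2 (Finset.filter_subset _ _)
  have fA : ∀ H, ((A.filter fun G => E G H : Finset _) : Set (K × K × K)) ⊆ A :=
    fun G => Finset.coe_subset.2 (Finset.filter_subset _ _)
  have cases : ∀ l ∈ A.image (leftLine t) ∪ B.image (rightLine r t),
      (∃ G ∈ A, l = leftLine t G) ∨ ∃ H ∈ B, l = rightLine r t H := by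
    intro l hl
    rcases Finset.mem_union.1 hl with h | h <;> obtain ⟨G, hG, rfl⟩ := Finset.mem_image.1 h
    exacts [Or.inl ⟨G, hG, rfl⟩, Or.inr ⟨G, hG, rfl⟩]
  have hmeet : ∀ l ∈ A.image (leftLine t) ∪ B.image (rightLine r t), ∀ l' ∈ Nb l, Meet l l' := by
    intro l hl l' hl'
    rcases cases l hl with ⟨G, hG, rfl⟩ | ⟨H, hH, rfl⟩
    · rw [NbL G hG] at hl'
      obtain ⟨H, hH, rfl⟩ := Finset.mem_image.1 hl'
      exact hmeetE G hG H (fB G hH) (Finset.mem_filter.1 hH).2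
    · rw [NbR H hH] at hl'
      obtain ⟨G, hG, rfl⟩ := Finset.mem_image.1 hl'
      exact (hmeetE G (fA H hG) H hH (Finset.mem_filter.1 hG).2).symm
  obtain ⟨l, hl, k, u, S, hS, hcS, hSl⟩ := exists_line_affine_neighbours (p := p) (e := e)
    (L := A.image (leftLine t) ∪ B.image (rightLine r t)) (Nb := Nb)
    (by
      rw [Finset.union_nonempty, Finset.image_nonempty, Finset.image_nonempty]
      exact hne)
    (by
      refine lt_of_le_of_lt (Nat.mul_le_mul_right _ ?_) hcard
      exact (Finset.card_union_le _ _).trans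
        (add_le_add Finset.card_image_le Finset.card_image_le))
    hp
    (by
      intro l hl
      rcases cases l hl with ⟨G, hG, rfl⟩ | ⟨H, hH, rfl⟩
      · rw [NbL G hG]
        exact (Finset.image_subset_image (Finset.filter_subset _ _)).trans
          Finset.subset_union_right
      · rw [NbR H hH]
        exact (Finset.image_subset_image (Finset.filter_subset _ _)).trans
          Finset.subset_union_left)
    hmeet
    (by
      intro l hl l' hl' l'' hl'' h
      have hh := meet_of_meetParam_eq (hmeet l hl l' hl') (hmeet l hl l'' hl'') h
      rcases cases l hl with ⟨G, hG, rfl⟩ | ⟨H, hH, rfl⟩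
      · rw [NbL G hG] at hl' hl''
        obtain ⟨H', hH', rfl⟩ := Finset.mem_image.1 hl'
        obtain ⟨H'', hH'', rfl⟩ := Finset.mem_image.1 hl''
        rw [injR H' (fB G hH') H'' (fB G hH'') hh]
      · rw [NbR H hH] at hl' hl''
        obtain ⟨H', hH', rfl⟩ := Finset.mem_image.1 hl'
        obtain ⟨H'', hH'', rfl⟩ := Finset.mem_image.1 hl''
        rw [injL H' (fA H hH') H'' (fA H hH'') hh])
    (by
      intro l hl
      rcases cases l hl with ⟨G, hG, rfl⟩ | ⟨H, hH, rfl⟩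
      · rw [NbL G hG, Finset.card_image_of_injOn (injR'.mono (fB G))]
        exact hdA G hG
      · rw [NbR H hH, Finset.card_image_of_injOn (injL'.mono (fA H))]
        exact hdB H hH)
  rcases cases l hl with ⟨G, hG, rfl⟩ | ⟨H, hH, rfl⟩
  · rw [NbL G hG] at hS hcS
    obtain ⟨S', hS', rfl⟩ := Finset.subset_image_iff.1 hS
    have hS'' : S' ⊆ B.filter fun H => E G H := Finset.coe_subset.1 hS'
    rw [Finset.card_image_of_injOn (injR'.mono (fB G)),
      Finset.card_image_of_injOn (injR'.mono (hS'.trans (fB G)))] at hcS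
    refine Or.inl ⟨G, hG, S', hS'', hcS,
      pencil_of_left hr ht.det_ne_zero (ht.left_ne_zero G (iA hG)) (k := k) (u := u)
        fun H hH => ⟨hE G H (Finset.mem_filter.1 (hS'' hH)).2,
          ht.right_ne_zero H (iB (Finset.mem_filter.1 (hS'' hH)).1),
          hSl _ (Finset.mem_image_of_mem _ hH)⟩⟩
  · rw [NbR H hH] at hS hcS
    obtain ⟨S', hS', rfl⟩ := Finset.subset_image_iff.1 hS
    have hS'' : S' ⊆ A.filter fun G => E G H := Finset.coe_subset.1 hS'
    rw [Finset.card_image_of_injOn (injL'.mono (fA H)),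
      Finset.card_image_of_injOn (injL'.mono (hS'.trans (fA H)))] at hcS
    refine Or.inr ⟨H, hH, S', hS'', hcS,
      pencil_of_right hr ht.det_ne_zero (ht.right_ne_zero H (iB hH)) (k := k) (u := u)
        fun G hG => ⟨hE G H (Finset.mem_filter.1 (hS'' hG)).2,
          ht.left_ne_zero G (iA (Finset.mem_filter.1 (hS'' hG)).1),
          hSl _ (Finset.mem_image_of_mem _ hG)⟩⟩

end Twist

section Curves

/-- At most one of the two families of isotropic lines contains a rich line. -/
def FibersLT {K : Type*} (A : Finset (K × K)) (k : ℕ) : Prop :=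
  (∀ S ⊆ A, ∀ z, (∀ q ∈ S, q.1 = z) → S.card < k) ∨ ∀ S ⊆ A, ∀ w, (∀ q ∈ S, q.2 = w) → S.card < k

theorem FibersLT.false_of_injOn {K ι : Type*} {A : Finset (K × K)} {k : ℕ} (h : FibersLT A k)
    {S : Finset ι} (hk : k ≤ S.card) {φ ψ : ι → K × K} (hφ : Set.InjOn φ S) (hψ : Set.InjOn ψ S)
    (hφA : ∀ i ∈ S, φ i ∈ A) (hψA : ∀ i ∈ S, ψ i ∈ A) {z w : K} (hz : ∀ i ∈ S, (φ i).1 = z)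
    (hw : ∀ i ∈ S, (ψ i).2 = w) : False := by
  classical
  rcases h with h | h
  · have := h (S.image φ) (Finset.image_subset_iff.2 hφA) z
      (fun q hq => by obtain ⟨i, hi, rfl⟩ := Finset.mem_image.1 hq; exact hz i hi)
    rw [Finset.card_image_of_injOn hφ] at this
    omega
  · have := h (S.image ψ) (Finset.image_subset_iff.2 hψA) w
      (fun q hq => by obtain ⟨i, hi, rfl⟩ := Finset.mem_image.1 hq; exact hw i hi)
    rw [Finset.card_image_of_injOn hψ] at this
    omega

variable {K : Type*} [Field K]

/-- Incidence of a point, in null coordinates, with the curve `c₁ z w + c₂ z + c₃ w + c₄ = 0`. -/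
def OnCurve (c : K × K × K × K) (q : K × K) : Prop :=
  c.1 * q.1 * q.2 + c.2.1 * q.1 + c.2.2.1 * q.2 + c.2.2.2 = 0

def Nondegenerate (c : K × K × K × K) : Prop := c.1 * c.2.2.2 - c.2.1 * c.2.2.1 ≠ 0

open Classical in
/-- The points of `A` on a curve. -/
noncomputable def curvePoints (A : Finset (K × K)) (c : K × K × K × K) : Finset (K × K) :=
  A.filter (OnCurve c)

/-- Two points that do not lie on a common curve containing at least `k` points of `A`. -/
def Good (A : Finset (K × K)) (k : ℕ) (q q' : K × K) : Prop :=
  ∀ c, Nondegenerate c → k ≤ (curvePoints A c).card → OnCurve c q → ¬ OnCurve c q'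

theorem mem_curvePoints {A : Finset (K × K)} {c : K × K × K × K} {q : K × K} :
    q ∈ curvePoints A c ↔ q ∈ A ∧ OnCurve c q := by
  classical
  simp [curvePoints]

theorem card_le_curvePoints {ι : Type*} {A : Finset (K × K)} {c : K × K × K × K} {S : Finset ι}
    {φ : ι → K × K} (hφ : Set.InjOn φ S) (hA : ∀ i ∈ S, φ i ∈ A) (hc : ∀ i ∈ S, OnCurve c (φ i)) :
    S.card ≤ (curvePoints A c).card :=
  Finset.card_le_card_of_injOn φ
    (fun i hi => Finset.mem_coe.2 (mem_curvePoints.2 ⟨hA i hi, hc i hi⟩)) hφ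

def tripleFst (H : K × K × K) : K × K := (H.2.1, H.2.2 / H.1)

def tripleSnd (r : K) (H : K × K × K) : K × K := (H.2.1 - H.1, (H.2.2 - r) / H.1)

theorem not_pencil_of_good {A : Finset (K × K)} {r : K} {k : ℕ} (hr : r ≠ 0) (hk : 2 ≤ k)
    (hfib : FibersLT A k) {G : K × K × K} (hG : G.1 ≠ 0) {S : Finset (K × K × K)}
    (hkS : k ≤ S.card) (hS : ∀ H ∈ S, H.1 ≠ 0 ∧ tripleFst H ∈ A ∧ tripleSnd r H ∈ A ∧
      pairForm r G H = 0 ∧ Good A k (tripleFst G) (tripleFst H) ∧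
      Good A k (tripleSnd r G) (tripleSnd r H)) : ¬ Pencil S := by
  have hx : ∀ H ∈ S, H.1 ≠ 0 := fun H hH => (hS H hH).1
  obtain ⟨H₀, hH₀⟩ : S.Nonempty := Finset.card_pos.1 (by omega)
  rintro (⟨x, hxS⟩ | ⟨a, b, c, d, hpar⟩)
  · have hx0 : x ≠ 0 := hxS H₀ hH₀ ▸ hx H₀ hH₀
    let c : K × K × K × K := (0, r, G.1 * x, -(r * G.2.1 + G.2.2 * x))
    have hc : Nondegenerate c := by
      simp only [Nondegenerate, c, zero_mul, zero_sub]
      exact neg_ne_zero.2 (mul_ne_zero hr (mul_ne_zero hG hx0))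
    have hcS : ∀ H ∈ S, OnCurve c (tripleFst H) := by
      intro H hH
      have h1 := (hS H hH).2.2.2.1
      have h2 : G.1 * x * (H.2.2 / H.1) = G.1 * H.2.2 := by
        rw [← hxS H hH]
        field_simp [hx H hH]
      have h3 := hxS H hH
      simp only [OnCurve, c, tripleFst]
      rw [pairForm, h3] at h1
      linear_combination h2 - h1
    refine (hS H₀ hH₀).2.2.2.2.1 c hc (hkS.trans (card_le_curvePoints ?_
      (fun H hH => (hS H hH).2.1) hcS)) ?_ (hcS H₀ hH₀)
    · intro H hH H' hH' h
      simp only [tripleFst, Prod.mk.injEq, hxS H hH, hxS H' hH'] at h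
      refine Prod.ext ((hxS H hH).trans (hxS H' hH').symm) (Prod.ext h.1 ?_)
      exact (div_left_inj' hx0).1 h.2
    · simp only [OnCurve, c, tripleFst]
      field_simp
      ring
  · have hinj : ∀ H ∈ S, ∀ H' ∈ S, H.1 = H'.1 → H = H' := by
      intro H hH H' hH' h
      refine Prod.ext h (Prod.ext ?_ ?_)
      · rw [(hpar H hH).1, (hpar H' hH').1, h]
      · rw [(hpar H hH).2, (hpar H' hH').2, h]
    have hform : ∀ H ∈ S, (r * (G.2.1 - a) - G.1 * c) + (G.2.2 - G.1 * d - r * b) * H.1 = 0 := by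
      intro H hH
      have h1 := (hS H hH).2.2.2.1
      rw [pairForm, (hpar H hH).1, (hpar H hH).2] at h1
      linear_combination h1
    obtain ⟨H₁, hH₁, H₂, hH₂, hne⟩ := Finset.one_lt_card.1 (show 1 < S.card by omega)
    have h2 : G.2.2 - G.1 * d - r * b = 0 := by
      have h3 : (G.2.2 - G.1 * d - r * b) * (H₁.1 - H₂.1) = 0 := by
        linear_combination hform H₁ hH₁ - hform H₂ hH₂
      exact (mul_eq_zero.1 h3).resolve_right
        (sub_ne_zero.2 fun h => hne (hinj H₁ hH₁ H₂ hH₂ h))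
    have h1 : r * (G.2.1 - a) - G.1 * c = 0 := by
      have := hform H₁ hH₁
      rwa [h2, zero_mul, add_zero] at this
    have fst_fst : ∀ H ∈ S, (tripleFst H).1 = a + b * H.1 := fun H hH => (hpar H hH).1
    have fst_snd : ∀ H ∈ S, (tripleFst H).2 = d + c / H.1 := by
      intro H hH
      have := hx H hH
      simp only [tripleFst, (hpar H hH).2]
      field_simp
      ring
    have snd_fst : ∀ H ∈ S, (tripleSnd r H).1 = a + (b - 1) * H.1 := by
      intro H hH
      simp only [tripleSnd, (hpar H hH).1]
      ring
    have snd_snd : ∀ H ∈ S, (tripleSnd r H).2 = d + (c - r) / H.1 := by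
      intro H hH
      have := hx H hH
      simp only [tripleSnd, (hpar H hH).2]
      field_simp
      ring
    have inj_mul : ∀ {u v : K}, u ≠ 0 → ∀ H ∈ S, ∀ H' ∈ S, v + u * H.1 = v + u * H'.1 → H = H' :=
      fun hu H hH H' hH' h => hinj H hH H' hH' (mul_left_cancel₀ hu (add_left_cancel h))
    have inj_div : ∀ {u v : K}, u ≠ 0 → ∀ H ∈ S, ∀ H' ∈ S, v + u / H.1 = v + u / H'.1 → H = H' := by
      intro u v hu H hH H' hH' h
      refine hinj H hH H' hH' ?_
      have h3 := add_left_cancel h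
      rw [div_eq_div_iff (hx H hH) (hx H' hH')] at h3
      exact (mul_left_cancel₀ hu h3).symm
    have case_fst : b * c = 0 := by
      by_contra hbc
      let e : K × K × K × K := (1, -d, -a, a * d - b * c)
      have he : Nondegenerate e := by
        simp only [Nondegenerate, e]
        intro h
        exact hbc (by linear_combination -h)
      have heS : ∀ H ∈ S, OnCurve e (tripleFst H) := by
        intro H hH
        have := hx H hH
        simp only [OnCurve, e, fst_fst H hH, fst_snd H hH]
        field_simp
        ring
      refine (hS H₀ hH₀).2.2.2.2.1 e he (hkS.trans (card_le_curvePoints ?_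
        (fun H hH => (hS H hH).2.1) heS)) ?_ (heS H₀ hH₀)
      · intro H hH H' hH' h
        have h3 := congrArg Prod.fst h
        rw [fst_fst H hH, fst_fst H' hH'] at h3
        exact inj_mul (left_ne_zero_of_mul hbc) H hH H' hH' h3
      · simp only [OnCurve, e, tripleFst]
        field_simp
        apply mul_left_cancel₀ hr
        linear_combination (G.2.2 - G.1 * d) * h1 + G.1 * c * h2
    have case_snd : (b - 1) * (c - r) = 0 := by
      by_contra hbc
      let e : K × K × K × K := (1, -d, -a, a * d - (b - 1) * (c - r))
      have he : Nondegenerate e := by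
        simp only [Nondegenerate, e]
        intro h
        exact hbc (by linear_combination -h)
      have heS : ∀ H ∈ S, OnCurve e (tripleSnd r H) := by
        intro H hH
        have := hx H hH
        simp only [OnCurve, e, snd_fst H hH, snd_snd H hH]
        field_simp
        ring
      refine (hS H₀ hH₀).2.2.2.2.2 e he (hkS.trans (card_le_curvePoints ?_
        (fun H hH => (hS H hH).2.2.1) heS)) ?_ (heS H₀ hH₀)
      · intro H hH H' hH' h
        have h3 := congrArg Prod.fst h
        rw [snd_fst H hH, snd_fst H' hH'] at h3
        exact inj_mul (left_ne_zero_of_mul hbc) H hH H' hH' h3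
      · simp only [OnCurve, e, tripleSnd]
        field_simp
        apply mul_left_cancel₀ hr
        linear_combination (G.2.2 - r - G.1 * d) * h1 + G.1 * (c - r) * h2
    rcases mul_eq_zero.1 case_fst with hb | hc
    · have hcr : c - r = 0 := by
        rw [hb] at case_snd
        linear_combination -case_snd
      have hc0 : c ≠ 0 := by rw [sub_eq_zero.1 hcr]; exact hr
      refine hfib.false_of_injOn hkS (φ := tripleFst) (ψ := tripleSnd r) (z := a) (w := d) ?_ ?_
        (fun H hH => (hS H hH).2.1) (fun H hH => (hS H hH).2.2.1) ?_ ?_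
      · intro H hH H' hH' h
        have h3 := congrArg Prod.snd h
        rw [fst_snd H hH, fst_snd H' hH'] at h3
        exact inj_div hc0 H hH H' hH' h3
      · intro H hH H' hH' h
        have h3 := congrArg Prod.fst h
        rw [snd_fst H hH, snd_fst H' hH'] at h3
        exact inj_mul (by rw [hb]; simp) H hH H' hH' h3
      · intro H hH
        rw [fst_fst H hH, hb, zero_mul, add_zero]
      · intro H hH
        rw [snd_snd H hH, hcr, zero_div, add_zero]
    · have hb1 : b - 1 = 0 := by
        rw [hc, zero_sub] at case_snd
        exact (mul_eq_zero.1 case_snd).resolve_right (neg_ne_zero.2 hr)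
      have hb0 : b ≠ 0 := by rw [sub_eq_zero.1 hb1]; exact one_ne_zero
      refine hfib.false_of_injOn hkS (φ := tripleSnd r) (ψ := tripleFst) (z := a) (w := d) ?_ ?_
        (fun H hH => (hS H hH).2.2.1) (fun H hH => (hS H hH).2.1) ?_ ?_
      · intro H hH H' hH' h
        have h3 := congrArg Prod.snd h
        rw [snd_snd H hH, snd_snd H' hH'] at h3
        exact inj_div (by rw [hc, zero_sub]; exact neg_ne_zero.2 hr) H hH H' hH' h3
      · intro H hH H' hH' h
        have h3 := congrArg Prod.fst h
        rw [fst_fst H hH, fst_fst H' hH'] at h3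
        exact inj_mul hb0 H hH H' hH' h3
      · intro H hH
        rw [snd_fst H hH, hb1, zero_mul, add_zero]
      · intro H hH
        rw [fst_snd H hH, hc, zero_div, add_zero]

end Curves

section Edges

theorem card_edges_le_of_degenerate {α β : Type*} {E : α → β → Prop} {M : ℕ} :
    ∀ (n : ℕ) (X : Finset α) (Y : Finset β) [∀ x, DecidablePred (E x)]
      [∀ y, DecidablePred fun x => E x y], X.card + Y.card = n →
    (∀ X' ⊆ X, ∀ Y' ⊆ Y, X'.Nonempty ∨ Y'.Nonempty →
      (∃ x ∈ X', (Y'.filter (E x)).card ≤ M) ∨ ∃ y ∈ Y', (X'.filter fun x => E x y).card ≤ M) →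
    ∑ x ∈ X, (Y.filter (E x)).card ≤ M * n := by
  classical
  intro n
  induction n with
  | zero =>
    intro X Y _ _ hn _
    have : X = ∅ := Finset.card_eq_zero.1 (by omega)
    simp [this]
  | succ n ih =>
    intro X Y _ _ hn h
    have hne : X.Nonempty ∨ Y.Nonempty := by
      simp only [← Finset.card_pos]
      omega
    rcases h X subset_rfl Y subset_rfl hne with ⟨x, hx, hxM⟩ | ⟨y, hy, hyM⟩
    · have h1 := ih (X.erase x) Y (by
        rw [Finset.card_erase_of_mem hx]
        have := Finset.card_pos.2 ⟨x, hx⟩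
        omega)
        fun X' hX' Y' hY' => h X' (hX'.trans (Finset.erase_subset _ _)) Y' hY'
      rw [← Finset.add_sum_erase _ _ hx, mul_add]
      omega
    · have h1 := ih X (Y.erase y) (by
        rw [Finset.card_erase_of_mem hy]
        have := Finset.card_pos.2 ⟨y, hy⟩
        omega)
        fun X' hX' Y' hY' => h X' hX' Y' (hY'.trans (Finset.erase_subset _ _))
      have h2 : ∑ x ∈ X, (Y.filter (E x)).card
          = ∑ x ∈ X, ((Y.erase y).filter (E x)).card + (X.filter fun x => E x y).card := by
        rw [Finset.card_filter (fun x => E x y), ← Finset.sum_add_distrib]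
        refine Finset.sum_congr rfl fun x _ => ?_
        rw [Finset.card_filter, Finset.card_filter, ← Finset.sum_erase_add _ _ hy]
      rw [h2, mul_add]
      omega

variable {K : Type*} [Field K]

theorem Good.symm {A : Finset (K × K)} {k : ℕ} {q q' : K × K} (h : Good A k q q') :
    Good A k q' q := fun c hc hk hq' hq => h c hc hk hq hq'

theorem pairForm_swap (r : K) (G H : K × K × K) : pairForm r H G = -pairForm r G H := by
  simp only [pairForm]
  ring

/-- Two triples with a common bisector and with both pairs of endpoints good. -/
def GoodEdge (A : Finset (K × K)) (k : ℕ) (r : K) (G H : K × K × K) : Prop :=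
  pairForm r G H = 0 ∧ Good A k (tripleFst G) (tripleFst H) ∧
    Good A k (tripleSnd r G) (tripleSnd r H)

theorem GoodEdge.symm {A : Finset (K × K)} {k : ℕ} {r : K} {G H : K × K × K}
    (h : GoodEdge A k r G H) : GoodEdge A k r H G :=
  ⟨by rw [pairForm_swap, h.1, neg_zero], h.2.1.symm, h.2.2.symm⟩

variable [Infinite K] {p : ℕ} [CharP K p]

open Classical in
theorem card_goodEdge_le {A : Finset (K × K)} {r : K} {k e : ℕ} (hr : r ≠ 0) (hk : 2 ≤ k)
    (hfib : FibersLT A k) {T : Finset (K × K × K)}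
    (hT : ∀ H ∈ T, H.1 ≠ 0 ∧ tripleFst H ∈ A ∧ tripleSnd r H ∈ A)
    (hcard : 2 * T.card * (3 * e + 1) < (e + 1) ^ 3) (hp : 6 * e + 1 < p) :
    ∑ G ∈ T, (T.filter fun H => GoodEdge A k r G H).card ≤ (21 * e + k) * (2 * T.card) := by
  refine card_edges_le_of_degenerate _ T T (two_mul _).symm fun X hX Y hY hne => ?_
  by_contra! hcon
  obtain ⟨h1, h2⟩ := hcon
  have hXY : (X.card + Y.card) * (3 * e + 1) < (e + 1) ^ 3 := by
    refine lt_of_le_of_lt (Nat.mul_le_mul_right _ ?_) hcard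
    have := Finset.card_le_card hX
    have := Finset.card_le_card hY
    omega
  rcases exists_vertex_pencil (p := p) hr (fun G hG => (hT G (hX hG)).1)
      (fun H hH => (hT H (hY hH)).1) hne hXY hp (E := GoodEdge A k r) (fun G H h => h.1)
      (fun G hG => lt_of_le_of_lt (by omega) (h1 G hG))
      (fun H hH => lt_of_le_of_lt (by omega) (h2 H hH)) with
    ⟨G, hG, S, hS, hcS, hpen⟩ | ⟨H, hH, S, hS, hcS, hpen⟩
  · have := h1 G hG
    refine not_pencil_of_good hr hk hfib (hT G (hX hG)).1 (by omega) (fun H hH => ?_) hpen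
    have h3 := Finset.mem_filter.1 (hS hH)
    obtain ⟨hx, hf, hs⟩ := hT H (hY h3.1)
    exact ⟨hx, hf, hs, h3.2⟩
  · have := h2 H hH
    refine not_pencil_of_good hr hk hfib (hT H (hY hH)).1 (by omega) (fun G hG => ?_) hpen
    have h3 := Finset.mem_filter.1 (hS hG)
    obtain ⟨hx, hf, hs⟩ := hT G (hX h3.1)
    exact ⟨hx, hf, hs, h3.2.symm⟩

/-- The relation, in null coordinates, of having a common bisector. -/
def BisRel (g h : (K × K) × (K × K)) : Prop :=
  (g.1.1 - g.2.1) * (g.1.2 - g.2.2) * (g.1.1 - h.1.1)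
    + (g.1.1 - g.2.1) * (h.1.1 - h.2.1) * (g.1.2 - h.1.2) = 0

def toTriple (g : (K × K) × (K × K)) : K × K × K :=
  (g.1.1 - g.2.1, g.1.1, (g.1.1 - g.2.1) * g.1.2)

omit [Infinite K] in
theorem tripleFst_toTriple {g : (K × K) × (K × K)} (h : g.1.1 - g.2.1 ≠ 0) :
    tripleFst (toTriple g) = g.1 := by
  refine Prod.ext rfl ?_
  simp only [tripleFst, toTriple]
  field_simp

omit [Infinite K] in
theorem tripleSnd_toTriple {r : K} {g : (K × K) × (K × K)} (hr : r ≠ 0)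
    (h : (g.1.1 - g.2.1) * (g.1.2 - g.2.2) = r) : tripleSnd r (toTriple g) = g.2 := by
  have h0 : g.1.1 - g.2.1 ≠ 0 := left_ne_zero_of_mul (h ▸ hr)
  refine Prod.ext ?_ ?_
  · simp [tripleSnd, toTriple]
  · simp only [tripleSnd, toTriple, ← h]
    field_simp
    ring

open Classical in
theorem card_bisRel_le {A : Finset (K × K)} {r : K} {k e : ℕ} (hr : r ≠ 0) (hk : 2 ≤ k)
    (hfib : FibersLT A k) {P : Finset ((K × K) × (K × K))}
    (hP : ∀ g ∈ P, g.1 ∈ A ∧ g.2 ∈ A ∧ (g.1.1 - g.2.1) * (g.1.2 - g.2.2) = r)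
    (hcard : 2 * P.card * (3 * e + 1) < (e + 1) ^ 3) (hp : 6 * e + 1 < p) :
    ((P ×ˢ P).filter fun gh => BisRel gh.1 gh.2 ∧ Good A k gh.1.1 gh.2.1 ∧
      Good A k gh.1.2 gh.2.2).card ≤ (21 * e + k) * (2 * P.card) := by
  have hx : ∀ g ∈ P, g.1.1 - g.2.1 ≠ 0 := fun g hg => left_ne_zero_of_mul ((hP g hg).2.2 ▸ hr)
  have hinj : Set.InjOn (toTriple (K := K)) P := by
    intro g hg h hh e
    refine Prod.ext ?_ ?_
    · rw [← tripleFst_toTriple (hx g hg), e, tripleFst_toTriple (hx h hh)]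
    · rw [← tripleSnd_toTriple hr (hP g hg).2.2, e, tripleSnd_toTriple hr (hP h hh).2.2]
  have hT := card_goodEdge_le (p := p) (T := P.image toTriple) (e := e) hr hk hfib ?_ ?_ hp
  · rw [Finset.card_image_of_injOn hinj] at hT
    refine le_trans ?_ hT
    rw [Finset.sum_image hinj]
    rw [Finset.card_filter, Finset.sum_product]
    refine Finset.sum_le_sum fun g hg => ?_
    rw [← Finset.card_filter]
    refine Finset.card_le_card_of_injOn toTriple (fun h hh => ?_)
      (hinj.mono (Finset.coe_subset.2 (Finset.filter_subset _ _)))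
    rw [Finset.mem_coe, Finset.mem_filter] at hh ⊢
    refine ⟨Finset.mem_image_of_mem _ hh.1, ?_, ?_, ?_⟩
    · have h1 := hh.2.1
      have h2 := (hP g hg).2.2
      simp only [BisRel] at h1
      simp only [pairForm, toTriple]
      rw [← h2]
      linear_combination h1
    · rw [tripleFst_toTriple (hx g hg), tripleFst_toTriple (hx h hh.1)]
      exact hh.2.2.1
    · rw [tripleSnd_toTriple hr (hP g hg).2.2, tripleSnd_toTriple hr (hP h hh.1).2.2]
      exact hh.2.2.2
  · intro H hH
    obtain ⟨g, hg, rfl⟩ := Finset.mem_image.1 hH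
    rw [tripleFst_toTriple (hx g hg), tripleSnd_toTriple hr (hP g hg).2.2]
    exact ⟨hx g hg, (hP g hg).1, (hP g hg).2.1⟩
  · rwa [Finset.card_image_of_injOn hinj]

end Edges

section Lines

variable {F : Type*} [Field F]

/-- A normal vector for each direction of lines in the plane. -/
def normal : Option F → F × F
  | none => (1, 0)
  | some s => (-s, 1)

/-- The lines of the plane are the level sets `lineForm m x = c`. -/
def lineForm (m : Option F) (x : F × F) : F := (normal m).1 * x.1 + (normal m).2 * x.2

theorem eq_of_lineForm_eq {x y : F × F} {m m' : Option F} (hm : m ≠ m')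
    (h : lineForm m x = lineForm m y) (h' : lineForm m' x = lineForm m' y) : x = y := by
  rcases m with _ | s <;> rcases m' with _ | s' <;> simp only [lineForm, normal] at h h'
  · exact absurd rfl hm
  · have h1 : x.1 = y.1 := by linear_combination h
    rw [h1] at h'
    exact Prod.ext h1 (by linear_combination h')
  · have h1 : x.1 = y.1 := by linear_combination h'
    rw [h1] at h
    exact Prod.ext h1 (by linear_combination h)
  · have hs : s - s' ≠ 0 := sub_ne_zero.2 fun e => hm (by rw [e])
    have h1 : x.1 = y.1 := by
      apply mul_left_cancel₀ hs
      linear_combination h' - h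
    rw [h1] at h
    exact Prod.ext h1 (by linear_combination h)

variable [Fintype F] [DecidableEq F]

def lineCard (A : Finset (F × F)) (l : Option F × F) : ℕ :=
  (A.filter fun x => lineForm l.1 x = l.2).card

theorem sum_lineCard (A : Finset (F × F)) :
    ∑ l, lineCard A l = (Fintype.card F + 1) * A.card := by
  rw [Fintype.sum_prod_type]
  have (m : Option F) : ∑ c, lineCard A (m, c) = A.card :=
    (Finset.card_eq_sum_card_fiberwise (f := lineForm m) (t := Finset.univ)
      fun _ _ => Finset.mem_coe.2 (Finset.mem_univ _)).symm
  simp [this]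

theorem sum_lineCard_sq_le (A : Finset (F × F)) :
    ∑ l, lineCard A l ^ 2 ≤ Fintype.card F * A.card + A.card ^ 2 := by
  have h1 : ∀ l, lineCard A l ^ 2 = ∑ x ∈ A, ∑ y ∈ A,
      if lineForm l.1 x = l.2 ∧ lineForm l.1 x = lineForm l.1 y then 1 else 0 := by
    intro l
    rw [lineCard, sq, Finset.card_filter, Finset.sum_mul_sum]
    refine Finset.sum_congr rfl fun x _ => Finset.sum_congr rfl fun y _ => ?_
    by_cases hx : lineForm l.1 x = l.2
    · simp [hx, eq_comm]
    · simp [hx]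
  have h2 : ∀ x y : F × F, ∑ l : Option F × F,
      (if lineForm l.1 x = l.2 ∧ lineForm l.1 x = lineForm l.1 y then 1 else 0)
        ≤ 1 + if x = y then Fintype.card F else 0 := by
    intro x y
    rw [Fintype.sum_prod_type]
    have h3 (m : Option F) : (∑ c, if lineForm m x = c ∧ lineForm m x = lineForm m y then 1 else 0)
        = if lineForm m x = lineForm m y then 1 else 0 := by
      by_cases h : lineForm m x = lineForm m y
      · simp [h]
      · simp [h]
    simp only [h3]
    rw [← Finset.card_filter]
    split_ifs with hxy
    · refine (Finset.card_le_univ _).trans ?_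
      rw [Fintype.card_option, add_comm]
    · refine Finset.card_le_one.2 fun m hm m' hm' => ?_
      by_contra hne
      exact hxy (eq_of_lineForm_eq hne (Finset.mem_filter.1 hm).2 (Finset.mem_filter.1 hm').2)
  simp only [h1]
  rw [Finset.sum_comm]
  calc ∑ x ∈ A, ∑ l : Option F × F, ∑ y ∈ A,
        (if lineForm l.1 x = l.2 ∧ lineForm l.1 x = lineForm l.1 y then 1 else 0)
      ≤ ∑ x ∈ A, ∑ y ∈ A, (1 + if x = y then Fintype.card F else 0) := by
        refine Finset.sum_le_sum fun x _ => ?_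
        rw [Finset.sum_comm]
        exact Finset.sum_le_sum fun y _ => h2 x y
    _ = Fintype.card F * A.card + A.card ^ 2 := by
        simp only [Finset.sum_add_distrib, Finset.sum_const, smul_eq_mul, mul_one,
          Finset.sum_ite_eq, sq]
        rw [Finset.sum_congr rfl fun x hx => if_pos hx]
        simp only [Finset.sum_const, smul_eq_mul]
        ring

theorem sum_lineCard_sub_sq_le (A : Finset (F × F)) :
    ∑ l, ((lineCard A l : ℝ) - A.card / Fintype.card F) ^ 2 ≤ Fintype.card F * A.card := by
  have hF : (0 : ℝ) < Fintype.card F := Nat.cast_pos.2 Fintype.card_pos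
  have h1 : ∑ l, (lineCard A l : ℝ) = (Fintype.card F + 1) * A.card := by
    exact_mod_cast sum_lineCard A
  have h2 : ∑ l, (lineCard A l : ℝ) ^ 2 ≤ Fintype.card F * A.card + (A.card : ℝ) ^ 2 := by
    exact_mod_cast sum_lineCard_sq_le A
  simp only [sub_sq, Finset.sum_add_distrib, Finset.sum_sub_distrib, ← Finset.sum_mul,
    ← Finset.mul_sum, h1]
  simp only [Finset.sum_const, Finset.card_univ, Fintype.card_prod, Fintype.card_option,
    nsmul_eq_mul]
  have h3 : (0 : ℝ) ≤ (A.card : ℝ) ^ 2 / Fintype.card F := by positivity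
  have h4 : 2 * (((Fintype.card F : ℝ) + 1) * A.card) * (A.card / Fintype.card F)
      = 2 * (A.card : ℝ) ^ 2 + 2 * ((A.card : ℝ) ^ 2 / Fintype.card F) := by
    field_simp
  have h5 : (((Fintype.card F + 1) * Fintype.card F : ℕ) : ℝ) * (A.card / Fintype.card F : ℝ) ^ 2
      = (A.card : ℝ) ^ 2 + (A.card : ℝ) ^ 2 / Fintype.card F := by
    push_cast
    field_simp
  rw [h4, h5]
  linarith

theorem sum_lineCard_mul_le (A : Finset (F × F)) (b : Option F × F → ℝ) :
    (∑ l, (lineCard A l : ℝ) * b l - A.card / Fintype.card F * ∑ l, b l) ^ 2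
      ≤ Fintype.card F * A.card * ∑ l, b l ^ 2 := by
  have h := Finset.sum_mul_sq_le_sq_mul_sq Finset.univ
    (fun l => (lineCard A l : ℝ) - A.card / Fintype.card F) b
  simp only [sub_mul, Finset.sum_sub_distrib, ← Finset.mul_sum] at h
  exact h.trans (mul_le_mul_of_nonneg_right (sum_lineCard_sub_sq_le A)
    (Finset.sum_nonneg fun _ _ => sq_nonneg _))

end Lines

section Bisectors

variable {F : Type*} [Field F]

/-- For distinct points, the line `l` is the perpendicular bisector of `a` and `b`. -/
def IsBisector (l : Option F × F) (a b : F × F) : Prop :=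
  ∃ t, b.1 = a.1 + t * (normal l.1).1 ∧ b.2 = a.2 + t * (normal l.1).2 ∧
    2 * lineForm l.1 a + t * ((normal l.1).1 ^ 2 + (normal l.1).2 ^ 2) = 2 * l.2

theorem exists_isBisector (h2 : (2 : F) ≠ 0) (a b : F × F) : ∃ l, IsBisector l a b := by
  by_cases h : b.2 = a.2
  · refine ⟨(none, (a.1 + b.1) / 2), b.1 - a.1, ?_, ?_, ?_⟩ <;> simp only [normal, lineForm]
    · ring
    · rw [h]; ring
    · field_simp
      ring
  · have h' : b.2 - a.2 ≠ 0 := sub_ne_zero.2 h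
    let s := -(b.1 - a.1) / (b.2 - a.2)
    have hs : (b.2 - a.2) * s = -(b.1 - a.1) := mul_div_cancel₀ _ h'
    refine ⟨(some s, (-s * (a.1 + b.1) + (a.2 + b.2)) / 2), b.2 - a.2, ?_, ?_, ?_⟩ <;>
      simp only [normal, lineForm]
    · linear_combination hs
    · ring
    · rw [mul_div_cancel₀ _ h2]
      linear_combination s * hs

theorem IsBisector.lineForm_eq (h2 : (2 : F) ≠ 0) {l : Option F × F} {a b x : F × F}
    (h : IsBisector l a b) (hab : a ≠ b) (hx : dist2 x a = dist2 x b) : lineForm l.1 x = l.2 := by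
  obtain ⟨t, e1, e2, e3⟩ := h
  have ht : t ≠ 0 := by
    rintro rfl
    exact hab (Prod.ext (by rw [e1]; ring) (by rw [e2]; ring))
  apply mul_left_cancel₀ (mul_ne_zero h2 ht)
  simp only [dist2, e1, e2] at hx
  simp only [lineForm] at e3 ⊢
  linear_combination hx + t * e3

theorem IsBisector.dist2_eq {l : Option F × F} {a b a' b' : F × F}
    (h : IsBisector l a b) (h' : IsBisector l a' b') : dist2 a a' = dist2 b b' := by
  obtain ⟨t, e1, e2, e3⟩ := h
  obtain ⟨t', e1', e2', e3'⟩ := h'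
  simp only [dist2, e1, e2, e1', e2']
  simp only [lineForm] at e3 e3'
  linear_combination (t' - t) * (e3 - e3')

variable {K : Type*} [Field K] [Algebra F K]

/-- Null coordinates, where `i` is a square root of `-1`. -/
def nullCoord (i : K) (a : F × F) : K × K :=
  (algebraMap F K a.1 + i * algebraMap F K a.2, algebraMap F K a.1 - i * algebraMap F K a.2)

theorem nullCoord_injective (h2 : (2 : F) ≠ 0) {i : K} (hi : i ^ 2 = -1) :
    Function.Injective (nullCoord (F := F) i) := by
  intro a b h
  have h2' : (2 : K) ≠ 0 := by
    rw [← map_ofNat (algebraMap F K) 2]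
    exact (map_ne_zero _).2 h2
  have hi0 : i ≠ 0 := by
    rintro rfl
    norm_num at hi
  have e1 := congrArg Prod.fst h
  have e2 := congrArg Prod.snd h
  simp only [nullCoord] at e1 e2
  refine Prod.ext ((algebraMap F K).injective ?_) ((algebraMap F K).injective ?_)
  · apply mul_left_cancel₀ h2'
    linear_combination e1 + e2
  · apply mul_left_cancel₀ (mul_ne_zero h2' hi0)
    linear_combination e1 - e2

theorem nullCoord_dist2 {i : K} (hi : i ^ 2 = -1) (a b : F × F) :
    ((nullCoord i a).1 - (nullCoord i b).1) * ((nullCoord i a).2 - (nullCoord i b).2)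
      = algebraMap F K (dist2 a b) := by
  simp only [nullCoord, dist2, map_add, map_pow, map_sub]
  linear_combination -(algebraMap F K a.2 - algebraMap F K b.2) ^ 2 * hi

theorem IsBisector.bisRel {i : K} (hi : i ^ 2 = -1) {l : Option F × F} {a b a' b' : F × F}
    (h : IsBisector l a b) (h' : IsBisector l a' b') :
    BisRel (nullCoord i a, nullCoord i a') (nullCoord i b, nullCoord i b') := by
  obtain ⟨t, e1, e2, e3⟩ := h
  obtain ⟨t', e1', e2', e3'⟩ := h'
  have e4 := congrArg (algebraMap F K) (e3.trans e3'.symm)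
  simp only [lineForm, map_add, map_mul, map_pow, map_ofNat] at e4
  simp only [BisRel, nullCoord, e1, e2, e1', e2', map_add, map_mul]
  generalize algebraMap F K a.1 = a₁ at *
  generalize algebraMap F K a.2 = a₂ at *
  generalize algebraMap F K a'.1 = c₁ at *
  generalize algebraMap F K a'.2 = c₂ at *
  generalize algebraMap F K t = s at *
  generalize algebraMap F K t' = s' at *
  generalize algebraMap F K (normal l.1).1 = m at *
  generalize algebraMap F K (normal l.1).2 = n at *
  linear_combination -s * (a₁ + i * a₂ - (c₁ + i * c₂)) * e4
    + s * (a₁ + i * a₂ - (c₁ + i * c₂)) * (2 * (a₂ - c₂) * n + (s - s') * n ^ 2) * hi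

/-- A bisector of a non-isotropic pair determines the reflection of every point. -/
theorem IsBisector.right_unique {l : Option F × F} {a b a' b' b'' : F × F}
    (h : IsBisector l a b) (hab : dist2 a b ≠ 0) (h' : IsBisector l a' b')
    (h'' : IsBisector l a' b'') : b' = b'' := by
  obtain ⟨t, e1, e2, e3⟩ := h
  obtain ⟨t', e1', e2', e3'⟩ := h'
  obtain ⟨t'', e1'', e2'', e3''⟩ := h''
  have hn : (normal l.1).1 ^ 2 + (normal l.1).2 ^ 2 ≠ 0 := by
    intro h0
    apply hab
    simp only [dist2, e1, e2]
    linear_combination t ^ 2 * h0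
  have ht : t' = t'' := by
    apply mul_right_cancel₀ hn
    linear_combination e3' - e3''
  exact Prod.ext (by rw [e1', e1'', ht]) (by rw [e2', e2'', ht])

theorem IsBisector.symm {l : Option F × F} {a b : F × F} (h : IsBisector l a b) :
    IsBisector l b a := by
  obtain ⟨t, e1, e2, e3⟩ := h
  refine ⟨-t, by rw [e1]; ring, by rw [e2]; ring, ?_⟩
  simp only [lineForm] at e3 ⊢
  rw [e1, e2]
  linear_combination e3

/-- If `a, a'` lie on an isotropic line then their reflections lie on one of the other family. -/
theorem IsBisector.isotropic {i : K} (hi : i ^ 2 = -1) {l : Option F × F} {a b a' b' : F × F}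
    (h : IsBisector l a b) (hab : dist2 a b ≠ 0) (h' : IsBisector l a' b')
    (h0 : dist2 a a' = 0) :
    ((nullCoord i a).1 = (nullCoord i a').1 ∧ (nullCoord i b).2 = (nullCoord i b').2) ∨
      ((nullCoord i a).2 = (nullCoord i a').2 ∧ (nullCoord i b).1 = (nullCoord i b').1) := by
  obtain ⟨t, e1, e2, e3⟩ := h
  obtain ⟨t', e1', e2', e3'⟩ := h'
  have h1 := nullCoord_dist2 hi a a'
  rw [h0, map_zero] at h1
  have hn : algebraMap F K ((normal l.1).1 ^ 2 + (normal l.1).2 ^ 2) ≠ 0 := by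
    rw [map_ne_zero]
    intro h0
    apply hab
    simp only [dist2, e1, e2]
    linear_combination t ^ 2 * h0
  have e4 := congrArg (algebraMap F K) (e3.trans e3'.symm)
  simp only [lineForm, map_add, map_mul, map_pow, map_ofNat] at e4 hn
  simp only [nullCoord, e1, e2, e1', e2', map_add, map_mul] at h1 ⊢
  generalize algebraMap F K a.1 = a₁ at *
  generalize algebraMap F K a.2 = a₂ at *
  generalize algebraMap F K a'.1 = c₁ at *
  generalize algebraMap F K a'.2 = c₂ at *
  generalize algebraMap F K t = s at *
  generalize algebraMap F K t' = s' at *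
  generalize algebraMap F K (normal l.1).1 = m at *
  generalize algebraMap F K (normal l.1).2 = n at *
  have hf : (m + i * n) * (m - i * n) = m ^ 2 + n ^ 2 := by linear_combination -n ^ 2 * hi
  rw [← hf] at hn
  rcases mul_eq_zero.1 h1 with hz | hz
  · refine Or.inl ⟨sub_eq_zero.1 hz, ?_⟩
    apply mul_left_cancel₀ (left_ne_zero_of_mul hn)
    linear_combination e4 - (m - i * n) * hz + (-(s - s') * n ^ 2 - 2 * (a₂ - c₂) * n) * hi
  · refine Or.inr ⟨sub_eq_zero.1 hz, ?_⟩
    apply mul_left_cancel₀ (right_ne_zero_of_mul hn)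
    linear_combination e4 - (m + i * n) * hz + (-(s - s') * n ^ 2 - 2 * (a₂ - c₂) * n) * hi

end Bisectors

section Incidences

theorem sq_sum_card_le {ι α : Type*} [DecidableEq α] {s : Finset ι} {S : ι → Finset α}
    {A : Finset α} (hS : ∀ i ∈ s, S i ⊆ A)
    (h2 : ∀ i ∈ s, ∀ j ∈ s, i ≠ j → (S i ∩ S j).card ≤ 2) :
    (∑ i ∈ s, (S i).card) ^ 2 ≤ A.card * (∑ i ∈ s, (S i).card + 2 * s.card ^ 2) := by
  classical
  have hsub : ∀ i ∈ s, (S i).card = ∑ x ∈ A, if x ∈ S i then 1 else 0 := by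
    intro i hi
    rw [← Finset.card_filter, Finset.filter_mem_eq_inter, Finset.inter_eq_right.2 (hS i hi)]
  have h1 : ∑ i ∈ s, (S i).card = ∑ x ∈ A, ∑ i ∈ s, if x ∈ S i then 1 else 0 := by
    rw [Finset.sum_congr rfl hsub, Finset.sum_comm]
  have h3 : ∑ x ∈ A, (∑ i ∈ s, if x ∈ S i then 1 else 0) ^ 2
      = ∑ i ∈ s, ∑ j ∈ s, (S i ∩ S j).card := by
    simp only [sq, Finset.sum_mul_sum]
    rw [Finset.sum_comm]
    refine Finset.sum_congr rfl fun i hi => ?_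
    rw [Finset.sum_comm]
    refine Finset.sum_congr rfl fun j hj => ?_
    simp only [mul_ite, mul_one, mul_zero, ← ite_and]
    rw [← Finset.card_filter]
    congr 1
    ext x
    simp only [Finset.mem_filter, Finset.mem_inter]
    exact ⟨fun h => ⟨h.2.2, h.2.1⟩, fun h => ⟨hS i hi h.1, h.2, h.1⟩⟩
  have h4 : ∑ i ∈ s, ∑ j ∈ s, (S i ∩ S j).card ≤ ∑ i ∈ s, (S i).card + 2 * s.card ^ 2 := by
    calc ∑ i ∈ s, ∑ j ∈ s, (S i ∩ S j).card
        ≤ ∑ i ∈ s, ∑ j ∈ s, ((if i = j then (S i).card else 0) + 2) := by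
          refine Finset.sum_le_sum fun i hi => Finset.sum_le_sum fun j hj => ?_
          split_ifs with h
          · rw [h, Finset.inter_self]
            omega
          · simpa using h2 i hi j hj h
      _ = _ := by
          simp only [Finset.sum_add_distrib, Finset.sum_ite_eq, Finset.sum_const, smul_eq_mul]
          rw [Finset.sum_congr rfl fun i hi => if_pos hi]
          ring
  rw [h1]
  refine (sq_sum_le_card_mul_sum_sq (s := A)).trans (Nat.mul_le_mul_left _ ?_)
  rw [h3, ← h1]
  exact h4

variable {K : Type*} [Field K]

theorem Nondegenerate.fst_ne_zero {c : K × K × K × K} (hc : Nondegenerate c) {q : K × K}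
    (hq : OnCurve c q) : c.1 * q.1 + c.2.2.1 ≠ 0 := by
  intro h
  apply hc
  simp only [OnCurve] at hq
  linear_combination c.1 * hq - (c.2.1 + c.1 * q.2) * h

theorem Nondegenerate.eq_of_fst_eq {c : K × K × K × K} (hc : Nondegenerate c) {q q' : K × K}
    (hq : OnCurve c q) (hq' : OnCurve c q') (h : q.1 = q'.1) : q = q' := by
  refine Prod.ext h (mul_left_cancel₀ (hc.fst_ne_zero hq) ?_)
  simp only [OnCurve] at hq hq'
  rw [← h] at hq'
  linear_combination hq - hq'

theorem quadratic_eq_zero {α β γ x y z : K} (hxy : x ≠ y) (hxz : x ≠ z) (hyz : y ≠ z)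
    (hx : α * x ^ 2 + β * x + γ = 0) (hy : α * y ^ 2 + β * y + γ = 0)
    (hz : α * z ^ 2 + β * z + γ = 0) : α = 0 ∧ β = 0 ∧ γ = 0 := by
  have h1 : α * (x + y) + β = 0 := by
    apply mul_left_cancel₀ (sub_ne_zero.2 hxy)
    linear_combination hx - hy
  have h2 : α * (x + z) + β = 0 := by
    apply mul_left_cancel₀ (sub_ne_zero.2 hxz)
    linear_combination hx - hz
  have h3 : α = 0 := by
    apply mul_left_cancel₀ (sub_ne_zero.2 hyz)
    linear_combination h1 - h2
  have h4 : β = 0 := by simpa [h3] using h1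
  exact ⟨h3, h4, by simpa [h3, h4] using hx⟩

theorem curve_coeff_eq {c c' : K × K × K × K} (hc : Nondegenerate c) {S : Finset (K × K)}
    (hS : 2 < S.card) (h : ∀ q ∈ S, OnCurve c q) (h' : ∀ q ∈ S, OnCurve c' q) :
    c.2.1 * c'.1 - c'.2.1 * c.1 = 0 ∧
      c.2.1 * c'.2.2.1 + c.2.2.2 * c'.1 - (c'.2.1 * c.2.2.1 + c'.2.2.2 * c.1) = 0 ∧
      c.2.2.2 * c'.2.2.1 - c'.2.2.2 * c.2.2.1 = 0 := by
  obtain ⟨q₁, h₁, q₂, h₂, q₃, h₃, n₁₂, n₁₃, n₂₃⟩ := Finset.two_lt_card.1 hS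
  have hq : ∀ q ∈ S, (c.2.1 * c'.1 - c'.2.1 * c.1) * q.1 ^ 2
      + (c.2.1 * c'.2.2.1 + c.2.2.2 * c'.1 - (c'.2.1 * c.2.2.1 + c'.2.2.2 * c.1)) * q.1
      + (c.2.2.2 * c'.2.2.1 - c'.2.2.2 * c.2.2.1) = 0 := by
    intro q hq
    have e := h q hq
    have e' := h' q hq
    simp only [OnCurve] at e e'
    linear_combination (c'.1 * q.1 + c'.2.2.1) * e - (c.1 * q.1 + c.2.2.1) * e'
  exact quadratic_eq_zero (fun e => n₁₂ (hc.eq_of_fst_eq (h _ h₁) (h _ h₂) e))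
    (fun e => n₁₃ (hc.eq_of_fst_eq (h _ h₁) (h _ h₃) e))
    (fun e => n₂₃ (hc.eq_of_fst_eq (h _ h₂) (h _ h₃) e)) (hq _ h₁) (hq _ h₂) (hq _ h₃)

theorem OnCurve.of_common_points {c c' : K × K × K × K} (hc : Nondegenerate c)
    {S : Finset (K × K)} (hS : 2 < S.card) (h : ∀ q ∈ S, OnCurve c q) (h' : ∀ q ∈ S, OnCurve c' q)
    {q : K × K} (hq : OnCurve c q) : OnCurve c' q := by
  obtain ⟨e1, e2, e3⟩ := curve_coeff_eq hc hS h h'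
  apply mul_left_cancel₀ (hc.fst_ne_zero hq)
  simp only [OnCurve] at hq ⊢
  linear_combination (c'.1 * q.1 + c'.2.2.1) * hq - q.1 ^ 2 * e1 - q.1 * e2 - e3

/-- The distance form in null coordinates. -/
def nullDist (q q' : K × K) : K := (q.1 - q'.1) * (q.2 - q'.2)

def circleCurve (q : K × K) (r : K) : K × K × K × K := (1, -q.2, -q.1, q.1 * q.2 - r)

theorem onCurve_circleCurve {q q' : K × K} {r : K} :
    OnCurve (circleCurve q r) q' ↔ nullDist q q' = r := by
  simp only [OnCurve, circleCurve, nullDist]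
  constructor <;> intro h <;> linear_combination h

theorem nondegenerate_circleCurve {q : K × K} {r : K} (hr : r ≠ 0) :
    Nondegenerate (circleCurve q r) := by
  simp only [Nondegenerate, circleCurve]
  intro h
  exact hr (by linear_combination -h)

theorem centre_eq {q q' : K × K} {r r' : K} (hr : r ≠ 0) {S : Finset (K × K)} (hS : 2 < S.card)
    (h : ∀ a ∈ S, nullDist q a = r) (h' : ∀ a ∈ S, nullDist q' a = r') : q = q' := by
  obtain ⟨e1, e2, e3⟩ := curve_coeff_eq (nondegenerate_circleCurve (q := q) hr) hS
    (fun a ha => onCurve_circleCurve.2 (h a ha)) (fun a ha => onCurve_circleCurve.2 (h' a ha))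
  simp only [circleCurve] at e1 e2 e3
  have hw : q.2 = q'.2 := by linear_combination -e1
  rw [← hw] at e2 e3
  have hrr : r = r' := by linear_combination -e2
  rw [← hrr] at e3
  exact Prod.ext (mul_left_cancel₀ hr (by linear_combination -e3)) hw

open Classical in
theorem sq_card_nullDist_le (B : Finset (K × K)) {r : K} (hr : r ≠ 0) :
    ((B ×ˢ B).filter fun g => nullDist g.1 g.2 = r).card ^ 2
      ≤ B.card * (((B ×ˢ B).filter fun g => nullDist g.1 g.2 = r).card + 2 * B.card ^ 2) := by
  have h : ((B ×ˢ B).filter fun g => nullDist g.1 g.2 = r).card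
      = ∑ x ∈ B, (B.filter fun a => nullDist x a = r).card := by
    simp only [Finset.card_filter, Finset.sum_product]
  rw [h]
  refine sq_sum_card_le (fun _ _ => Finset.filter_subset _ _) fun x _ y _ hxy => ?_
  by_contra! hcon
  refine hxy (centre_eq hr hcon (fun a ha => ?_) (r' := r) fun a ha => ?_)
  · exact (Finset.mem_filter.1 (Finset.mem_inter.1 ha).1).2
  · exact (Finset.mem_filter.1 (Finset.mem_inter.1 ha).2).2

open Classical in
/-- The traces on `B` of the curves containing at least `k` points of `B`. -/
noncomputable def richTraces (B : Finset (K × K)) (k : ℕ) : Finset (Finset (K × K)) :=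
  B.powerset.filter fun S => k ≤ S.card ∧ ∃ c, Nondegenerate c ∧ S = curvePoints B c

theorem sum_card_richTraces_le {B : Finset (K × K)} {k : ℕ} (hk : 4 * B.card ≤ k ^ 2) :
    ∑ S ∈ richTraces B k, S.card ≤ 2 * B.card := by
  classical
  have h1 := sq_sum_card_le (s := richTraces B k) (S := id) (A := B)
    (fun S hS => Finset.mem_powerset.1 (Finset.mem_filter.1 hS).1) (by
      intro S hS S' hS' hne
      obtain ⟨c, hc, hSc⟩ := (Finset.mem_filter.1 hS).2.2
      obtain ⟨c', hc', hSc'⟩ := (Finset.mem_filter.1 hS').2.2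
      by_contra! hcon
      have h : ∀ q ∈ S ∩ S', OnCurve c q := fun q hq =>
        (mem_curvePoints.1 (hSc ▸ (Finset.mem_inter.1 hq).1)).2
      have h' : ∀ q ∈ S ∩ S', OnCurve c' q := fun q hq =>
        (mem_curvePoints.1 (hSc' ▸ (Finset.mem_inter.1 hq).2)).2
      apply hne
      rw [hSc, hSc']
      ext q
      rw [mem_curvePoints, mem_curvePoints]
      exact and_congr_right fun _ => ⟨OnCurve.of_common_points hc hcon h h',
        OnCurve.of_common_points hc' hcon h' h⟩)
  simp only [id] at h1
  have h2 : (richTraces B k).card * k ≤ ∑ S ∈ richTraces B k, S.card :=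
    Finset.card_nsmul_le_sum _ _ _ fun S hS => (Finset.mem_filter.1 hS).2.1
  set X := ∑ S ∈ richTraces B k, S.card
  set f := (richTraces B k).card
  rcases Nat.eq_zero_or_pos X with hX | hX
  · omega
  have hn : 0 < B.card := by
    by_contra! h0
    rw [Nat.le_zero.1 h0, zero_mul] at h1
    exact absurd h1 (not_le.2 (by positivity))
  have hkpos : 0 < k ^ 2 := by omega
  have h3 : (f * k) ^ 2 ≤ X ^ 2 := Nat.pow_le_pow_left h2 2
  have h4 : k ^ 2 * X ^ 2 ≤ B.card * k ^ 2 * X + 2 * B.card * X ^ 2 := by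
    nlinarith [Nat.mul_le_mul_left (k ^ 2) h1, Nat.mul_le_mul_left (2 * B.card) h3]
  have h5 : 2 * B.card * X ^ 2 * 2 ≤ k ^ 2 * X ^ 2 := by
    nlinarith [Nat.mul_le_mul_right (X ^ 2) hk]
  have h6 : (k ^ 2 * X) * X ≤ (k ^ 2 * X) * (2 * B.card) := by nlinarith
  exact Nat.le_of_mul_le_mul_left h6 (by positivity)

open Classical in
theorem card_isosceles_rich_le {B S : Finset (K × K)} (hSB : S ⊆ B) {c : K × K × K × K}
    (hc : Nondegenerate c) (hS : ∀ q ∈ S, OnCurve c q) :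
    ((B ×ˢ (S ×ˢ S)).filter fun t => nullDist t.1 t.2.1 = nullDist t.1 t.2.2 ∧
      nullDist t.1 t.2.1 ≠ 0 ∧ t.2.1 ≠ t.2.2).card ≤ 2 * B.card * S.card := by
  let X := B.filter fun x => ∃ r ≠ 0, 2 < (S.filter fun a => nullDist x a = r).card
  have hX : X.card ≤ 1 := by
    refine Finset.card_le_one.2 fun x hx x' hx' => ?_
    obtain ⟨r, hr, h3⟩ := (Finset.mem_filter.1 hx).2
    obtain ⟨r', hr', h3'⟩ := (Finset.mem_filter.1 hx').2
    refine centre_eq hr h3' (fun a ha => onCurve_circleCurve.1 ?_) fun a ha =>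
      (Finset.mem_filter.1 ha).2
    exact OnCurve.of_common_points hc h3 (fun b hb => hS b (Finset.mem_filter.1 hb).1)
      (fun b hb => onCurve_circleCurve.2 (Finset.mem_filter.1 hb).2)
      (hS a (Finset.mem_filter.1 ha).1)
  rw [← Finset.card_filter_add_card_filter_not (fun t : (K × K) × (K × K) × (K × K) => t.1 ∈ X)]
  have h1 : (X ×ˢ (S ×ˢ S)).card ≤ B.card * S.card := by
    rw [Finset.card_product, Finset.card_product]
    have := Nat.mul_le_mul hX (Nat.mul_le_mul_right S.card (Finset.card_le_card hSB))
    rwa [one_mul] at this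
  have h2 : (B ×ˢ S).card = B.card * S.card := Finset.card_product _ _
  rw [two_mul, add_mul]
  refine add_le_add ((Finset.card_le_card fun t ht => ?_).trans h1)
    ((Finset.card_le_card_of_injOn (fun t => (t.1, t.2.1)) (fun t ht => ?_) ?_).trans_eq h2)
  · simp only [Finset.mem_filter, Finset.mem_product] at ht ⊢
    exact ⟨ht.2, ht.1.1.2⟩
  · simp only [Finset.coe_filter, Finset.mem_filter, Finset.mem_product, Set.mem_ofPred_eq] at ht
    exact Finset.mem_coe.2 (Finset.mem_product.2 ⟨ht.1.1.1, ht.1.1.2.1⟩)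
  · rintro ⟨x, a, b⟩ ht ⟨x', a', b'⟩ ht' h
    simp only [Finset.coe_filter, Finset.mem_filter, Finset.mem_product, Set.mem_ofPred_eq,
      Prod.mk.injEq] at ht ht' h
    obtain ⟨rfl, rfl⟩ := h
    by_contra hne
    refine ht.2 (Finset.mem_filter.2 ⟨ht.1.1.1, nullDist x a, ht.1.2.2.1, ?_⟩)
    refine Finset.two_lt_card.2 ⟨a, ?_, b, ?_, b', ?_, ht.1.2.2.2, ht'.1.2.2.2, ?_⟩
    · exact Finset.mem_filter.2 ⟨ht.1.1.2.1, rfl⟩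
    · exact Finset.mem_filter.2 ⟨ht.1.1.2.2, ht.1.2.1.symm⟩
    · exact Finset.mem_filter.2 ⟨ht'.1.1.2.2, ht'.1.2.1.symm⟩
    · rintro rfl
      exact hne rfl

open Classical in
theorem card_isosceles_not_good_le {B : Finset (K × K)} {k : ℕ} (hk : 4 * B.card ≤ k ^ 2) :
    ((B ×ˢ (B ×ˢ B)).filter fun t => nullDist t.1 t.2.1 = nullDist t.1 t.2.2 ∧
      nullDist t.1 t.2.1 ≠ 0 ∧ t.2.1 ≠ t.2.2 ∧ ¬ Good B k t.2.1 t.2.2).card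
      ≤ 4 * B.card ^ 2 := by
  calc _ ≤ ((richTraces B k).biUnion fun S => (B ×ˢ (S ×ˢ S)).filter fun t =>
        nullDist t.1 t.2.1 = nullDist t.1 t.2.2 ∧ nullDist t.1 t.2.1 ≠ 0 ∧ t.2.1 ≠ t.2.2).card := by
        refine Finset.card_le_card fun t ht => ?_
        obtain ⟨h1, h2, h3, h4, h5⟩ := Finset.mem_filter.1 ht
        simp only [Finset.mem_product] at h1
        simp only [Good] at h5
        push Not at h5
        obtain ⟨c, hc, hck, hca, hcb⟩ := h5
        refine Finset.mem_biUnion.2 ⟨curvePoints B c, ?_, ?_⟩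
        · exact Finset.mem_filter.2
            ⟨Finset.mem_powerset.2 (Finset.filter_subset _ _), hck, c, hc, rfl⟩
        · refine Finset.mem_filter.2 ⟨?_, h2, h3, h4⟩
          simp only [Finset.mem_product, mem_curvePoints]
          exact ⟨h1.1, ⟨h1.2.1, hca⟩, h1.2.2, hcb⟩
    _ ≤ ∑ S ∈ richTraces B k, 2 * B.card * S.card := by
        refine Finset.card_biUnion_le.trans (Finset.sum_le_sum fun S hS => ?_)
        obtain ⟨h1, -, c, hc, rfl⟩ := Finset.mem_filter.1 hS
        exact card_isosceles_rich_le (Finset.mem_powerset.1 h1) hc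
          fun q hq => (mem_curvePoints.1 hq).2
    _ ≤ 4 * B.card ^ 2 := by
        rw [← Finset.mul_sum]
        nlinarith [Nat.mul_le_mul_left (2 * B.card) (sum_card_richTraces_le hk)]

end Incidences

section Energy

theorem card_le_of_fibers {α β K : Type*} [DecidableEq K] {A : Finset α} {k : ℕ} {f : α → K}
    (hf : ∀ x ∈ A, ∀ S ⊆ A, (∀ y ∈ S, f x = f y) → S.card ≤ k) {Q : Finset β}
    {φ : β → (α × α) × α} (hφ : Set.InjOn φ Q)
    (hQ : ∀ q ∈ Q, ((φ q).1.1 ∈ A ∧ (φ q).2 ∈ A) ∧ (φ q).1.2 ∈ A ∧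
      f (φ q).1.1 = f (φ q).1.2) :
    Q.card ≤ k * A.card ^ 2 := by
  classical
  have h1 : ((A ×ˢ A).filter fun g => f g.1 = f g.2).card ≤ k * A.card := by
    rw [Finset.card_filter, Finset.sum_product, mul_comm, ← smul_eq_mul]
    refine Finset.sum_le_card_nsmul _ _ _ fun x hx => ?_
    rw [← Finset.card_filter]
    exact hf x hx _ (Finset.filter_subset _ _) fun y hy => (Finset.mem_filter.1 hy).2
  calc Q.card ≤ (((A ×ˢ A).filter fun g => f g.1 = f g.2) ×ˢ A).card := by
        refine Finset.card_le_card_of_injOn φ (fun q hq => Finset.mem_coe.2 ?_) hφ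
        obtain ⟨⟨h1, h2⟩, h3, h4⟩ := hQ q hq
        exact Finset.mem_product.2 ⟨Finset.mem_filter.2 ⟨Finset.mem_product.2 ⟨h1, h3⟩, h4⟩, h2⟩
    _ ≤ k * A.card ^ 2 := by
        rw [Finset.card_product]
        nlinarith [Nat.mul_le_mul_right A.card h1]

variable {F : Type*} [Field F] [DecidableEq F]

/-- The pairs of points of `A` at distance `r`. -/
def distPairs (A : Finset (F × F)) (r : F) : Finset ((F × F) × (F × F)) :=
  (A ×ˢ A).filter fun g => dist2 g.1 g.2 = r

variable {K : Type*} [Field K] [Algebra F K]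

open Classical in
noncomputable def nullImage (i : K) (A : Finset (F × F)) : Finset (K × K) := A.image (nullCoord i)

omit [DecidableEq F] in
theorem mem_nullImage {i : K} {A : Finset (F × F)} {a : F × F} (ha : a ∈ A) :
    nullCoord i a ∈ nullImage i A := by
  classical
  exact Finset.mem_image_of_mem _ ha

omit [DecidableEq F] in
theorem card_nullImage (h2 : (2 : F) ≠ 0) {i : K} (hi : i ^ 2 = -1) (A : Finset (F × F)) :
    (nullImage i A).card = A.card := by
  classical
  exact Finset.card_image_of_injective _ (nullCoord_injective h2 hi)

open Classical in
theorem image_distPairs {i : K} (hi : i ^ 2 = -1) (A : Finset (F × F))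
    (r : F) : (distPairs A r).image (Prod.map (nullCoord i) (nullCoord i))
      = (nullImage i A ×ˢ nullImage i A).filter fun g => nullDist g.1 g.2 = algebraMap F K r := by
  ext ⟨x, y⟩
  simp only [distPairs, nullImage, Finset.mem_image, Finset.mem_filter, Finset.mem_product,
    Prod.map, Prod.mk.injEq]
  constructor
  · rintro ⟨⟨a, b⟩, ⟨⟨ha, hb⟩, h⟩, rfl, rfl⟩
    exact ⟨⟨⟨_, ha, rfl⟩, _, hb, rfl⟩, by rw [nullDist, nullCoord_dist2 hi, h]⟩
  · rintro ⟨⟨⟨a, ha, rfl⟩, b, hb, rfl⟩, h⟩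
    rw [nullDist, nullCoord_dist2 hi] at h
    exact ⟨(a, b), ⟨⟨ha, hb⟩, (algebraMap F K).injective h⟩, rfl, rfl⟩

open Classical in
theorem sq_card_distPairs_le (h2 : (2 : F) ≠ 0) {i : K} (hi : i ^ 2 = -1) (A : Finset (F × F))
    {r : F} (hr : r ≠ 0) :
    (distPairs A r).card ^ 2 ≤ A.card * ((distPairs A r).card + 2 * A.card ^ 2) := by
  have hinj := nullCoord_injective (F := F) h2 hi
  have := sq_card_nullDist_le (nullImage i A) ((map_ne_zero (algebraMap F K)).2 hr)
  rwa [← image_distPairs hi, Finset.card_image_of_injective _ (hinj.prodMap hinj),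
    card_nullImage h2 hi] at this

open Classical in
/-- The non-isotropic pairs of points of `A` which do not lie on a common rich curve. -/
noncomputable def goodPairs (i : K) (A : Finset (F × F)) (k : ℕ) : Finset ((F × F) × (F × F)) :=
  (A ×ˢ A).filter fun g => dist2 g.1 g.2 ≠ 0 ∧
    Good (nullImage i A) k (nullCoord i g.1) (nullCoord i g.2)

/-- Pairs of good pairs with a common bisector. -/
noncomputable def bisectorEnergy (i : K) (A : Finset (F × F)) (k : ℕ)
    (L : (F × F) × (F × F) → Option F × F) : Finset (((F × F) × (F × F)) × ((F × F) × (F × F))) :=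
  (goodPairs i A k ×ˢ goodPairs i A k).filter fun q => L q.1 = L q.2

def regroup {α : Type*} (q : (α × α) × (α × α)) : (α × α) × (α × α) :=
  ((q.1.1, q.2.1), (q.1.2, q.2.2))

theorem regroup_injective {α : Type*} : Function.Injective (regroup (α := α)) := by
  rintro ⟨⟨a, b⟩, c, d⟩ ⟨⟨a', b'⟩, c', d'⟩ h
  simp only [regroup, Prod.mk.injEq] at h ⊢
  tauto

variable [Infinite K] {p : ℕ} [CharP K p]

theorem card_bisectorEnergy_dist_le (h2 : (2 : F) ≠ 0) {i : K} (hi : i ^ 2 = -1)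
    {A : Finset (F × F)} {k e : ℕ} (hk : 2 ≤ k) (hfib : FibersLT (nullImage i A) k)
    {L : (F × F) × (F × F) → Option F × F} (hL : ∀ g, IsBisector (L g) g.1 g.2) {r : F}
    (hr : r ≠ 0) (hcard : 2 * (distPairs A r).card * (3 * e + 1) < (e + 1) ^ 3)
    (hp : 6 * e + 1 < p) :
    ((bisectorEnergy i A k L).filter fun q => dist2 q.1.1 q.2.1 = r).card
      ≤ (21 * e + k) * (2 * (distPairs A r).card) := by
  classical
  have hinj := nullCoord_injective (F := F) h2 hi
  have hinj2 := hinj.prodMap hinj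
  have hP := Finset.card_image_of_injective (distPairs A r) hinj2
  rw [← hP] at hcard ⊢
  refine le_trans ?_ (card_bisRel_le (p := p) ((map_ne_zero (algebraMap F K)).2 hr) hk hfib ?_
    hcard hp)
  · refine Finset.card_le_card_of_injOn
      (fun q => Prod.map (Prod.map (nullCoord i) (nullCoord i))
        (Prod.map (nullCoord i) (nullCoord i)) (regroup q)) (fun q hq => ?_)
      ((hinj2.prodMap hinj2).comp regroup_injective).injOn
    obtain ⟨hq, hqr⟩ := Finset.mem_filter.1 (Finset.mem_coe.1 hq)
    obtain ⟨hq, hqL⟩ := Finset.mem_filter.1 hq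
    obtain ⟨h1, h2⟩ := Finset.mem_product.1 hq
    obtain ⟨h1, -, h1g⟩ := Finset.mem_filter.1 h1
    obtain ⟨h2, -, h2g⟩ := Finset.mem_filter.1 h2
    rw [Finset.mem_product] at h1 h2
    have hb1 := hL q.1
    have hb2 := hL q.2
    rw [← hqL] at hb2
    refine Finset.mem_coe.2 (Finset.mem_filter.2 ⟨Finset.mem_product.2 ⟨?_, ?_⟩, ?_, h1g, h2g⟩)
    · exact Finset.mem_image.2 ⟨(q.1.1, q.2.1), Finset.mem_filter.2
        ⟨Finset.mem_product.2 ⟨h1.1, h2.1⟩, hqr⟩, rfl⟩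
    · exact Finset.mem_image.2 ⟨(q.1.2, q.2.2), Finset.mem_filter.2
        ⟨Finset.mem_product.2 ⟨h1.2, h2.2⟩, (hb1.dist2_eq hb2).symm.trans hqr⟩, rfl⟩
    · exact hb1.bisRel hi hb2
  · intro g hg
    rw [image_distPairs hi] at hg
    obtain ⟨hg, hgr⟩ := Finset.mem_filter.1 hg
    exact ⟨(Finset.mem_product.1 hg).1, (Finset.mem_product.1 hg).2, hgr⟩

omit [Infinite K] [DecidableEq F] in
theorem FibersLT.fibers_le (h2 : (2 : F) ≠ 0) {i : K} (hi : i ^ 2 = -1) {A : Finset (F × F)}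
    {k : ℕ} (h : FibersLT (nullImage i A) k) :
    (∀ x ∈ A, ∀ S ⊆ A, (∀ y ∈ S, (nullCoord i x).1 = (nullCoord i y).1) → S.card ≤ k) ∨
      ∀ x ∈ A, ∀ S ⊆ A, (∀ y ∈ S, (nullCoord i x).2 = (nullCoord i y).2) → S.card ≤ k := by
  classical
  have key (f : K × K → K)
      (h : ∀ S ⊆ nullImage i A, ∀ z, (∀ q ∈ S, f q = z) → S.card < k) : ∀ x ∈ A, ∀ S ⊆ A,
      (∀ y ∈ S, f (nullCoord i x) = f (nullCoord i y)) → S.card ≤ k := by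
    intro x _ S hS hy
    rw [← Finset.card_image_of_injective S (nullCoord_injective h2 hi)]
    refine (h _ (Finset.image_subset_image hS) (f (nullCoord i x)) fun q hq => ?_).le
    obtain ⟨y, hyS, rfl⟩ := Finset.mem_image.1 hq
    exact (hy y hyS).symm
  exact h.imp (key _) (key _)

omit [Infinite K] in
theorem card_bisectorEnergy_isotropic_le (h2 : (2 : F) ≠ 0) {i : K} (hi : i ^ 2 = -1)
    {A : Finset (F × F)} {k : ℕ} (hfib : FibersLT (nullImage i A) k)
    {L : (F × F) × (F × F) → Option F × F} (hL : ∀ g, IsBisector (L g) g.1 g.2) :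
    ((bisectorEnergy i A k L).filter fun q => dist2 q.1.1 q.2.1 = 0).card ≤ 2 * k * A.card ^ 2 := by
  classical
  let Q := (bisectorEnergy i A k L).filter fun q => dist2 q.1.1 q.2.1 = 0
  have hQ : ∀ q ∈ Q, (q.1.1 ∈ A ∧ q.1.2 ∈ A) ∧ (q.2.1 ∈ A ∧ q.2.2 ∈ A) ∧ dist2 q.1.1 q.1.2 ≠ 0 ∧
      IsBisector (L q.1) q.1.1 q.1.2 ∧ IsBisector (L q.1) q.2.1 q.2.2 ∧
      dist2 q.1.1 q.2.1 = 0 := by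
    intro q hq
    obtain ⟨hq, hq0⟩ := Finset.mem_filter.1 hq
    obtain ⟨hq, hqL⟩ := Finset.mem_filter.1 hq
    obtain ⟨h1, h2⟩ := Finset.mem_product.1 hq
    obtain ⟨h1, h1d, -⟩ := Finset.mem_filter.1 h1
    exact ⟨Finset.mem_product.1 h1, Finset.mem_product.1 (Finset.mem_filter.1 h2).1, h1d, hL _,
      hqL ▸ hL q.2, hq0⟩
  have inj1 : ∀ q ∈ Q, ∀ q' ∈ Q, q.1.1 = q'.1.1 → q.1.2 = q'.1.2 → q.2.1 = q'.2.1 → q = q' := by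
    intro q hq q' hq' e1 e2 e3
    have h := hQ q hq
    have h' := hQ q' hq'
    have e : q.1 = q'.1 := Prod.ext e1 e2
    have h3 := h'.2.2.2.2.1
    rw [← e, ← e3] at h3
    exact Prod.ext e (Prod.ext e3 (h.2.2.2.1.right_unique h.2.2.1 h.2.2.2.2.1 h3))
  have inj2 : ∀ q ∈ Q, ∀ q' ∈ Q, q.1.1 = q'.1.1 → q.1.2 = q'.1.2 → q.2.2 = q'.2.2 → q = q' := by
    intro q hq q' hq' e1 e2 e3
    have h := hQ q hq
    have h' := hQ q' hq'
    have e : q.1 = q'.1 := Prod.ext e1 e2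
    have h3 := h'.2.2.2.2.1.symm
    rw [← e, ← e3] at h3
    exact Prod.ext e (Prod.ext
      (h.2.2.2.1.right_unique h.2.2.1 h.2.2.2.2.1.symm h3) e3)
  have hbound : ∀ f g : F × F → K,
      ((∀ x ∈ A, ∀ S ⊆ A, (∀ y ∈ S, f x = f y) → S.card ≤ k) ∨
        ∀ x ∈ A, ∀ S ⊆ A, (∀ y ∈ S, g x = g y) → S.card ≤ k) →
      (Q.filter fun q => f q.1.1 = f q.2.1 ∧ g q.1.2 = g q.2.2).card ≤ k * A.card ^ 2 := by
    rintro f g (h | h)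
    · refine card_le_of_fibers h (φ := fun q => ((q.1.1, q.2.1), q.1.2)) ?_ ?_
      · intro q hq q' hq' e
        simp only [Prod.mk.injEq] at e
        exact inj1 q (Finset.mem_filter.1 hq).1 q' (Finset.mem_filter.1 hq').1 e.1.1 e.2 e.1.2
      · intro q hq
        obtain ⟨hq, hf, -⟩ := Finset.mem_filter.1 hq
        exact ⟨(hQ q hq).1, (hQ q hq).2.1.1, hf⟩
    · refine card_le_of_fibers h (φ := fun q => ((q.1.2, q.2.2), q.1.1)) ?_ ?_
      · intro q hq q' hq' e
        simp only [Prod.mk.injEq] at e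
        exact inj2 q (Finset.mem_filter.1 hq).1 q' (Finset.mem_filter.1 hq').1 e.2 e.1.1 e.1.2
      · intro q hq
        obtain ⟨hq, -, hg⟩ := Finset.mem_filter.1 hq
        exact ⟨(hQ q hq).1.symm, (hQ q hq).2.1.2, hg⟩
  have hor := hfib.fibers_le h2 hi
  calc Q.card ≤ ((Q.filter fun q => (nullCoord i q.1.1).1 = (nullCoord i q.2.1).1 ∧
          (nullCoord i q.1.2).2 = (nullCoord i q.2.2).2) ∪
        (Q.filter fun q => (nullCoord i q.1.1).2 = (nullCoord i q.2.1).2 ∧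
          (nullCoord i q.1.2).1 = (nullCoord i q.2.2).1)).card := by
        refine Finset.card_le_card fun q hq => ?_
        obtain ⟨-, -, hd, hb, hb', h0⟩ := hQ q hq
        rw [← Finset.filter_or]
        exact Finset.mem_filter.2 ⟨hq, hb.isotropic hi hd hb' h0⟩
    _ ≤ k * A.card ^ 2 + k * A.card ^ 2 := (Finset.card_union_le _ _).trans
        (add_le_add (hbound _ _ hor) (hbound _ _ hor.symm))
    _ = 2 * k * A.card ^ 2 := by ring

theorem card_bisectorEnergy_le [Fintype F] (h2 : (2 : F) ≠ 0) {i : K} (hi : i ^ 2 = -1)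
    {A : Finset (F × F)} {k : ℕ} {e : F → ℕ} (hk : 2 ≤ k) (hfib : FibersLT (nullImage i A) k)
    {L : (F × F) × (F × F) → Option F × F} (hL : ∀ g, IsBisector (L g) g.1 g.2)
    (hcard : ∀ r, r ≠ 0 → 2 * (distPairs A r).card * (3 * e r + 1) < (e r + 1) ^ 3)
    (hp : ∀ r, r ≠ 0 → 6 * e r + 1 < p) :
    (bisectorEnergy i A k L).card ≤ 2 * k * A.card ^ 2
      + ∑ r ∈ Finset.univ.erase 0, (21 * e r + k) * (2 * (distPairs A r).card) := by
  rw [Finset.card_eq_sum_card_fiberwise (f := fun q => dist2 q.1.1 q.2.1) (t := Finset.univ)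
    (fun _ _ => Finset.mem_coe.2 (Finset.mem_univ _)),
    ← Finset.add_sum_erase _ _ (Finset.mem_univ 0)]
  exact add_le_add (card_bisectorEnergy_isotropic_le h2 hi hfib hL) (Finset.sum_le_sum fun r hr =>
    card_bisectorEnergy_dist_le h2 hi hk hfib hL (Finset.ne_of_mem_erase hr)
      (hcard r (Finset.ne_of_mem_erase hr)) (hp r (Finset.ne_of_mem_erase hr)))

end Energy

section Count

variable {F : Type*} [Field F]

theorem dist2_comm (x y : F × F) : dist2 x y = dist2 y x := by
  simp only [dist2]
  ring

variable [DecidableEq F]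

/-- The number of points of `A` at distance `r` from `x`. -/
def circleCard (A : Finset (F × F)) (x : F × F) (r : F) : ℕ :=
  (A.filter fun a => dist2 x a = r).card

theorem card_distPairs (A : Finset (F × F)) (r : F) :
    (distPairs A r).card = ∑ x ∈ A, circleCard A x r := by
  simp only [distPairs, circleCard, Finset.card_filter, Finset.sum_product]

variable [Fintype F]

/-- The number of isosceles triples in `A` with non-zero equal sides. -/
def isoscelesCount (A : Finset (F × F)) : ℕ :=
  ∑ x ∈ A, ∑ r ∈ Finset.univ.erase 0, circleCard A x r ^ 2

def isoscelesTriples (A : Finset (F × F)) : Finset ((F × F) × (F × F) × (F × F)) :=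
  (A ×ˢ (A ×ˢ A)).filter fun t => dist2 t.1 t.2.1 = dist2 t.1 t.2.2 ∧ dist2 t.1 t.2.1 ≠ 0

theorem isoscelesCount_eq (A : Finset (F × F)) : isoscelesCount A = (isoscelesTriples A).card := by
  rw [isoscelesTriples, Finset.card_filter, Finset.sum_product]
  refine Finset.sum_congr rfl fun x _ => ?_
  rw [← Finset.card_filter, Finset.card_eq_sum_card_fiberwise (f := fun g => dist2 x g.1)
    (t := Finset.univ.erase 0)
    (fun g hg => Finset.mem_coe.2 (Finset.mem_erase.2
      ⟨(Finset.mem_filter.1 (Finset.mem_coe.1 hg)).2.2, Finset.mem_univ _⟩))]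
  refine Finset.sum_congr rfl fun r hr => ?_
  rw [sq, circleCard, ← Finset.card_product]
  congr 1
  ext ⟨a, b⟩
  simp only [Finset.mem_filter, Finset.mem_product]
  constructor
  · rintro ⟨⟨ha, h1⟩, hb, h2⟩
    exact ⟨⟨⟨ha, hb⟩, h1.trans h2.symm, h1 ▸ Finset.ne_of_mem_erase hr⟩, h1⟩
  · rintro ⟨⟨⟨ha, hb⟩, h1, -⟩, h2⟩
    exact ⟨⟨ha, h2⟩, hb, h1 ▸ h2⟩

theorem sum_sq_card_distPairs_le (A : Finset (F × F)) :
    ∑ r ∈ Finset.univ.erase 0, (distPairs A r).card ^ 2 ≤ A.card * isoscelesCount A := by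
  rw [isoscelesCount, Finset.sum_comm, Finset.mul_sum]
  refine Finset.sum_le_sum fun r _ => ?_
  rw [card_distPairs]
  exact sq_sum_le_card_mul_sum_sq

theorem sum_card_distPairs_le (A : Finset (F × F)) :
    ∑ r ∈ Finset.univ.erase 0, (distPairs A r).card ≤ A.card ^ 2 := by
  rw [sq, ← Finset.card_product, Finset.card_eq_sum_card_fiberwise
    (f := fun g : (F × F) × (F × F) => dist2 g.1 g.2) (t := Finset.univ)
    (fun _ _ => Finset.mem_coe.2 (Finset.mem_univ _))]
  exact Finset.sum_le_sum_of_subset (Finset.erase_subset _ _)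

variable {K : Type*} [Field K] [Algebra F K]

noncomputable def bisectorCount (i : K) (A : Finset (F × F)) (k : ℕ)
    (L : (F × F) × (F × F) → Option F × F) (l : Option F × F) : ℕ :=
  ((goodPairs i A k).filter fun g => L g = l).card

theorem sum_bisectorCount_le (i : K) (A : Finset (F × F)) (k : ℕ)
    (L : (F × F) × (F × F) → Option F × F) : ∑ l, bisectorCount i A k L l ≤ A.card ^ 2 := by
  classical
  have h : (goodPairs i A k).card = ∑ l, bisectorCount i A k L l :=
    Finset.card_eq_sum_card_fiberwise (fun _ _ => Finset.mem_coe.2 (Finset.mem_univ _))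
  rw [← h, sq, ← Finset.card_product]
  exact Finset.card_le_card (Finset.filter_subset _ _)

theorem sum_bisectorCount_sq (i : K) (A : Finset (F × F)) (k : ℕ)
    (L : (F × F) × (F × F) → Option F × F) :
    ∑ l, bisectorCount i A k L l ^ 2 = (bisectorEnergy i A k L).card := by
  rw [Finset.card_eq_sum_card_fiberwise (s := bisectorEnergy i A k L) (f := fun q => L q.1)
    (t := Finset.univ) (fun _ _ => Finset.mem_coe.2 (Finset.mem_univ _))]
  refine Finset.sum_congr rfl fun l _ => ?_
  rw [sq, bisectorCount, ← Finset.card_product]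
  congr 1
  ext ⟨g, h⟩
  simp only [bisectorEnergy, Finset.mem_filter, Finset.mem_product]
  constructor
  · rintro ⟨⟨hg, h1⟩, hh, h2⟩
    exact ⟨⟨⟨hg, hh⟩, h1.trans h2.symm⟩, h1⟩
  · rintro ⟨⟨⟨hg, hh⟩, h1⟩, h2⟩
    exact ⟨⟨hg, h2⟩, hh, h1 ▸ h2⟩

omit [DecidableEq F] [Fintype F] in
theorem dist2_ne_zero_of_equidistant (h2 : (2 : F) ≠ 0) {i : K} (hi : i ^ 2 = -1) {x a b : F × F}
    (hab : a ≠ b) (h : dist2 x a = dist2 x b) (h0 : dist2 x a ≠ 0) : dist2 a b ≠ 0 := by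
  intro hd
  have e := nullCoord_dist2 (K := K) hi a b
  rw [hd, map_zero] at e
  have ea := nullCoord_dist2 (K := K) hi x a
  have eb := nullCoord_dist2 (K := K) hi x b
  rw [← h, ← ea] at eb
  have hne : ((nullCoord i x).1 - (nullCoord i a).1)
      * ((nullCoord i x).2 - (nullCoord i a).2) ≠ 0 := by
    rw [ea]
    exact (map_ne_zero _).2 h0
  refine hab (nullCoord_injective h2 hi ?_)
  rcases mul_eq_zero.1 e with hz | hz
  · have hz' := sub_eq_zero.1 hz
    rw [← hz'] at eb
    exact Prod.ext hz' (sub_right_injective (mul_left_cancel₀ (left_ne_zero_of_mul hne) eb)).symm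
  · have hz' := sub_eq_zero.1 hz
    rw [← hz'] at eb
    exact Prod.ext (sub_right_injective (mul_right_cancel₀ (right_ne_zero_of_mul hne) eb)).symm hz'

theorem card_isoscelesTriples_le (h2 : (2 : F) ≠ 0) {i : K} (hi : i ^ 2 = -1)
    {A : Finset (F × F)} {k : ℕ} (hk : 4 * A.card ≤ k ^ 2)
    {L : (F × F) × (F × F) → Option F × F} (hL : ∀ g, IsBisector (L g) g.1 g.2) :
    (isoscelesTriples A).card
      ≤ 5 * A.card ^ 2 + ∑ l, lineCard A l * bisectorCount i A k L l := by
  classical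
  have hinj := nullCoord_injective (F := F) h2 hi
  have hd (a b : F × F) : nullDist (nullCoord i a) (nullCoord i b) = algebraMap F K (dist2 a b) :=
    nullCoord_dist2 hi a b
  let T₁ := (isoscelesTriples A).filter fun t => t.2.1 = t.2.2
  let T₂ := (isoscelesTriples A).filter fun t => t.2.1 ≠ t.2.2 ∧
    ¬ Good (nullImage i A) k (nullCoord i t.2.1) (nullCoord i t.2.2)
  let T₃ := (isoscelesTriples A).filter fun t => t.2 ∈ goodPairs i A k
  have hcover : isoscelesTriples A ⊆ (T₁ ∪ T₂) ∪ T₃ := by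
    intro t ht
    obtain ⟨hA, he, h0⟩ := Finset.mem_filter.1 ht
    by_cases h1 : t.2.1 = t.2.2
    · exact Finset.mem_union_left _ (Finset.mem_union_left _ (Finset.mem_filter.2 ⟨ht, h1⟩))
    by_cases hg : Good (nullImage i A) k (nullCoord i t.2.1) (nullCoord i t.2.2)
    · exact Finset.mem_union_right _ (Finset.mem_filter.2 ⟨ht, Finset.mem_filter.2
        ⟨(Finset.mem_product.1 hA).2, dist2_ne_zero_of_equidistant h2 hi h1 he h0, hg⟩⟩)
    · exact Finset.mem_union_left _ (Finset.mem_union_right _ (Finset.mem_filter.2 ⟨ht, h1, hg⟩))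
  have h₁ : T₁.card ≤ A.card ^ 2 := by
    rw [sq, ← Finset.card_product]
    refine Finset.card_le_card_of_injOn (fun t => (t.1, t.2.1)) (fun t ht => ?_) ?_
    · have := Finset.mem_product.1 (Finset.mem_filter.1 (Finset.mem_filter.1
        (Finset.mem_coe.1 ht)).1).1
      exact Finset.mem_coe.2 (Finset.mem_product.2 ⟨this.1, (Finset.mem_product.1 this.2).1⟩)
    · rintro ⟨x, a, b⟩ ht ⟨x', a', b'⟩ ht' h
      have e := (Finset.mem_filter.1 (Finset.mem_coe.1 ht)).2
      have e' := (Finset.mem_filter.1 (Finset.mem_coe.1 ht')).2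
      simp only [Prod.mk.injEq] at h e e' ⊢
      exact ⟨h.1, h.2, by rw [← e, ← e', h.2]⟩
  have h₂ : T₂.card ≤ 4 * A.card ^ 2 := by
    have := card_isosceles_not_good_le (B := nullImage i A) (k := k)
      (by rwa [card_nullImage h2 hi])
    rw [card_nullImage h2 hi] at this
    refine (Finset.card_le_card_of_injOn (Prod.map (nullCoord i) (Prod.map (nullCoord i)
      (nullCoord i))) (fun t ht => ?_) (hinj.prodMap (hinj.prodMap hinj)).injOn).trans this
    obtain ⟨ht, hne, hg⟩ := Finset.mem_filter.1 (Finset.mem_coe.1 ht)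
    obtain ⟨hA, he, h0⟩ := Finset.mem_filter.1 ht
    simp only [Finset.mem_product] at hA
    refine Finset.mem_coe.2 (Finset.mem_filter.2 ⟨?_, ?_, ?_, ?_, hg⟩)
    · simp only [Finset.mem_product, Prod.map]
      exact ⟨mem_nullImage hA.1, mem_nullImage hA.2.1, mem_nullImage hA.2.2⟩
    · simp only [Prod.map, hd, he]
    · simp only [Prod.map, hd]
      exact (map_ne_zero _).2 h0
    · exact fun h => hne (hinj h)
  have h₃ : T₃.card ≤ ∑ l, lineCard A l * bisectorCount i A k L l := by
    calc T₃.card ≤ ((goodPairs i A k).sigma fun g => A.filter fun x =>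
            lineForm (L g).1 x = (L g).2).card := by
          refine Finset.card_le_card_of_injOn (fun t => ⟨t.2, t.1⟩) (fun t ht => ?_) ?_
          · obtain ⟨ht, hg⟩ := Finset.mem_filter.1 (Finset.mem_coe.1 ht)
            obtain ⟨hA, he, h0⟩ := Finset.mem_filter.1 ht
            refine Finset.mem_coe.2 (Finset.mem_sigma.2 ⟨hg, Finset.mem_filter.2
              ⟨(Finset.mem_product.1 hA).1, (hL t.2).lineForm_eq h2 ?_ he⟩⟩)
            intro hab
            refine (Finset.mem_filter.1 hg).2.1 ?_
            rw [hab]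
            simp [dist2]
          · intro t _ t' _ h
            simp only [Sigma.mk.injEq, heq_eq_eq] at h
            exact Prod.ext h.2 h.1
      _ = ∑ g ∈ goodPairs i A k, lineCard A (L g) := Finset.card_sigma _ _
      _ = ∑ l, lineCard A l * bisectorCount i A k L l := by
          rw [← Finset.sum_fiberwise_of_maps_to (t := Finset.univ) (g := L)
            (fun _ _ => Finset.mem_univ _)]
          refine Finset.sum_congr rfl fun l _ => ?_
          rw [Finset.sum_congr rfl fun g hg => by rw [(Finset.mem_filter.1 hg).2],
            Finset.sum_const, smul_eq_mul, mul_comm, bisectorCount]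
  have := Finset.card_le_card hcover
  have := Finset.card_union_le (T₁ ∪ T₂) T₃
  have := Finset.card_union_le T₁ T₂
  omega

variable [Infinite K] {p : ℕ} [CharP K p]

theorem card_bisectorEnergy_le_real (h2 : (2 : F) ≠ 0) {i : K} (hi : i ^ 2 = -1)
    {A : Finset (F × F)} {k : ℕ} (hk : 2 ≤ k) (hfib : FibersLT (nullImage i A) k)
    {L : (F × F) × (F × F) → Option F × F} (hL : ∀ g, IsBisector (L g) g.1 g.2)
    (hp : ∀ r, r ≠ 0 → 6 * Nat.sqrt (6 * (distPairs A r).card) + 1 < p) {s : ℝ} (hs : 0 < s) :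
    ((bisectorEnergy i A k L).card : ℝ) ≤ 4 * k * (A.card : ℝ) ^ 2 + 21 * s * (A.card : ℝ) ^ 2
      + 126 * (A.card * isoscelesCount A) / s := by
  have h := card_bisectorEnergy_le (p := p) h2 hi hk hfib hL
    (e := fun r => Nat.sqrt (6 * (distPairs A r).card)) (fun r _ => ?_) hp
  · have h' : ((bisectorEnergy i A k L).card : ℝ) ≤ 2 * k * (A.card : ℝ) ^ 2
      + ∑ r ∈ Finset.univ.erase 0, (21 * (Nat.sqrt (6 * (distPairs A r).card) : ℝ) + k)
        * (2 * ((distPairs A r).card : ℝ)) := by exact_mod_cast h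
    refine h'.trans ?_
    have h1 : ∀ r ∈ Finset.univ.erase (0 : F), (21 * (Nat.sqrt (6 * (distPairs A r).card) : ℝ) + k)
        * (2 * ((distPairs A r).card : ℝ)) ≤ (21 * s + 2 * k) * (distPairs A r).card
          + 126 / s * ((distPairs A r).card : ℝ) ^ 2 := by
      intro r _
      set N := (distPairs A r).card
      have h3 : ((Nat.sqrt (6 * N) : ℕ) : ℝ) ^ 2 ≤ 6 * N := by exact_mod_cast Nat.sqrt_le' (6 * N)
      set e := ((Nat.sqrt (6 * N) : ℕ) : ℝ)
      have h4 : 2 * e ≤ s + 6 * N / s := by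
        rw [← sub_le_iff_le_add', le_div_iff₀ hs]
        nlinarith [sq_nonneg (e - s)]
      have h5 : (0 : ℝ) ≤ 21 * N := by positivity
      have h6 := mul_le_mul_of_nonneg_left h4 h5
      have h7 : (21 * N : ℝ) * (s + 6 * N / s) = 21 * s * N + 126 / s * (N : ℝ) ^ 2 := by ring
      nlinarith
    have h2 := Finset.sum_le_sum h1
    rw [Finset.sum_add_distrib, ← Finset.mul_sum, ← Finset.mul_sum] at h2
    have h3 : ∑ r ∈ Finset.univ.erase 0, ((distPairs A r).card : ℝ) ≤ (A.card : ℝ) ^ 2 := by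
      exact_mod_cast sum_card_distPairs_le A
    have h4 : ∑ r ∈ Finset.univ.erase 0, ((distPairs A r).card : ℝ) ^ 2
        ≤ A.card * isoscelesCount A := by
      exact_mod_cast sum_sq_card_distPairs_le A
    have h5 := mul_le_mul_of_nonneg_left h3 (show 0 ≤ 21 * s + 2 * (k : ℝ) by positivity)
    have h6 := mul_le_mul_of_nonneg_left h4 (show 0 ≤ 126 / s by positivity)
    have h7 : 126 / s * (A.card * isoscelesCount A) = 126 * (A.card * isoscelesCount A) / s := by
      ring
    rw [h7] at h6
    linarith
  · have h3 := Nat.lt_succ_sqrt (6 * (distPairs A r).card)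
    set e := Nat.sqrt (6 * (distPairs A r).card)
    rw [Nat.succ_eq_add_one] at h3
    nlinarith [Nat.mul_lt_mul_of_pos_right h3 (Nat.succ_pos e)]

theorem isoscelesCount_le (h2 : (2 : F) ≠ 0) {i : K} (hi : i ^ 2 = -1)
    {A : Finset (F × F)} {k : ℕ} (hk : 2 ≤ k) (hkA : 4 * A.card ≤ k ^ 2)
    (hfib : FibersLT (nullImage i A) k)
    (hp : ∀ r, r ≠ 0 → 6 * Nat.sqrt (6 * (distPairs A r).card) + 1 < p) {s : ℝ} (hs : 0 < s) :
    (isoscelesCount A : ℝ) ≤ 5 * (A.card : ℝ) ^ 2 + (A.card : ℝ) ^ 3 / Fintype.card F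
      + √(Fintype.card F * A.card * (4 * k * (A.card : ℝ) ^ 2 + 21 * s * (A.card : ℝ) ^ 2
        + 126 * (A.card * isoscelesCount A) / s)) := by
  choose L hL using fun g : (F × F) × (F × F) => exists_isBisector h2 g.1 g.2
  have hE := card_bisectorEnergy_le_real (p := p) h2 hi hk hfib hL hp hs
  have hT := card_isoscelesTriples_le h2 hi hkA hL
  rw [← isoscelesCount_eq] at hT
  have hT' : (isoscelesCount A : ℝ) ≤ 5 * (A.card : ℝ) ^ 2
      + ∑ l, (lineCard A l : ℝ) * bisectorCount i A k L l := by exact_mod_cast hT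
  have hS := sum_lineCard_mul_le A fun l => (bisectorCount i A k L l : ℝ)
  have hB : ∑ l, (bisectorCount i A k L l : ℝ) ≤ (A.card : ℝ) ^ 2 := by
    exact_mod_cast sum_bisectorCount_le i A k L
  have hB2 : ∑ l, (bisectorCount i A k L l : ℝ) ^ 2 = (bisectorEnergy i A k L).card := by
    exact_mod_cast sum_bisectorCount_sq i A k L
  rw [hB2] at hS
  have h1 := (le_abs_self _).trans (Real.abs_le_sqrt
    (hS.trans (mul_le_mul_of_nonneg_left hE (by positivity))))
  have h3 := mul_le_mul_of_nonneg_left hB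
    (show (0 : ℝ) ≤ A.card / Fintype.card F by positivity)
  have h4 : (A.card : ℝ) / Fintype.card F * (A.card : ℝ) ^ 2
      = (A.card : ℝ) ^ 3 / Fintype.card F := by ring
  rw [h4] at h3
  linarith

end Count

section Assembly

variable {F : Type*} [Field F]

theorem pinnedMax_mono {A B : Finset (F × F)} (h : A ⊆ B) : pinnedMax A ≤ pinnedMax B := by
  refine Finset.sup_le fun x hx => le_trans ?_ (Finset.le_sup (f := pinnedCount B) (h hx))
  exact Set.ncard_le_ncard (Set.image_mono (Finset.coe_subset.2 h)) (B.finite_toSet.image _)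

theorem pinnedMax_pos {A : Finset (F × F)} (h : A.Nonempty) : 0 < pinnedMax A := by
  obtain ⟨x, hx⟩ := h
  refine lt_of_lt_of_le ?_ (Finset.le_sup (f := pinnedCount A) hx)
  exact (Set.ncard_pos (A.finite_toSet.image _)).2 ⟨_, Set.mem_image_of_mem _ (Finset.mem_coe.2 hx)⟩

variable [DecidableEq F]

theorem card_image_dist2_le {A : Finset (F × F)} {x : F × F} (hx : x ∈ A) :
    (A.image fun a => dist2 x a).card ≤ pinnedMax A := by
  refine le_trans (le_of_eq ?_) (Finset.le_sup (f := pinnedCount A) hx)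
  rw [pinnedCount, ← Set.ncard_coe_finset, Finset.coe_image]
  congr 2
  ext a
  rw [dist2_comm]

variable [Fintype F] {K : Type*} [Field K] [Algebra F K]

theorem circleCard_zero_le {i : K} (hi : i ^ 2 = -1) (A : Finset (F × F)) (x : F × F) :
    circleCard A x 0 ≤ 2 * Fintype.card F := by
  classical
  have hi0 : i ≠ 0 := by
    rintro rfl
    norm_num at hi
  have h1 : (A.filter fun a => (nullCoord i x).1 = (nullCoord i a).1).card ≤ Fintype.card F := by
    refine Finset.card_le_card_of_injOn Prod.fst
      (fun _ _ => Finset.mem_coe.2 (Finset.mem_univ _)) ?_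
    intro a ha b hb h
    have e := (Finset.mem_filter.1 (Finset.mem_coe.1 ha)).2.symm.trans
      (Finset.mem_filter.1 (Finset.mem_coe.1 hb)).2
    simp only [nullCoord, h] at e
    exact Prod.ext h ((algebraMap F K).injective (mul_left_cancel₀ hi0 (add_left_cancel e)))
  have h2 : (A.filter fun a => (nullCoord i x).2 = (nullCoord i a).2).card ≤ Fintype.card F := by
    refine Finset.card_le_card_of_injOn Prod.fst
      (fun _ _ => Finset.mem_coe.2 (Finset.mem_univ _)) ?_
    intro a ha b hb h
    have e := (Finset.mem_filter.1 (Finset.mem_coe.1 ha)).2.symm.trans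
      (Finset.mem_filter.1 (Finset.mem_coe.1 hb)).2
    simp only [nullCoord, h] at e
    exact Prod.ext h ((algebraMap F K).injective (mul_left_cancel₀ hi0 (sub_right_injective e)))
  rw [two_mul]
  refine le_trans (Finset.card_le_card fun a ha => ?_)
    ((Finset.card_union_le _ _).trans (add_le_add h1 h2))
  obtain ⟨haA, ha0⟩ := Finset.mem_filter.1 ha
  have e := nullCoord_dist2 (K := K) hi x a
  rw [ha0, map_zero] at e
  rw [← Finset.filter_or]
  exact Finset.mem_filter.2 ⟨haA, (mul_eq_zero.1 e).imp sub_eq_zero.1 sub_eq_zero.1⟩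

theorem card_cube_le {i : K} (hi : i ^ 2 = -1) {A : Finset (F × F)}
    (hA : 4 * Fintype.card F ≤ A.card) : A.card ^ 3 ≤ 4 * pinnedMax A * isoscelesCount A := by
  have hx : ∀ x ∈ A, A.card ^ 2 ≤
      4 * pinnedMax A * ∑ r ∈ Finset.univ.erase 0, circleCard A x r ^ 2 := by
    intro x hx
    let R := A.image fun a => dist2 x a
    have h1 : A.card ≤ circleCard A x 0 + ∑ r ∈ R.erase 0, circleCard A x r := by
      have h : A.card = ∑ r ∈ R, circleCard A x r :=
        Finset.card_eq_sum_card_image (fun a => dist2 x a) A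
      by_cases h0 : 0 ∈ R
      · rw [h, Finset.add_sum_erase _ _ h0]
      · rw [Finset.erase_eq_of_notMem h0, ← h]
        omega
    have h2 := circleCard_zero_le hi A x
    have h3 : A.card ≤ 2 * ∑ r ∈ R.erase 0, circleCard A x r := by omega
    have h4 : (∑ r ∈ R.erase 0, circleCard A x r) ^ 2
        ≤ (R.erase 0).card * ∑ r ∈ R.erase 0, circleCard A x r ^ 2 := sq_sum_le_card_mul_sum_sq
    have h5 : (R.erase 0).card ≤ pinnedMax A :=
      (Finset.card_le_card (Finset.erase_subset _ _)).trans (card_image_dist2_le hx)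
    have h6 : ∑ r ∈ R.erase 0, circleCard A x r ^ 2
        ≤ ∑ r ∈ Finset.univ.erase 0, circleCard A x r ^ 2 :=
      Finset.sum_le_sum_of_subset (Finset.erase_subset_erase _ (Finset.subset_univ _))
    have h7 := h4.trans (Nat.mul_le_mul h5 h6)
    have h8 := Nat.pow_le_pow_left h3 2
    rw [mul_pow] at h8
    linarith
  rw [isoscelesCount, Finset.mul_sum, pow_succ', ← smul_eq_mul]
  exact Finset.card_nsmul_le_sum _ _ _ hx

omit [DecidableEq F] [Fintype F] in
theorem exists_fibersLT (h2 : (2 : F) ≠ 0) {i : K} (hi : i ^ 2 = -1) {A : Finset (F × F)} {k : ℕ}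
    (hk : A.card < k ^ 2) : ∃ B ⊆ A, A.card ≤ 2 * B.card ∧ FibersLT (nullImage i B) k := by
  classical
  have hinj := nullCoord_injective (F := F) (K := K) h2 hi
  have hk0 : k ≠ 0 := by
    rintro rfl
    simp at hk
  let fib (a : F × F) := A.filter fun b => (nullCoord i b).1 = (nullCoord i a).1
  have hsplit := Finset.card_filter_add_card_filter_not (s := A) fun a => k ≤ (fib a).card
  have hpre {B : Finset (F × F)} {S : Finset (K × K)} (hS : S ⊆ nullImage i B) :
      ∃ S' ⊆ B, S'.card = S.card ∧ ∀ a ∈ S', nullCoord i a ∈ S := by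
    obtain ⟨S', hS', rfl⟩ := Finset.subset_image_iff.1 hS
    exact ⟨S', by exact_mod_cast hS', (Finset.card_image_of_injective _ hinj).symm,
      fun a ha => Finset.mem_image_of_mem _ ha⟩
  rcases le_total (A.filter fun a => k ≤ (fib a).card).card
      (A.filter fun a => ¬ k ≤ (fib a).card).card with h | h
  · refine ⟨A.filter fun a => ¬ k ≤ (fib a).card, Finset.filter_subset _ _, by omega,
      Or.inl fun S hS z hz => ?_⟩
    obtain ⟨S', hS', hcard, hmem⟩ := hpre hS
    rw [← hcard]
    by_contra! hcon
    obtain ⟨a, ha⟩ := Finset.card_pos.1 (show 0 < S'.card by omega)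
    refine (Finset.mem_filter.1 (hS' ha)).2 (hcon.trans (Finset.card_le_card fun b hb => ?_))
    exact Finset.mem_filter.2 ⟨(Finset.mem_filter.1 (hS' hb)).1,
      (hz _ (hmem b hb)).trans (hz _ (hmem a ha)).symm⟩
  · refine ⟨A.filter fun a => k ≤ (fib a).card, Finset.filter_subset _ _, by omega,
      Or.inr fun S hS w hw => ?_⟩
    obtain ⟨S', hS', hcard, hmem⟩ := hpre hS
    rw [← hcard]
    have hdisj : (S' : Set (F × F)).PairwiseDisjoint fib := by
      intro a ha b hb hab
      refine Finset.disjoint_left.2 fun c hc hc' => hab (hinj (Prod.ext ?_ ?_))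
      · exact (Finset.mem_filter.1 hc).2.symm.trans (Finset.mem_filter.1 hc').2
      · exact (hw _ (hmem a ha)).trans (hw _ (hmem b hb)).symm
    have h3 : (S'.biUnion fib).card ≤ A.card :=
      Finset.card_le_card (Finset.biUnion_subset.2 fun a _ => Finset.filter_subset _ _)
    rw [Finset.card_biUnion hdisj] at h3
    have h4 : S'.card * k ≤ ∑ a ∈ S', (fib a).card :=
      Finset.card_nsmul_le_sum _ _ _ fun a ha => (Finset.mem_filter.1 (hS' ha)).2
    by_contra! hcon
    nlinarith [Nat.mul_le_mul_right k hcon]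

theorem sqrt_card_distPairs_lt (h2 : (2 : F) ≠ 0) {i : K} (hi : i ^ 2 = -1) {A : Finset (F × F)}
    {q : ℝ} (hq : 10 ^ 8 ≤ q) (hF : (Fintype.card F : ℝ) = q ^ 4) (hA : (A.card : ℝ) ≤ 2 * q ^ 5)
    {r : F} (hr : r ≠ 0) : 6 * Nat.sqrt (6 * (distPairs A r).card) + 1 < Fintype.card F := by
  have h1 : ((distPairs A r).card : ℝ) ^ 2
      ≤ A.card * ((distPairs A r).card + 2 * (A.card : ℝ) ^ 2) := by
    exact_mod_cast sq_card_distPairs_le h2 hi A hr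
  have h3 : ((Nat.sqrt (6 * (distPairs A r).card) : ℕ) : ℝ) ^ 2 ≤ 6 * (distPairs A r).card := by
    exact_mod_cast Nat.sqrt_le' _
  have hN0 : (0 : ℝ) ≤ (distPairs A r).card := Nat.cast_nonneg _
  have he0 : (0 : ℝ) ≤ (Nat.sqrt (6 * (distPairs A r).card) : ℕ) := Nat.cast_nonneg _
  have hn0 : (0 : ℝ) ≤ A.card := Nat.cast_nonneg _
  suffices h : 6 * ((Nat.sqrt (6 * (distPairs A r).card) : ℕ) : ℝ) + 1 < Fintype.card F by
    exact_mod_cast h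
  rw [hF]
  generalize ((Nat.sqrt (6 * (distPairs A r).card) : ℕ) : ℝ) = e at *
  generalize ((distPairs A r).card : ℝ) = N at *
  generalize (A.card : ℝ) = n at *
  have hq0 : 0 < q := by linarith
  have hN : N ≤ q ^ 8 / 10 ^ 3 := by
    by_contra! hcon
    have h4 : n ^ 3 ≤ 8 * q ^ 15 := (pow_le_pow_left₀ hn0 hA 3).trans_eq (by ring)
    have h5 : 4 * n ≤ N := by
      have : (10 : ℝ) ^ 8 * q ^ 5 ≤ q ^ 8 := by
        have h6 : (10 : ℝ) ^ 8 ≤ q ^ 3 := hq.trans (le_self_pow₀ (by linarith) (by norm_num))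
        calc (10 : ℝ) ^ 8 * q ^ 5 ≤ q ^ 3 * q ^ 5 := by gcongr
          _ = q ^ 8 := by ring
      have h7 : 0 < q ^ 5 := by positivity
      linarith
    have h6 : (q ^ 8 / 10 ^ 3) ^ 2 < N ^ 2 := pow_lt_pow_left₀ hcon (by positivity) (by norm_num)
    have h7 : (10 : ℝ) ^ 8 * q ^ 15 ≤ q ^ 16 := by
      calc (10 : ℝ) ^ 8 * q ^ 15 ≤ q * q ^ 15 := by gcongr
        _ = q ^ 16 := by ring
    have h8 : (q ^ 8 / 10 ^ 3) ^ 2 = q ^ 16 / 10 ^ 6 := by ring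
    rw [h8] at h6
    have h9 : 0 < q ^ 15 := by positivity
    nlinarith [mul_le_mul_of_nonneg_right h5 hN0]
  have h4 : 1 ≤ q ^ 4 / 20 := by
    have := le_self_pow₀ (a := q) (by linarith) (show 4 ≠ 0 by norm_num)
    linarith
  have h5 : e ≤ q ^ 4 / 10 := by
    refine le_of_sq_le_sq ?_ (by positivity)
    have : (q ^ 4 / 10) ^ 2 = q ^ 8 / 100 := by ring
    have h8 : 0 < q ^ 8 := by positivity
    rw [this]
    linarith
  linarith

theorem isoscelesCount_le_of_bounds {T n k q P : ℝ} (hq : 1 ≤ q) (hP : P = q ^ 4) (hn0 : 0 ≤ n)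
    (hn : n ≤ 2 * q ^ 5) (hk0 : 0 ≤ k) (hk : k ≤ 4 * q ^ 3) (hT0 : 0 ≤ T)
    (h : T ≤ 5 * n ^ 2 + n ^ 3 / P
      + √(P * n * (4 * k * n ^ 2 + 21 * q ^ 3 * n ^ 2 + 126 * (n * T) / q ^ 3))) :
    T ≤ 600 * q ^ 11 := by
  have hq0 : 0 < q := by linarith
  have h1 : 5 * n ^ 2 ≤ 20 * q ^ 11 := by
    calc 5 * n ^ 2 ≤ 5 * (2 * q ^ 5) ^ 2 := by gcongr
      _ = 20 * q ^ 10 := by ring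
      _ ≤ 20 * q ^ 11 := by gcongr; norm_num
  have h2 : n ^ 3 / P ≤ 8 * q ^ 11 := by
    rw [hP, div_le_iff₀ (by positivity)]
    calc n ^ 3 ≤ (2 * q ^ 5) ^ 3 := by gcongr
      _ = 8 * q ^ 11 * q ^ 4 := by ring
  have h3 : P * n * (4 * k * n ^ 2 + 21 * q ^ 3 * n ^ 2 + 126 * (n * T) / q ^ 3)
      ≤ 296 * (q ^ 11) ^ 2 + 504 * q ^ 11 * T := by
    rw [hP]
    calc q ^ 4 * n * (4 * k * n ^ 2 + 21 * q ^ 3 * n ^ 2 + 126 * (n * T) / q ^ 3)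
        ≤ q ^ 4 * (2 * q ^ 5) * (4 * (4 * q ^ 3) * (2 * q ^ 5) ^ 2 + 21 * q ^ 3 * (2 * q ^ 5) ^ 2
          + 126 * (2 * q ^ 5 * T) / q ^ 3) := by gcongr
      _ = 296 * (q ^ 11) ^ 2 + 504 * q ^ 11 * T := by
        field_simp
        ring
  by_contra! hcon
  have h4 : 0 < q ^ 11 := by positivity
  generalize q ^ 11 = X at *
  have h5 : T - 28 * X ≤ √(296 * X ^ 2 + 504 * X * T) := by
    have := Real.sqrt_le_sqrt h3
    linarith
  have h6 := (Real.le_sqrt' (by linarith)).1 h5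
  nlinarith [mul_pos h4 (lt_trans (by positivity) hcon : 0 < T), mul_lt_mul_of_pos_right hcon
    (lt_trans (by positivity) hcon : 0 < T)]

variable [Infinite K]

theorem pinnedMax_ge_of_large [CharP K (Fintype.card F)] (h2 : (2 : F) ≠ 0) {i : K}
    (hi : i ^ 2 = -1) {q : ℝ} (hq : 10 ^ 8 ≤ q) (hF : (Fintype.card F : ℝ) = q ^ 4)
    {A : Finset (F × F)} (hA : q ^ 5 ≤ A.card) : q ^ 4 ≤ 20000 * pinnedMax A := by
  have hq0 : 0 < q := by linarith
  have hq1 : 1 ≤ q := by linarith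
  obtain ⟨A₁, hA₁, hcard₁⟩ := Finset.exists_subset_card_eq (Nat.ceil_le.2 hA)
  have hm : (A₁.card : ℝ) ≤ 2 * q ^ 5 := by
    have := Nat.ceil_lt_add_one (show 0 ≤ q ^ 5 by positivity)
    rw [hcard₁]
    have := one_le_pow₀ hq1 (n := 5)
    linarith
  have hm' : q ^ 5 ≤ A₁.card := hcard₁ ▸ Nat.le_ceil _
  let k := Nat.sqrt (4 * A₁.card) + 1
  have hk : 4 * A₁.card < k ^ 2 := Nat.lt_succ_sqrt' _
  obtain ⟨B, hB, hcardB, hfib⟩ := exists_fibersLT (A := A₁) h2 hi (k := k) (by omega)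
  have hBA := Finset.card_le_card hB
  have hn : (B.card : ℝ) ≤ 2 * q ^ 5 := (Nat.cast_le.2 hBA).trans hm
  have hn' : q ^ 5 ≤ 2 * B.card := hm'.trans (by exact_mod_cast hcardB)
  have hk4 : (k : ℝ) ≤ 4 * q ^ 3 := by
    have h1 : ((Nat.sqrt (4 * A₁.card) : ℕ) : ℝ) ^ 2 ≤ 4 * A₁.card := by
      exact_mod_cast Nat.sqrt_le' _
    have h3 : ((Nat.sqrt (4 * A₁.card) : ℕ) : ℝ) ≤ 3 * q ^ 3 := by
      refine le_of_sq_le_sq ?_ (by positivity)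
      have h4 : q ^ 5 ≤ q ^ 6 := pow_le_pow_right₀ hq1 (by norm_num)
      have h5 : (3 * q ^ 3) ^ 2 = 9 * q ^ 6 := by ring
      have h6 : 0 < q ^ 6 := by positivity
      rw [h5]
      linarith
    have := one_le_pow₀ hq1 (n := 3)
    simp only [k, Nat.cast_add, Nat.cast_one]
    linarith
  have hk2 : 2 ≤ k := by
    have h1 : (0 : ℝ) < A₁.card := lt_of_lt_of_le (by positivity) hm'
    have h3 : 0 < A₁.card := by exact_mod_cast h1
    have := Nat.sqrt_pos.2 (show 0 < 4 * A₁.card by omega)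
    omega
  have hT := isoscelesCount_le_of_bounds hq1 hF (Nat.cast_nonneg _) hn (Nat.cast_nonneg _) hk4
    (Nat.cast_nonneg _) (isoscelesCount_le (p := Fintype.card F) h2 hi hk2 (by omega) hfib
      (fun r hr => sqrt_card_distPairs_lt h2 hi hq hF hn hr) (show 0 < q ^ 3 by positivity))
  have h4 : 4 * Fintype.card F ≤ B.card := by
    have h5 : (10 : ℝ) ^ 8 * q ^ 4 ≤ q ^ 5 := by
      calc (10 : ℝ) ^ 8 * q ^ 4 ≤ q * q ^ 4 := by gcongr
        _ = q ^ 5 := by ring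
    have h6 : 0 < q ^ 4 := by positivity
    have : (4 * Fintype.card F : ℝ) ≤ B.card := by
      rw [hF]
      linarith
    exact_mod_cast this
  have h5 : (B.card : ℝ) ^ 3 ≤ 4 * pinnedMax B * isoscelesCount B := by
    exact_mod_cast card_cube_le hi h4
  have h6 : (pinnedMax B : ℝ) ≤ pinnedMax A := Nat.cast_le.2 (pinnedMax_mono (hB.trans hA₁))
  have h7 : q ^ 15 ≤ 8 * (B.card : ℝ) ^ 3 := by
    calc q ^ 15 = (q ^ 5) ^ 3 := by ring
      _ ≤ (2 * (B.card : ℝ)) ^ 3 := by gcongr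
      _ = 8 * (B.card : ℝ) ^ 3 := by ring
  have h8 : 4 * (pinnedMax B : ℝ) * isoscelesCount B ≤ 4 * pinnedMax A * (600 * q ^ 11) := by
    gcongr
  have h9 : q ^ 11 * q ^ 4 ≤ q ^ 11 * (19200 * pinnedMax A) := by
    calc q ^ 11 * q ^ 4 = q ^ 15 := by ring
      _ ≤ 8 * (4 * pinnedMax A * (600 * q ^ 11)) := by linarith
      _ = q ^ 11 * (19200 * pinnedMax A) := by ring
  have h10 := le_of_mul_le_mul_left h9 (by positivity)
  have : (0 : ℝ) ≤ pinnedMax A := Nat.cast_nonneg _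
  linarith

end Assembly

/-- Pinned Erdős–Falconer over `F_p`: there is an absolute constant `c > 0` such that for every
prime `p` and every `A ⊆ F_p²` with `|A| ≥ p^(5/4)` we have `Δ_pin(A) > c·p`. -/
theorem pinned_falconer :
    ∃ c : ℝ, 0 < c ∧
      ∀ p : ℕ, p.Prime →
        ∀ A : Finset (ZMod p × ZMod p),
          (p : ℝ) ^ ((5 : ℝ) / 4) ≤ (A.card : ℝ) →
          c * (p : ℝ) < (pinnedMax A : ℝ) := by
  refine ⟨1 / 10 ^ 33, by positivity, fun p hp A hA => ?_⟩
  have : Fact p.Prime := ⟨hp⟩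
  have hp0 : (0 : ℝ) < p := Nat.cast_pos.2 hp.pos
  rcases lt_or_ge p (10 ^ 32) with hsmall | hlarge
  · have hA0 : A.Nonempty := by
      rw [← Finset.card_pos]
      have : (0 : ℝ) < A.card := lt_of_lt_of_le (by positivity) hA
      exact_mod_cast this
    have h1 : (1 : ℝ) ≤ pinnedMax A := Nat.one_le_cast.2 (pinnedMax_pos hA0)
    have h2 : (p : ℝ) < 10 ^ 32 := by exact_mod_cast hsmall
    linarith
  · obtain ⟨i, hi⟩ := IsAlgClosed.exists_pow_nat_eq (-1 : AlgebraicClosure (ZMod p)) two_pos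
    have hpR : (10 : ℝ) ^ 32 ≤ p := by exact_mod_cast hlarge
    have hq4 : ((p : ℝ) ^ ((1 : ℝ) / 4)) ^ 4 = p := by
      rw [← Real.rpow_natCast, ← Real.rpow_mul hp0.le]
      norm_num
    have hq5 : ((p : ℝ) ^ ((1 : ℝ) / 4)) ^ 5 = (p : ℝ) ^ ((5 : ℝ) / 4) := by
      rw [← Real.rpow_natCast, ← Real.rpow_mul hp0.le]
      norm_num
    have hq : (10 : ℝ) ^ 8 ≤ (p : ℝ) ^ ((1 : ℝ) / 4) := by
      refine le_of_pow_le_pow_left₀ (n := 4) (by norm_num) (by positivity) ?_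
      rw [hq4]
      linarith
    have h2 : (2 : ZMod p) ≠ 0 := by
      intro h
      have := (ZMod.natCast_eq_zero_iff 2 p).1 (by exact_mod_cast h)
      have := Nat.le_of_dvd two_pos this
      omega
    have : CharP (AlgebraicClosure (ZMod p)) (Fintype.card (ZMod p)) := by
      rw [ZMod.card]
      infer_instance
    have h := pinnedMax_ge_of_large h2 hi hq (by rw [ZMod.card, hq4]) (A := A) (by rwa [hq5])
    rw [hq4] at h
    linarith

end Stmt0
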